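/- Let m ∈ ℕ, p_1 = ⋯ = p_{m+1} = 1 (so p = 1/(m+1)), and let ~w = (w_1,…,w_{m+1}) ∈ A_{(1,…,1)}(ℝ^{m+1}). Let A be a function on ℝ with A' ∈ BMO(ℝ) and ‖A'‖_{BMO(ℝ)} = 1. Then there is a constant C such that for every λ > 0, ν_w({x ∈ ℝ : |C_{m+1,A}(a_1,…,a_m; f)(x)| > λ}) ≤ C (∏_{j=1}^m ∫_ℝ (|a_j(y_j)|/λ^{1/(m+1)}) log(e + |a_j(y_j)|/λ^{1/(m+1)}) w_j(y_j) dy_j)^{1/(m+1)} · (∫_ℝ (|f(y)|/λ^{1/(m+1)}) log(e + |f(y)|/λ^{1/(m+1)}) w_{m+1}(y) dy)^{1/(m+1)}. -/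

import Mathlib

open MeasureTheory Filter Set
open scoped ENNReal BigOperators

noncomputable section

/-- `Adiff g x y = ∫_y^x g`, i.e. `G x - G y` for an antiderivative `G` of `g`. -/
def Adiff (g : ℝ → ℝ) (x y : ℝ) : ℝ := ∫ t in y..x, g t

/-- `P₂(A; x, y) = A x - A y - A' y * (x - y)`. -/
def P2 (A A' : ℝ → ℝ) (x y : ℝ) : ℝ := A x - A y - A' y * (x - y)

/-- The generalized Calderón commutator `𝒞_{m+1,A}(a₁,…,a_m; f)`, defined as a
principal value. -/
def CcommA (m : ℕ) (A A' : ℝ → ℝ) (a : Fin m → ℝ → ℝ) (f : ℝ → ℝ) (x : ℝ) : ℝ :=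
  limUnder (nhdsWithin 0 (Ioi 0)) fun ε : ℝ =>
    ∫ y in {y : ℝ | ε < |x - y|},
      (P2 A A' x y * ∏ j, Adiff (a j) x y) / (x - y) ^ (m + 2) * f y

/-- The `(m+1)`-th order Calderón commutator `𝒞_{m+1}(a₁,…,a_m; f)`. -/
def Ccomm (m : ℕ) (a : Fin m → ℝ → ℝ) (f : ℝ → ℝ) (x : ℝ) : ℝ :=
  limUnder (nhdsWithin 0 (Ioi 0)) fun ε : ℝ =>
    ∫ y in {y : ℝ | ε < |x - y|},
      (∏ j, Adiff (a j) x y) / (x - y) ^ (m + 1) * f y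

/-- The BMO norm of `g` over intervals in `ℝ`. -/
def bmoNorm (g : ℝ → ℝ) : ℝ :=
  sSup {c : ℝ | ∃ u v : ℝ, u < v ∧
    c = (v - u)⁻¹ * ∫ y in Ioc u v, |g y - (v - u)⁻¹ * ∫ z in Ioc u v, g z|}

/-- Average (in `ℝ≥0∞`) of a nonnegative function over an interval. -/
def avgE (g : ℝ → ℝ) (u v : ℝ) : ℝ≥0∞ :=
  (ENNReal.ofReal (v - u))⁻¹ * ∫⁻ y in Ioc u v, ENNReal.ofReal (g y)

/-- Weighted `L^p` norm `(∫ |g|^p w)^{1/p}`. -/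
def wLpNorm (p : ℝ) (w g : ℝ → ℝ) : ℝ≥0∞ :=
  (∫⁻ x, ENNReal.ofReal (|g x| ^ p * w x)) ^ (1 / p)

/-- `L^p` norm. -/
def LpNorm (p : ℝ) (g : ℝ → ℝ) : ℝ≥0∞ :=
  (∫⁻ x, ENNReal.ofReal (|g x| ^ p)) ^ (1 / p)

/-- Weak `L^p` quasinorm. -/
def wkNorm (p : ℝ) (g : ℝ → ℝ) : ℝ≥0∞ :=
  ⨆ (t : ℝ) (_ : 0 < t), ENNReal.ofReal t * (volume {x : ℝ | t < |g x|}) ^ (1 / p)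

/-- The multiple weight `ν_{→w} = ∏ w_i^{p/p_i}`. -/
def nuW (k : ℕ) (ptot : ℝ) (p : Fin k → ℝ) (w : Fin k → ℝ → ℝ) : ℝ → ℝ :=
  fun x => ∏ i, w i x ^ (ptot / p i)

/-- The multilinear Muckenhoupt `A_{→P}` constant (for exponents `p i > 1`). -/
def APconst (k : ℕ) (ptot : ℝ) (p : Fin k → ℝ) (w : Fin k → ℝ → ℝ) : ℝ≥0∞ :=
  ⨆ (u : ℝ) (v : ℝ) (_ : u < v),
    avgE (nuW k ptot p w) u v *
      ∏ i, (avgE (fun y => w i y ^ (-(1 / (p i - 1)))) u v) ^ (ptot * (1 - 1 / p i))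

/-- Hardy–Littlewood maximal operator on `ℝ` (over intervals). -/
def Mop1 (g : ℝ → ℝ) (x : ℝ) : ℝ≥0∞ :=
  ⨆ (u : ℝ) (v : ℝ) (_ : u < v) (_ : x ∈ Ioc u v), avgE (fun y => |g y|) u v

/-- The Fujii–Wilson `A_∞` constant of a weight `u` on `ℝ`. -/
def AinfConst (u : ℝ → ℝ) : ℝ≥0∞ :=
  ⨆ (c : ℝ) (d : ℝ) (_ : c < d),
    (∫⁻ y in Ioc c d, ENNReal.ofReal (u y))⁻¹ *
      ∫⁻ x in Ioc c d, Mop1 (Set.indicator (Ioc c d) u) x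

/-- The `A_{(1,…,1)}` constant of a vector weight. -/
def A11const (k : ℕ) (w : Fin k → ℝ → ℝ) : ℝ≥0∞ :=
  ⨆ (u : ℝ) (v : ℝ) (_ : u < v),
    avgE (fun x => ∏ i, w i x ^ ((1 : ℝ) / k)) u v *
      ∏ i, ((ENNReal.ofReal (essInf (w i) (volume.restrict (Ioc u v))))⁻¹) ^ ((1 : ℝ) / k)

/-- Luxemburg norm `‖f‖_{L(log L)^γ, (u,v)}` over the interval `(u, v]`. -/
def luxNormI (γ : ℝ) (u v : ℝ) (f : ℝ → ℝ) : ℝ :=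
  sInf {t : ℝ | 0 < t ∧
    ∫⁻ y in Ioc u v, ENNReal.ofReal (|f y| / t * Real.log (Real.exp 1 + |f y| / t) ^ γ)
      ≤ ENNReal.ofReal (v - u)}

/-- The interval with the same center as `(u,v]` and `lam` times its length. -/
def scaleI (lam u v : ℝ) : ℝ × ℝ :=
  ((u + v) / 2 - lam * (v - u) / 2, (u + v) / 2 + lam * (v - u) / 2)

/-- Maximal operator `M_{L log L}` on `ℝ`. -/
def MLlogL (f : ℝ → ℝ) (x : ℝ) : ℝ≥0∞ :=
  ⨆ (u : ℝ) (v : ℝ) (_ : u < v) (_ : x ∈ Ioc u v), ENNReal.ofReal (luxNormI 1 u v f)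

/-- John–Strömberg sharp maximal operator `M^♯_{0,s}` on `ℝ`. -/
def Msharp1 (s : ℝ) (g : ℝ → ℝ) (x : ℝ) : ℝ≥0∞ :=
  ⨆ (u : ℝ) (v : ℝ) (_ : u < v) (_ : x ∈ Ioc u v),
    ⨅ (b : ℝ), ⨅ (t : ℝ) (_ : 0 < t)
      (_ : volume {y ∈ Ioc u v | t < |g y - b|} < ENNReal.ofReal s * volume (Ioc u v)),
      ENNReal.ofReal t

/-- Membership in BMO(ℝ). -/
def MemBMO (g : ℝ → ℝ) : Prop :=
  ∃ M : ℝ, ∀ u v : ℝ, u < v →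
    (v - u)⁻¹ * (∫ y in Ioc u v, |g y - (v - u)⁻¹ * ∫ z in Ioc u v, g z|) ≤ M

end

lemma vitali_intervals (t : Set (ℝ × ℝ)) (R : ℝ) (ht : ∀ p ∈ t, p.1 < p.2)
    (hR : ∀ p ∈ t, p.2 - p.1 ≤ R) :
    ∃ u ⊆ t, u.Countable ∧ (u.PairwiseDisjoint fun p => Icc p.1 p.2) ∧
      ∀ p ∈ t, ∃ b ∈ u, Icc p.1 p.2 ⊆ Icc (b.1 - 2 * (b.2 - b.1)) (b.2 + 2 * (b.2 - b.1)) := by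
  obtain ⟨u, hut, hd, hc⟩ := Vitali.exists_disjoint_subfamily_covering_enlargement_closedBall t
    (fun p : ℝ × ℝ => (p.1 + p.2) / 2) (fun p => (p.2 - p.1) / 2) (R / 2)
    (fun p hp => by have := hR p hp; linarith) 5 (by norm_num)
  have e : ∀ p : ℝ × ℝ, Metric.closedBall ((p.1 + p.2) / 2) ((p.2 - p.1) / 2) = Icc p.1 p.2 := by
    intro p
    rw [Real.closedBall_eq_Icc]
    congr 1 <;> ring
  have e' : ∀ p : ℝ × ℝ, Metric.closedBall ((p.1 + p.2) / 2) (5 * ((p.2 - p.1) / 2)) =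
      Icc (p.1 - 2 * (p.2 - p.1)) (p.2 + 2 * (p.2 - p.1)) := by
    intro p
    rw [Real.closedBall_eq_Icc]
    congr 1 <;> ring
  simp only [e, e'] at hd hc
  refine ⟨u, hut, ?_, hd, hc⟩
  refine hd.countable_of_nonempty_interior fun p hp => ?_
  rw [interior_Icc]
  exact nonempty_Ioo.2 (ht p (hut hp))

/-- points contained in an interval over which the average of `h` exceeds `L` -/
def Bad (h : ℝ → ℝ) (L : ℝ) : Set ℝ :=
  {x | ∃ u v, u ≤ x ∧ x ≤ v ∧ u < v ∧ L * (v - u) < ∫ t in u..v, h t}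

lemma isOpen_Bad {h : ℝ → ℝ} (hi : Integrable h) (L : ℝ) : IsOpen (Bad h L) := by
  rw [isOpen_iff_mem_nhds]
  rintro x ⟨u, v, hu, hv, huv, hl⟩
  have hc : Continuous fun d : ℝ => (∫ t in (u - d)..(v + d), h t) - L * ((v + d) - (u - d)) := by
    have h1 : ∀ d : ℝ, (∫ t in (u - d)..(v + d), h t) =
        (∫ t in (0 : ℝ)..(v + d), h t) - ∫ t in (0 : ℝ)..(u - d), h t := fun d =>
      (intervalIntegral.integral_interval_sub_left hi.intervalIntegrable
        hi.intervalIntegrable).symm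
    simp only [h1]
    have h2 : Continuous fun b => ∫ t in (0 : ℝ)..b, h t :=
      intervalIntegral.continuous_primitive (fun a b => hi.intervalIntegrable) 0
    have h3 := h2.comp (f := fun d : ℝ => v + d) (by fun_prop)
    have h4 := h2.comp (f := fun d : ℝ => u - d) (by fun_prop)
    exact (h3.sub h4).sub (by fun_prop)
  have h0 : ∀ᶠ d in nhds (0 : ℝ),
      0 < (∫ t in (u - d)..(v + d), h t) - L * ((v + d) - (u - d)) := by
    have := hc.tendsto 0
    refine this.eventually (lt_mem_nhds ?_)
    simp only [sub_zero, add_zero]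
    linarith
  obtain ⟨e, he, hb⟩ := Metric.eventually_nhds_iff.1 h0
  have hd := @hb (e / 2) (by rw [Real.dist_eq, sub_zero, abs_of_pos (by linarith)]; linarith)
  refine mem_of_superset (Ioo_mem_nhds (show u - e / 2 < x by linarith)
    (show x < v + e / 2 by linarith)) fun y hy => ?_
  exact ⟨u - e / 2, v + e / 2, hy.1.le, hy.2.le, by linarith, by linarith⟩

lemma volume_Bad_le {h : ℝ → ℝ} (hi : Integrable h) (h0 : ∀ x, 0 ≤ h x) {L : ℝ} (hL : 0 < L) :
    volume (Bad h L) ≤ ENNReal.ofReal (5 * (∫ x, h x) / L) := by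
  set t : Set (ℝ × ℝ) := {p | p.1 < p.2 ∧ L * (p.2 - p.1) < ∫ t in p.1..p.2, h t} with ht
  have hle : ∀ p : ℝ × ℝ, p.1 < p.2 → ∫ t in p.1..p.2, h t ≤ ∫ x, h x := by
    intro p hp
    rw [intervalIntegral.integral_of_le hp.le]
    exact setIntegral_le_integral hi (ae_of_all _ h0)
  obtain ⟨u, hut, huc, hd, hc⟩ := vitali_intervals t ((∫ x, h x) / L) (fun p hp => hp.1)
    (fun p hp => by
      rw [le_div_iff₀ hL]
      have := hle p hp.1
      have := hp.2
      linarith)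
  have hsub : Bad h L ⊆ ⋃ b ∈ u, Icc (b.1 - 2 * (b.2 - b.1)) (b.2 + 2 * (b.2 - b.1)) := by
    rintro x ⟨c, d, h1, h2, h3, h4⟩
    obtain ⟨b, hb, hs⟩ := hc (c, d) ⟨h3, h4⟩
    exact mem_biUnion hb (hs ⟨h1, h2⟩)
  calc volume (Bad h L) ≤ ∑' b : u, volume (Icc (b.1.1 - 2 * (b.1.2 - b.1.1))
        (b.1.2 + 2 * (b.1.2 - b.1.1))) := (measure_mono hsub).trans (measure_biUnion_le _ huc _)
    _ ≤ ∑' b : u, ENNReal.ofReal (5 / L) * ∫⁻ x in Icc b.1.1 b.1.2, ENNReal.ofReal (h x) := by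
        refine ENNReal.tsum_le_tsum fun b => ?_
        have hb := hut b.2
        rw [Real.volume_Icc, ← ofReal_integral_eq_lintegral_ofReal hi.integrableOn
          (ae_of_all _ h0), ← ENNReal.ofReal_mul (by positivity)]
        refine ENNReal.ofReal_le_ofReal ?_
        rw [integral_Icc_eq_integral_Ioc, ← intervalIntegral.integral_of_le hb.1.le]
        have := hb.2
        rw [div_mul_eq_mul_div, le_div_iff₀ hL]
        linarith
    _ = ENNReal.ofReal (5 / L) * ∫⁻ x in ⋃ b ∈ u, Icc b.1 b.2, ENNReal.ofReal (h x) := by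
        rw [ENNReal.tsum_mul_left, lintegral_biUnion huc (fun _ _ => measurableSet_Icc) hd]
    _ ≤ ENNReal.ofReal (5 / L) * ∫⁻ x, ENNReal.ofReal (h x) := by
        gcongr
        exact Measure.restrict_le_self
    _ = ENNReal.ofReal (5 * (∫ x, h x) / L) := by
        rw [← ofReal_integral_eq_lintegral_ofReal hi (ae_of_all _ h0),
          ← ENNReal.ofReal_mul (by positivity)]
        congr 1; ring

/-- basic consequence of being outside a bad set -/
lemma not_Bad_le {h : ℝ → ℝ} {L x u v : ℝ} (hx : x ∉ Bad h L) (h1 : u ≤ x) (h2 : x ≤ v)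
    (h3 : u ≤ v) : ∫ t in u..v, h t ≤ L * (v - u) := by
  rcases h3.eq_or_lt with rfl | h3
  · simp
  · by_contra hc
    exact hx ⟨u, v, h1, h2, h3, not_le.1 hc⟩

/-- kernel of the commutator -/
noncomputable def Kq (m : ℕ) (a : Fin m → ℝ → ℝ) (x y : ℝ) : ℝ :=
  (∏ j, Adiff (a j) x y / (x - y)) / (x - y)

/-- truncated operator -/
noncomputable def Tr (m : ℕ) (a : Fin m → ℝ → ℝ) (f : ℝ → ℝ) (e x : ℝ) : ℝ :=
  ∫ y in {y : ℝ | e < |x - y|}, Kq m a x y * f y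

lemma measurableSet_trunc (e x : ℝ) : MeasurableSet {y : ℝ | e < |x - y|} :=
  measurableSet_lt measurable_const (by fun_prop)

lemma Adiff_continuous {g : ℝ → ℝ} (hg : Integrable g) :
    Continuous fun p : ℝ × ℝ => Adiff g p.1 p.2 := by
  have h1 : ∀ p : ℝ × ℝ, Adiff g p.1 p.2 =
        (∫ t in (0 : ℝ)..p.1, g t) - ∫ t in (0 : ℝ)..p.2, g t := fun d =>
      (intervalIntegral.integral_interval_sub_left hg.intervalIntegrable
        hg.intervalIntegrable).symm
  simp only [h1]
  have h2 : Continuous fun b => ∫ t in (0 : ℝ)..b, g t :=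
      intervalIntegral.continuous_primitive (fun a b => hg.intervalIntegrable) 0
  exact (h2.comp continuous_fst).sub (h2.comp continuous_snd)

lemma Kq_measurable {m : ℕ} {a : Fin m → ℝ → ℝ} (ha : ∀ j, Integrable (a j)) :
    Measurable fun p : ℝ × ℝ => Kq m a p.1 p.2 := by
  unfold Kq
  have := fun j => (Adiff_continuous (ha j)).measurable
  have h2 : Measurable fun p : ℝ × ℝ => p.1 - p.2 := by fun_prop
  exact (Finset.measurable_prod _ fun j _ => (this j).div h2).div h2

lemma Kq_measurable_right {m : ℕ} {a : Fin m → ℝ → ℝ} (ha : ∀ j, Integrable (a j)) (x : ℝ) :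
    Measurable fun y : ℝ => Kq m a x y := by
  have h : Measurable (Function.uncurry (Kq m a)) := Kq_measurable ha
  exact h.of_uncurry_left

lemma abs_Adiff_le {g : ℝ → ℝ} (hg : Integrable g) (x y : ℝ) : |Adiff g x y| ≤ ∫ t, |g t| := by
  unfold Adiff
  rw [← Real.norm_eq_abs]
  refine (intervalIntegral.norm_integral_le_integral_norm_uIoc).trans ?_
  simp only [Real.norm_eq_abs]
  exact setIntegral_le_integral hg.abs (ae_of_all _ fun _ => abs_nonneg _)

lemma Kq_abs_le {m : ℕ} {a : Fin m → ℝ → ℝ} {x y : ℝ} {α : Fin m → ℝ}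
    (h : ∀ j, |Adiff (a j) x y| ≤ α j * |x - y|) : |Kq m a x y| ≤ (∏ j, α j) / |x - y| := by
  unfold Kq
  rw [abs_div, Finset.abs_prod]
  rcases eq_or_ne x y with rfl | hxy
  · simp
  gcongr with j
  rw [abs_div, div_le_iff₀ (abs_pos.2 (sub_ne_zero.2 hxy))]
  exact h j

lemma Tr_integrable {m : ℕ} {a : Fin m → ℝ → ℝ} (ha : ∀ j, Integrable (a j)) {f : ℝ → ℝ}
    (hf : Integrable f) {e : ℝ} (he : 0 < e) (x : ℝ) :
    IntegrableOn (fun y => Kq m a x y * f y) {y : ℝ | e < |x - y|} := by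
  refine Integrable.bdd_mul (c := (∏ j, (∫ t, |a j t|) / e) / e) hf.integrableOn
    (Kq_measurable_right ha x).aestronglyMeasurable ?_
  refine (ae_restrict_iff' (measurableSet_trunc e x)).2 (ae_of_all _ fun y hy => ?_)
  simp only [mem_ofPred_eq] at hy
  rw [Real.norm_eq_abs]
  refine (Kq_abs_le (α := fun j => (∫ t, |a j t|) / e) fun j => ?_).trans ?_
  · rw [div_mul_eq_mul_div, le_div_iff₀ he]
    exact mul_le_mul (abs_Adiff_le (ha j) x y) hy.le he.le (integral_nonneg fun _ => abs_nonneg _)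
  · have : 0 ≤ ∏ j, (∫ t, |a j t|) / e := Finset.prod_nonneg fun j _ =>
      div_nonneg (integral_nonneg fun _ => abs_nonneg _) he.le
    gcongr

lemma Kq_eq (m : ℕ) (a : Fin m → ℝ → ℝ) (x y : ℝ) :
    Kq m a x y = (∏ j, Adiff (a j) x y) / (x - y) ^ (m + 1) := by
  unfold Kq
  rw [Finset.prod_div_distrib, Finset.prod_const, Finset.card_univ, Fintype.card_fin, div_div,
    pow_succ]

/-- symmetrised product of kernels -/
def Sk (k : ℝ → ℝ → ℝ) (p : ℝ × ℝ × ℝ) : ℝ :=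
  k p.1 p.2.1 * k p.1 p.2.2 + k p.2.1 p.1 * k p.2.1 p.2.2 + k p.2.2 p.1 * k p.2.2 p.2.1

section symm
variable {μ : Measure ℝ} [IsFiniteMeasure μ] {k : ℝ → ℝ → ℝ} {M : ℝ}

lemma integrable_bdd3 {g : ℝ × ℝ × ℝ → ℝ} (hg : Measurable g) {C : ℝ} (hC : ∀ p, |g p| ≤ C) :
    Integrable g (μ.prod (μ.prod μ)) :=
  Integrable.of_bound hg.aestronglyMeasurable C (ae_of_all _ hC)

lemma integrable_bdd2 {g : ℝ × ℝ → ℝ} (hg : Measurable g) {C : ℝ} (hC : ∀ p, |g p| ≤ C) :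
    Integrable g (μ.prod μ) :=
  Integrable.of_bound hg.aestronglyMeasurable C (ae_of_all _ hC)

lemma integrable_bdd1 {g : ℝ → ℝ} (hg : Measurable g) {C : ℝ} (hC : ∀ p, |g p| ≤ C) :
    Integrable g μ :=
  Integrable.of_bound hg.aestronglyMeasurable C (ae_of_all _ hC)

lemma kT_measurable (hk : Measurable (Function.uncurry k)) {f : ℝ → ℝ} (hf : Measurable f) :
    Measurable fun x => ∫ y, k x y * f y ∂μ := by
  have : Measurable fun p : ℝ × ℝ => k p.1 p.2 * f p.2 := hk.mul (hf.comp measurable_snd)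
  exact (this.stronglyMeasurable.integral_prod_right (ν := μ)).measurable

lemma kT_bound (hM : ∀ x y, |k x y| ≤ M) {f : ℝ → ℝ} 
    (hf1 : ∀ x, |f x| ≤ 1) (x : ℝ) : |∫ y, k x y * f y ∂μ| ≤ M * μ.real univ := by
  rw [← Real.norm_eq_abs]
  refine norm_integral_le_of_norm_le_const (ae_of_all _ fun y => ?_)
  rw [Real.norm_eq_abs, abs_mul]
  have := hM x y
  have := hf1 y
  have := abs_nonneg (k x y)
  nlinarith [abs_nonneg (f y)]

lemma Sk_measurable (hk : Measurable (Function.uncurry k)) : Measurable (Sk k) := by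
  have h : ∀ {g h : ℝ × ℝ × ℝ → ℝ}, Measurable g → Measurable h →
      Measurable fun p => k (g p) (h p) := fun hg hh => hk.comp (hg.prodMk hh)
  unfold Sk
  refine ((Measurable.mul (h ?_ ?_) (h ?_ ?_)).add (Measurable.mul (h ?_ ?_) (h ?_ ?_))).add
    (Measurable.mul (h ?_ ?_) (h ?_ ?_)) <;> fun_prop

lemma Sk_bound (hM : ∀ x y, |k x y| ≤ M) (p : ℝ × ℝ × ℝ) : |Sk k p| ≤ 3 * M ^ 2 := by
  have h : ∀ a b c d, |k a b * k c d| ≤ M ^ 2 := by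
    intro a b c d
    rw [abs_mul, pow_two]
    exact mul_le_mul (hM _ _) (hM _ _) (abs_nonneg _) ((abs_nonneg _).trans (hM 0 0))
  unfold Sk
  refine (abs_add_le _ _).trans ?_
  have h1 := abs_add_le (k p.1 p.2.1 * k p.1 p.2.2) (k p.2.1 p.1 * k p.2.1 p.2.2)
  have h2 := h p.1 p.2.1 p.1 p.2.2
  have h3 := h p.2.1 p.1 p.2.1 p.2.2
  have h4 := h p.2.2 p.1 p.2.2 p.2.1
  linarith

lemma symm_identity (hk : Measurable (Function.uncurry k)) (hM : ∀ x y, |k x y| ≤ M)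
    {f : ℝ → ℝ} (hf : Measurable f) (hf1 : ∀ x, |f x| ≤ 1) :
    ∫ p, Sk k p * (f p.2.1 * f p.2.2) ∂(μ.prod (μ.prod μ)) =
      (∫ x, (∫ y, k x y * f y ∂μ) ^ 2 ∂μ) +
      2 * ∫ x, f x * (∫ y, k x y * 1 ∂μ) * (∫ y, k x y * f y ∂μ) ∂μ := by
  have h : ∀ {g h : ℝ × ℝ × ℝ → ℝ}, Measurable g → Measurable h →
      Measurable fun p => k (g p) (h p) := fun hg hh => hk.comp (hg.prodMk hh)
  have h2 : ∀ {g h : ℝ × ℝ → ℝ}, Measurable g → Measurable h →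
      Measurable fun p => k (g p) (h p) := fun hg hh => hk.comp (hg.prodMk hh)
  have hf' : ∀ {g : ℝ × ℝ × ℝ → ℝ}, Measurable g → Measurable fun p => f (g p) :=
    fun hg => hf.comp hg
  have hb : ∀ a b c d y z, |k a b * k c d * (f y * f z)| ≤ M ^ 2 * (1 * 1) := by
    intro a b c d y z
    have hM0 : 0 ≤ M := (abs_nonneg _).trans (hM 0 0)
    rw [abs_mul, abs_mul, abs_mul, pow_two]
    gcongr <;> first | exact hM _ _ | exact hf1 _
  have i1 : Integrable (fun p : ℝ × ℝ × ℝ => k p.1 p.2.1 * k p.1 p.2.2 * (f p.2.1 * f p.2.2))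
      (μ.prod (μ.prod μ)) := by
    refine integrable_bdd3 (Measurable.mul (Measurable.mul (h ?_ ?_) (h ?_ ?_))
      (Measurable.mul (hf' ?_) (hf' ?_))) (C := M ^ 2 * (1 * 1)) (fun p => hb _ _ _ _ _ _) <;> fun_prop
  have i2 : Integrable (fun p : ℝ × ℝ × ℝ => k p.2.1 p.1 * k p.2.1 p.2.2 * (f p.2.1 * f p.2.2))
      (μ.prod (μ.prod μ)) := by
    refine integrable_bdd3 (Measurable.mul (Measurable.mul (h ?_ ?_) (h ?_ ?_))
      (Measurable.mul (hf' ?_) (hf' ?_))) (C := M ^ 2 * (1 * 1)) (fun p => hb _ _ _ _ _ _) <;> fun_prop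
  have i3 : Integrable (fun p : ℝ × ℝ × ℝ => k p.2.2 p.1 * k p.2.2 p.2.1 * (f p.2.1 * f p.2.2))
      (μ.prod (μ.prod μ)) := by
    refine integrable_bdd3 (Measurable.mul (Measurable.mul (h ?_ ?_) (h ?_ ?_))
      (Measurable.mul (hf' ?_) (hf' ?_))) (C := M ^ 2 * (1 * 1)) (fun p => hb _ _ _ _ _ _) <;> fun_prop
  have hTm := kT_measurable (μ := μ) hk hf
  have hTb : ∀ x, |∫ y, k x y * f y ∂μ| ≤ M * μ.real univ := kT_bound hM hf1
  have e1 : ∫ p : ℝ × ℝ × ℝ, k p.1 p.2.1 * k p.1 p.2.2 * (f p.2.1 * f p.2.2) ∂(μ.prod (μ.prod μ))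
      = ∫ x, (∫ y, k x y * f y ∂μ) ^ 2 ∂μ := by
    rw [integral_prod _ i1]
    refine integral_congr_ae (ae_of_all _ fun x => ?_)
    simp only
    rw [pow_two, ← integral_prod_mul]
    congr 1; ext p; ring
  have i2' : Integrable (fun p : ℝ × ℝ => k p.2 p.1 * f p.2 * ∫ z, k p.2 z * f z ∂μ)
      (μ.prod μ) := by
    refine integrable_bdd2 (((h2 measurable_snd measurable_fst).mul (hf.comp measurable_snd)).mul
      (hTm.comp measurable_snd)) (C := M * 1 * (M * μ.real univ)) fun p => ?_
    have hM0 : 0 ≤ M := (abs_nonneg _).trans (hM 0 0)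
    rw [abs_mul, abs_mul]
    gcongr <;> first | exact hM _ _ | exact hf1 _ | exact hTb _
  have key : ∫ x, ∫ y, k y x * f y * (∫ z, k y z * f z ∂μ) ∂μ ∂μ =
      ∫ x, f x * (∫ y, k x y * 1 ∂μ) * (∫ y, k x y * f y ∂μ) ∂μ := by
    rw [integral_integral_swap i2']
    refine integral_congr_ae (ae_of_all _ fun y => ?_)
    simp only
    rw [integral_mul_const, integral_mul_const]
    simp only [mul_one]
    ring
  have e2 : ∫ p : ℝ × ℝ × ℝ, k p.2.1 p.1 * k p.2.1 p.2.2 * (f p.2.1 * f p.2.2) ∂(μ.prod (μ.prod μ))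
      = ∫ x, f x * (∫ y, k x y * 1 ∂μ) * (∫ y, k x y * f y ∂μ) ∂μ := by
    rw [integral_prod _ i2, ← key]
    refine integral_congr_ae ?_
    filter_upwards [i2.prod_right_ae] with x hx
    rw [integral_prod _ hx]
    refine integral_congr_ae (ae_of_all _ fun y => ?_)
    simp only
    rw [← integral_const_mul]
    congr 1; ext z; ring
  have e3 : ∫ p : ℝ × ℝ × ℝ, k p.2.2 p.1 * k p.2.2 p.2.1 * (f p.2.1 * f p.2.2) ∂(μ.prod (μ.prod μ))
      = ∫ x, f x * (∫ y, k x y * 1 ∂μ) * (∫ y, k x y * f y ∂μ) ∂μ := by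
    rw [integral_prod _ i3, ← key]
    refine integral_congr_ae ?_
    filter_upwards [i3.prod_right_ae] with x hx
    rw [integral_prod_symm _ hx]
    refine integral_congr_ae (ae_of_all _ fun y => ?_)
    simp only
    rw [← integral_const_mul]
    congr 1; ext z; ring
  have : ∀ p : ℝ × ℝ × ℝ, Sk k p * (f p.2.1 * f p.2.2) =
      k p.1 p.2.1 * k p.1 p.2.2 * (f p.2.1 * f p.2.2) +
      k p.2.1 p.1 * k p.2.1 p.2.2 * (f p.2.1 * f p.2.2) +
      k p.2.2 p.1 * k p.2.2 p.2.1 * (f p.2.1 * f p.2.2) := fun p => by unfold Sk; ring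
  simp only [this]
  rw [integral_add (by exact i1.add i2) i3, integral_add i1 i2, e1, e2, e3]
  ring

lemma symm_one (hk : Measurable (Function.uncurry k)) (hM : ∀ x y, |k x y| ≤ M) :
    3 * ∫ x, (∫ y, k x y * 1 ∂μ) ^ 2 ∂μ = ∫ p, Sk k p ∂(μ.prod (μ.prod μ)) := by
  have := symm_identity (μ := μ) hk hM (f := fun _ => 1) measurable_const (by simp)
  simp only [mul_one, one_mul] at this ⊢
  rw [this]
  simp only [pow_two]
  ring

lemma symm_bound (hk : Measurable (Function.uncurry k)) (hM : ∀ x y, |k x y| ≤ M)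
    {f : ℝ → ℝ} (hf : Measurable f) (hf1 : ∀ x, |f x| ≤ 1) :
    ∫ x, (∫ y, k x y * f y ∂μ) ^ 2 ∂μ ≤ 2 * (∫ p, |Sk k p| ∂(μ.prod (μ.prod μ))) +
      4 * ∫ x, (∫ y, k x y * 1 ∂μ) ^ 2 ∂μ := by
  have hI := symm_identity (μ := μ) hk hM hf hf1
  have hTm := kT_measurable (μ := μ) hk hf
  have hTb : ∀ x, |∫ y, k x y * f y ∂μ| ≤ M * μ.real univ := kT_bound hM hf1
  have hTm1 := kT_measurable (μ := μ) hk (f := fun _ => 1) measurable_const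
  have hTb1 : ∀ x, |∫ y, k x y * 1 ∂μ| ≤ M * μ.real univ := kT_bound hM (f := fun _ => 1) (by simp)
  set T := fun x => ∫ y, k x y * f y ∂μ with hT
  set U := fun x => ∫ y, k x y * 1 ∂μ with hU
  have hsq : ∀ {g : ℝ → ℝ}, Measurable g → (∀ x, |g x| ≤ M * μ.real univ) →
      Integrable (fun x => g x ^ 2) μ := by
    intro g hg hb
    refine integrable_bdd1 (by fun_prop) (C := (M * μ.real univ) ^ 2) fun x => ?_
    rw [abs_pow]
    gcongr
    exact hb x
  have j1 := hsq hTm hTb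
  have j2 := hsq hTm1 hTb1
  have hSi : Integrable (fun p => |Sk k p|) (μ.prod (μ.prod μ)) :=
    (integrable_bdd3 (Sk_measurable hk) (Sk_bound hM)).abs
  have b1 : |∫ p, Sk k p * (f p.2.1 * f p.2.2) ∂(μ.prod (μ.prod μ))| ≤
      ∫ p, |Sk k p| ∂(μ.prod (μ.prod μ)) := by
    refine (abs_integral_le_integral_abs).trans ?_
    refine integral_mono_of_nonneg (ae_of_all _ fun p => abs_nonneg _) hSi
      (ae_of_all _ fun p => ?_)
    simp only [abs_mul]
    have := hf1 p.2.1
    have := hf1 p.2.2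
    have h4 : |f p.2.1| * |f p.2.2| ≤ 1 := mul_le_one₀ (hf1 _) (abs_nonneg _) (hf1 _)
    nlinarith [abs_nonneg (Sk k p)]
  have b2 : |∫ x, f x * U x * T x ∂μ| ≤ ∫ x, (U x ^ 2 + T x ^ 2 / 4) ∂μ := by
    refine (abs_integral_le_integral_abs).trans ?_
    refine integral_mono_of_nonneg (ae_of_all _ fun p => abs_nonneg _) (j2.add (j1.div_const 4))
      (ae_of_all _ fun x => ?_)
    simp only [abs_mul]
    have h1 := hf1 x
    have h2 : |f x| * |U x| ≤ |U x| := by nlinarith [abs_nonneg (U x)]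
    have h3 : |f x| * |U x| * |T x| ≤ |U x| * |T x| := by gcongr
    have h4 := sq_nonneg (|U x| - |T x| / 2)
    rw [← sq_abs (U x), ← sq_abs (T x)]
    nlinarith
  rw [integral_add j2 (j1.div_const 4), integral_div] at b2
  have := abs_le.1 b1
  have := abs_le.1 b2
  linarith

end symm

lemma alg_prod_sub {ι : Type*} (s : Finset ι) (α γ g : ι → ℝ) (hγ : ∀ i, γ i = α i + g i)
    (h1 : ∀ i, |α i| ≤ 1) (h3 : ∀ i, |γ i| ≤ 1) :
    |(∏ i ∈ s, γ i) - ∏ i ∈ s, α i| ≤ ∑ i ∈ s, |g i| := by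
  classical
  induction s using Finset.induction_on with
  | empty => simp
  | insert i s hi ih =>
    rw [Finset.prod_insert hi, Finset.prod_insert hi, Finset.sum_insert hi]
    have e : γ i * (∏ i ∈ s, γ i) - α i * ∏ i ∈ s, α i =
        g i * (∏ i ∈ s, γ i) + α i * ((∏ i ∈ s, γ i) - ∏ i ∈ s, α i) := by
      rw [hγ i]; ring
    have hP : |∏ i ∈ s, γ i| ≤ 1 := by
      rw [Finset.abs_prod]
      exact Finset.prod_le_one (fun _ _ => abs_nonneg _) fun i _ => h3 i
    rw [e]
    refine (abs_add_le _ _).trans ?_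
    rw [abs_mul, abs_mul]
    have := h1 i
    have h5 : |g i| * |∏ i ∈ s, γ i| ≤ |g i| := by nlinarith [abs_nonneg (g i)]
    have h6 : |α i| * |(∏ i ∈ s, γ i) - ∏ i ∈ s, α i| ≤ ∑ i ∈ s, |g i| := by
      refine le_trans ?_ ih
      nlinarith [abs_nonneg ((∏ i ∈ s, γ i) - ∏ i ∈ s, α i)]
    linarith

lemma alg_P {ι : Type*} (s : Finset ι) (t : ℝ) (ht0 : 0 ≤ t) (ht1 : t ≤ 1) (α β γ g : ι → ℝ)
    (hγ : ∀ i, γ i = α i + g i) (hβ : ∀ i, β i = α i + t * g i)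
    (h1 : ∀ i, |α i| ≤ 1) (h2 : ∀ i, |β i| ≤ 1) (h3 : ∀ i, |γ i| ≤ 1) :
    |(1 - t) * ((∏ i ∈ s, β i) * ∏ i ∈ s, γ i) - (∏ i ∈ s, α i) * (∏ i ∈ s, γ i) +
      t * ((∏ i ∈ s, α i) * ∏ i ∈ s, β i)| ≤ t * (1 - t) * (∑ i ∈ s, |g i|) ^ 2 := by
  classical
  induction s using Finset.induction_on with
  | empty => simp
  | insert i s hi ih =>
    rw [Finset.prod_insert hi, Finset.prod_insert hi, Finset.prod_insert hi, Finset.sum_insert hi]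
    have hB : |∏ i ∈ s, β i| ≤ 1 := by
      rw [Finset.abs_prod]
      exact Finset.prod_le_one (fun _ _ => abs_nonneg _) fun i _ => h2 i
    have hG : |∏ i ∈ s, γ i| ≤ 1 := by
      rw [Finset.abs_prod]
      exact Finset.prod_le_one (fun _ _ => abs_nonneg _) fun i _ => h3 i
    have hD := alg_prod_sub s α γ g hγ h1 h3
    have hS : 0 ≤ ∑ i ∈ s, |g i| := Finset.sum_nonneg fun _ _ => abs_nonneg _
    set A := ∏ i ∈ s, α i
    set B := ∏ i ∈ s, β i
    set G := ∏ i ∈ s, γ i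
    set S := ∑ i ∈ s, |g i|
    set P := (1 - t) * (B * G) - A * G + t * (A * B) with hP
    have e : (1 - t) * (β i * B * (γ i * G)) - α i * A * (γ i * G) + t * (α i * A * (β i * B)) =
        (α i * γ i) * P + t * (1 - t) * (α i * g i * (B * (G - A)) + g i ^ 2 * (B * G)) := by
      rw [hP, hγ i, hβ i]; ring
    rw [e]
    have ht : 0 ≤ t * (1 - t) := mul_nonneg ht0 (by linarith)
    have b1 : |α i * γ i * P| ≤ t * (1 - t) * S ^ 2 := by
      rw [abs_mul]
      have : |α i * γ i| ≤ 1 := by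
        rw [abs_mul]; exact mul_le_one₀ (h1 i) (abs_nonneg _) (h3 i)
      nlinarith [abs_nonneg P]
    have b2 : |α i * g i * (B * (G - A))| ≤ |g i| * S := by
      rw [abs_mul, abs_mul, abs_mul]
      have c1 : |α i| * |g i| ≤ |g i| := by nlinarith [abs_nonneg (g i), h1 i]
      have c2 : |B| * |G - A| ≤ S := by nlinarith [abs_nonneg (G - A)]
      exact mul_le_mul c1 c2 (by positivity) (abs_nonneg _)
    have b3 : |g i ^ 2 * (B * G)| ≤ |g i| ^ 2 := by
      rw [abs_mul, abs_mul, abs_pow]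
      have : |B| * |G| ≤ 1 := mul_le_one₀ hB (abs_nonneg _) hG
      nlinarith [sq_nonneg |g i|]
    refine (abs_add_le _ _).trans ?_
    rw [abs_mul (t * (1 - t)), abs_of_nonneg ht]
    have b4 := abs_add_le (α i * g i * (B * (G - A))) (g i ^ 2 * (B * G))
    calc |α i * γ i * P| + t * (1 - t) * |α i * g i * (B * (G - A)) + g i ^ 2 * (B * G)|
        ≤ t * (1 - t) * S ^ 2 + t * (1 - t) * (|g i| * S + |g i| ^ 2) := by
          gcongr
          linarith
      _ ≤ t * (1 - t) * (|g i| + S) ^ 2 := by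
          rw [← mul_add]
          gcongr
          nlinarith [abs_nonneg (g i)]

/-- truncated kernel -/
noncomputable def kt (m : ℕ) (a : Fin m → ℝ → ℝ) (e x y : ℝ) : ℝ :=
  if e < |x - y| then Kq m a x y else 0

/-- error kernel -/
noncomputable def ke (e x y : ℝ) : ℝ := if e < |x - y| then e / (x - y) ^ 2 else 1 / e

lemma Sk_perm1 (k : ℝ → ℝ → ℝ) (x y z : ℝ) : Sk k (x, y, z) = Sk k (y, x, z) := by
  simp only [Sk]; ring

lemma Sk_perm2 (k : ℝ → ℝ → ℝ) (x y z : ℝ) : Sk k (x, y, z) = Sk k (x, z, y) := by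
  simp only [Sk]; ring

lemma Adiff_symm (g : ℝ → ℝ) (x y : ℝ) : Adiff g x y = - Adiff g y x :=
  intervalIntegral.integral_symm _ _

lemma Adiff_add {g : ℝ → ℝ} (hg : Integrable g) (x y z : ℝ) :
    Adiff g x y + Adiff g y z = Adiff g x z := by
  unfold Adiff
  rw [add_comm]
  exact intervalIntegral.integral_add_adjacent_intervals hg.intervalIntegrable
    hg.intervalIntegrable

/-- the key pointwise bound for ordered triples -/
lemma Kq_triple {m : ℕ} {a : Fin m → ℝ → ℝ} (ha : ∀ j, Integrable (a j))
    (h1 : ∀ j x y, |Adiff (a j) x y| ≤ |x - y|) {x y z : ℝ} (hxy : x < y) (hyz : y < z) :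
    |Sk (Kq m a) (x, y, z)| ≤ m * ∑ j, Sk (Kq 1 fun _ => a j) (x, y, z) := by
  have hL : 0 < z - x := by linarith
  set L := z - x with hLd
  set t := (y - x) / L with ht
  have ht0 : 0 < t := div_pos (by linarith) hL
  have ht1 : t < 1 := by rw [ht, div_lt_one hL]; linarith
  have hyx : y - x = t * L := by rw [ht]; field_simp
  have hzy : z - y = (1 - t) * L := by rw [ht]; field_simp; ring
  set α := fun j => Adiff (a j) y z / (y - z) with hα
  set β := fun j => Adiff (a j) x z / (x - z) with hβ
  set γ := fun j => Adiff (a j) x y / (x - y) with hγ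
  have hq : ∀ {x y} j, x ≠ y → |Adiff (a j) x y / (x - y)| ≤ 1 := by
    intro x y j hn
    rw [abs_div, div_le_one (abs_pos.2 (sub_ne_zero.2 hn))]
    exact h1 j x y
  have hq' : ∀ x y j, Adiff (a j) y x / (y - x) = Adiff (a j) x y / (x - y) := by
    intro x y j
    rw [Adiff_symm, ← neg_sub x y, neg_div_neg_eq]
  have h1t : 0 < 1 - t := by linarith
  have rel : ∀ j, β j = α j + t * (γ j - α j) := by
    intro j
    have := Adiff_add (ha j) x y z
    simp only [hα, hβ, hγ]
    rw [← this, show x - z = -L by rw [hLd]; ring, show y - z = -((1-t)*L) by rw [← hzy]; ring,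
      show x - y = -(t * L) by rw [← hyx]; ring]
    field_simp
    ring
  have hP := alg_P Finset.univ t ht0.le ht1.le α β γ (fun j => γ j - α j) (fun j => by ring)
    rel (fun j => hq j hyz.ne) (fun j => hq j (hxy.trans hyz).ne) (fun j => hq j hxy.ne)
  have hS : Sk (Kq m a) (x, y, z) = ((1 - t) * ((∏ i, β i) * ∏ i, γ i) - (∏ i, α i) * (∏ i, γ i) +
      t * ((∏ i, α i) * ∏ i, β i)) / (t * (1 - t) * L ^ 2) := by
    simp only [Sk, Kq]
    simp only [hq' x y, hq' x z, hq' y z]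
    rw [show x - z = -L by rw [hLd]; ring, show y - z = -((1-t)*L) by rw [← hzy]; ring,
      show x - y = -(t * L) by rw [← hyx]; ring, hyx, hzy, show z - x = L from rfl]
    have f1 : ∏ j, Adiff (a j) x y / -(t * L) = ∏ i, γ i := by
      simp only [hγ, show x - y = -(t * L) by rw [← hyx]; ring]
    have f2 : ∏ j, Adiff (a j) x z / -L = ∏ i, β i := by
      simp only [hβ, show x - z = -L by rw [hLd]; ring]
    have f3 : ∏ j, Adiff (a j) y z / -((1-t) * L) = ∏ i, α i := by
      simp only [hα, show y - z = -((1-t)*L) by rw [← hzy]; ring]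
    rw [f1, f2, f3]
    field_simp
    ring
  have hS1 : ∀ j, Sk (Kq 1 fun _ => a j) (x, y, z) = (γ j - α j) ^ 2 / L ^ 2 := by
    intro j
    simp only [Sk, Kq]
    simp only [hq' x y, hq' x z, hq' y z, Finset.univ_unique, Finset.prod_singleton]
    have f1 : Adiff (a j) x y / (x - y) = γ j := rfl
    have f2 : Adiff (a j) x z / (x - z) = β j := rfl
    have f3 : Adiff (a j) y z / (y - z) = α j := rfl
    rw [f1, f2, f3, rel j]
    rw [show x - z = -L by rw [hLd]; ring, show y - z = -((1-t)*L) by rw [← hzy]; ring,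
      show x - y = -(t * L) by rw [← hyx]; ring, hyx, hzy, show z - x = L from rfl]
    field_simp
    ring
  simp only [hS1]
  rw [hS, abs_div, abs_of_pos (show 0 < t * (1 - t) * L ^ 2 by positivity), ← Finset.sum_div,
    div_le_iff₀ (by positivity)]
  refine hP.trans ?_
  have hcs : (∑ j, |γ j - α j|) ^ 2 ≤ m * ∑ j, (γ j - α j) ^ 2 := by
    have := sq_sum_le_card_mul_sum_sq (s := (Finset.univ : Finset (Fin m)))
      (f := fun j => |γ j - α j|)
    simpa using this
  calc _ ≤ t * (1 - t) * (m * ∑ j, (γ j - α j) ^ 2) := by gcongr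
    _ = _ := by field_simp

lemma Kq_triple' {m : ℕ} {a : Fin m → ℝ → ℝ} (ha : ∀ j, Integrable (a j))
    (h1 : ∀ j x y, |Adiff (a j) x y| ≤ |x - y|) {x y z : ℝ} (hxy : x ≠ y) (hyz : y ≠ z)
    (hxz : x ≠ z) :
    |Sk (Kq m a) (x, y, z)| ≤ m * ∑ j, Sk (Kq 1 fun _ => a j) (x, y, z) := by
  rcases lt_or_gt_of_ne hxy with h | h <;> rcases lt_or_gt_of_ne hyz with h' | h' <;>
    rcases lt_or_gt_of_ne hxz with h'' | h''
  · exact Kq_triple ha h1 h h'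
  · linarith
  · have := Kq_triple ha h1 h'' h'
    simpa only [Sk_perm2 _ x z y] using this
  · have := Kq_triple ha h1 h'' h
    simpa only [Sk_perm1 _ z x y, Sk_perm2 _ x z y] using this
  · have := Kq_triple ha h1 h h''
    simpa only [Sk_perm1 _ y x z] using this
  · have := Kq_triple ha h1 h' h''
    simpa only [Sk_perm2 _ y z x, Sk_perm1 _ y x z] using this
  · linarith
  · have := Kq_triple ha h1 h' h
    simpa only [Sk_perm1 _ z y x, Sk_perm2 _ y z x, Sk_perm1 _ y x z] using this

lemma tail_integrable0 {r : ℝ} (hr : 0 < r) :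
    Integrable ({t : ℝ | r < |t|}.indicator fun t => (t ^ 2)⁻¹) := by
  refine Integrable.mono' (integrable_inv_one_add_sq.const_mul (1 + 1 / r ^ 2)) ?_ ?_
  · exact (Measurable.indicator (by fun_prop)
      (measurableSet_lt measurable_const (by fun_prop))).aestronglyMeasurable
  · refine ae_of_all _ fun t => ?_
    by_cases h : r < |t|
    · rw [indicator_of_mem (by exact h), Real.norm_eq_abs, abs_of_nonneg (by positivity)]
      have ht : r ^ 2 < t ^ 2 := by rw [← sq_abs t]; gcongr
      have : 0 < t ^ 2 := lt_trans (by positivity) ht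
      rw [inv_eq_one_div, div_le_iff₀ this, mul_assoc, inv_mul_eq_div, mul_div_assoc', le_div_iff₀ (by positivity), one_mul, add_mul, one_mul, div_mul_eq_mul_div, one_mul]
      have : 1 ≤ t ^ 2 / r ^ 2 := by rw [le_div_iff₀ (by positivity)]; linarith
      linarith
    · rw [indicator_of_notMem (by exact h)]
      simp; positivity

lemma tail_integral0 {r : ℝ} (hr : 0 < r) :
    ∫ t, ({t : ℝ | r < |t|}.indicator fun t => (t ^ 2)⁻¹) t = 2 / r := by
  have h1 : (fun t : ℝ => ({t : ℝ | r < |t|}.indicator fun t => (t ^ 2)⁻¹) t) =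
      fun t => (Ioi r).indicator (fun s : ℝ => s ^ (-2 : ℝ)) |t| := by
    ext t
    by_cases h : r < |t|
    · rw [indicator_of_mem (by exact h), indicator_of_mem (by exact h), Real.rpow_neg (abs_nonneg _)]
      norm_cast
      simp
    · rw [indicator_of_notMem (by exact h), indicator_of_notMem (by exact h)]
  rw [h1, integral_comp_abs, setIntegral_indicator measurableSet_Ioi]
  have : Ioi (0 : ℝ) ∩ Ioi r = Ioi r := by
    rw [Ioi_inter_Ioi]; congr 1; exact max_eq_right hr.le
  rw [this, integral_Ioi_rpow_of_lt (by norm_num) hr]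
  have : (-2 : ℝ) + 1 = -1 := by norm_num
  rw [this, Real.rpow_neg_one]
  ring

lemma tail_integrableOn {r : ℝ} (hr : 0 < r) (x : ℝ) :
    IntegrableOn (fun y : ℝ => ((x - y) ^ 2)⁻¹) {y | r < |x - y|} := by
  rw [← integrable_indicator_iff (measurableSet_trunc r x)]
  exact (tail_integrable0 hr).comp_sub_left x

lemma tail_integral {r : ℝ} (hr : 0 < r) (x : ℝ) :
    ∫ y in {y | r < |x - y|}, ((x - y) ^ 2)⁻¹ = 2 / r := by
  rw [← integral_indicator (measurableSet_trunc r x), ← tail_integral0 hr]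
  exact integral_sub_left_eq_self ({t : ℝ | r < |t|}.indicator fun t => (t ^ 2)⁻¹) volume x

lemma ke_measurable (e : ℝ) : Measurable (Function.uncurry (ke e)) := by
  refine Measurable.ite (measurableSet_lt measurable_const (by fun_prop)) ?_ measurable_const
  fun_prop

lemma ke_bound {e : ℝ} (he : 0 < e) (x y : ℝ) : |ke e x y| ≤ 1 / e := by
  unfold ke
  split_ifs with h
  · have : e ^ 2 < (x - y) ^ 2 := by rw [← sq_abs (x - y)]; gcongr
    have : 0 < (x - y) ^ 2 := by nlinarith
    rw [abs_of_nonneg (by positivity), div_le_div_iff₀ this he]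
    nlinarith
  · rw [abs_of_nonneg (by positivity)]

lemma ke_nonneg {e : ℝ} (he : 0 < e) (x y : ℝ) : 0 ≤ ke e x y := by
  unfold ke
  split_ifs <;> positivity

lemma ke_integrable {e : ℝ} (he : 0 < e) (x : ℝ) :
    Integrable (ke e x) ∧ ∫ y, ke e x y = 4 := by
  have h1 : ke e x = fun y => {y | e < |x - y|}.indicator (fun y => e * ((x - y) ^ 2)⁻¹) y +
      (Icc (x - e) (x + e)).indicator (fun _ => 1 / e) y := by
    ext y
    unfold ke
    split_ifs with h
    · rw [indicator_of_mem (by exact h), indicator_of_notMem, add_zero, div_eq_mul_inv]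
      intro h'
      exact absurd h (not_lt.2 (abs_le.2 ⟨by linarith [h'.2], by linarith [h'.1]⟩))
    · rw [indicator_of_notMem (by exact h), indicator_of_mem, zero_add]
      have := abs_le.1 (not_lt.1 h)
      exact ⟨by linarith, by linarith⟩
  have i1 : Integrable ({y | e < |x - y|}.indicator (fun y => e * ((x - y) ^ 2)⁻¹)) :=
    (integrable_indicator_iff (measurableSet_trunc e x)).2 ((tail_integrableOn he x).const_mul e)
  have i2 : Integrable ((Icc (x - e) (x + e)).indicator (fun _ => 1 / e)) := by
    refine (integrable_indicator_iff measurableSet_Icc).2 ?_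
    exact integrableOn_const (by simp)
  rw [h1]
  refine ⟨i1.add i2, ?_⟩
  rw [integral_add i1 i2, integral_indicator (measurableSet_trunc e x), integral_const_mul,
    tail_integral he, integral_indicator measurableSet_Icc, setIntegral_const]
  rw [Real.volume_real_Icc_of_le (by linarith)]
  simp only [smul_eq_mul]
  field_simp
  ring

lemma ke_Sk {u v : ℝ} (huv : u ≤ v) {e : ℝ} (he : 0 < e) (μ : Measure ℝ)
    (hμ : μ = volume.restrict (Ioc u v)) :
    ∫ p, Sk (ke e) p ∂(μ.prod (μ.prod μ)) ≤ 48 * (v - u) := by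
  have : IsFiniteMeasure μ := by rw [hμ]; infer_instance
  rw [← symm_one (ke_measurable e) (ke_bound he)]
  have h1 : ∀ x, (∫ y, ke e x y * 1 ∂μ) ^ 2 ≤ 16 := by
    intro x
    have h2 : ∫ y, ke e x y * 1 ∂μ ≤ 4 := by
      simp only [mul_one]
      rw [hμ, ← (ke_integrable he x).2]
      exact setIntegral_le_integral (ke_integrable he x).1 (ae_of_all _ fun y => ke_nonneg he x y)
    have h3 : 0 ≤ ∫ y, ke e x y * 1 ∂μ :=
      integral_nonneg fun y => mul_nonneg (ke_nonneg he x y) zero_le_one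
    nlinarith
  have h4 : ∫ x, (∫ y, ke e x y * 1 ∂μ) ^ 2 ∂μ ≤ ∫ x, (16 : ℝ) ∂μ :=
    integral_mono_of_nonneg (ae_of_all _ fun x => sq_nonneg _) (integrable_const _)
      (ae_of_all _ h1)
  rw [integral_const, hμ, smul_eq_mul, Measure.real, Measure.restrict_apply_univ, Real.volume_Ioc,
    ENNReal.toReal_ofReal (by linarith)] at h4
  subst hμ
  linarith

lemma kt_measurable {m : ℕ} {a : Fin m → ℝ → ℝ} (ha : ∀ j, Integrable (a j)) (e : ℝ) :
    Measurable (Function.uncurry (kt m a e)) := by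
  refine Measurable.ite (measurableSet_lt measurable_const (by fun_prop)) ?_ measurable_const
  exact Kq_measurable ha

lemma kt_sq {m : ℕ} {a : Fin m → ℝ → ℝ}
    (h1 : ∀ j x y, |Adiff (a j) x y| ≤ |x - y|) {e : ℝ} (x y : ℝ) :
    |kt m a e x y| ≤ if e < |x - y| then 1 / |x - y| else 0 := by
  unfold kt
  split_ifs
  · refine (Kq_abs_le (α := fun _ => 1) fun j => by rw [one_mul]; exact h1 j x y).trans ?_
    simp
  · simp

lemma kt_bound {m : ℕ} {a : Fin m → ℝ → ℝ}
    (h1 : ∀ j x y, |Adiff (a j) x y| ≤ |x - y|) {e : ℝ} (he : 0 < e) (x y : ℝ) :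
    |kt m a e x y| ≤ 1 / e := by
  refine (kt_sq h1 x y).trans ?_
  split_ifs with h
  · gcongr
  · positivity

/-- single term error estimate -/
lemma kt_term {m : ℕ} {a : Fin m → ℝ → ℝ}
    (h1 : ∀ j x y, |Adiff (a j) x y| ≤ |x - y|) {e : ℝ} (he : 0 < e) {x y z : ℝ}
    (h : ¬ (e < |x - y| ∧ e < |x - z| ∧ e < |y - z|)) :
    |kt m a e x y * kt m a e x z| ≤ (ke e y x * ke e y z + ke e z x * ke e z y) / 2 := by
  have hn := add_nonneg (mul_nonneg (ke_nonneg he y x) (ke_nonneg he y z))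
    (mul_nonneg (ke_nonneg he z x) (ke_nonneg he z y))
  rw [abs_mul]
  have b1 := kt_sq (e := e) h1 x y
  have b2 := kt_sq (e := e) h1 x z
  by_cases c1 : e < |x - y|
  · by_cases c2 : e < |x - z|
    · have c3 : ¬ e < |y - z| := fun c3 => h ⟨c1, c2, c3⟩
      have c3' : ¬ e < |z - y| := by rwa [abs_sub_comm]
      have c1' : e < |y - x| := by rwa [abs_sub_comm]
      have c2' : e < |z - x| := by rwa [abs_sub_comm]
      rw [if_pos c1] at b1
      rw [if_pos c2] at b2
      unfold ke
      rw [if_pos c1', if_pos c2', if_neg c3, if_neg c3']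
      have p1 : 0 < |x - y| := he.trans c1
      have p2 : 0 < |x - z| := he.trans c2
      have q1 : e / (y - x) ^ 2 * (1 / e) = (1 / |x - y|) ^ 2 := by
        rw [← sq_abs (y - x), abs_sub_comm y x]; field_simp
      have q2 : e / (z - x) ^ 2 * (1 / e) = (1 / |x - z|) ^ 2 := by
        rw [← sq_abs (z - x), abs_sub_comm z x]; field_simp
      rw [q1, q2]
      have := mul_le_mul b1 b2 (abs_nonneg _) (by positivity)
      nlinarith [sq_nonneg (1 / |x - y| - 1 / |x - z|)]
    · rw [if_neg c2] at b2
      rw [le_antisymm b2 (abs_nonneg _)]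
      linarith
  · rw [if_neg c1] at b1
    rw [le_antisymm b1 (abs_nonneg _)]
    linarith

lemma kt_err {m : ℕ} {a : Fin m → ℝ → ℝ}
    (h1 : ∀ j x y, |Adiff (a j) x y| ≤ |x - y|) {e : ℝ} (he : 0 < e) {x y z : ℝ}
    (h : ¬ (e < |x - y| ∧ e < |x - z| ∧ e < |y - z|)) :
    |Sk (kt m a e) (x, y, z)| ≤ Sk (ke e) (x, y, z) := by
  have t1 := kt_term h1 he h
  have t2 := kt_term (x := y) (y := x) (z := z) h1 he
    (by rw [abs_sub_comm y x]; tauto)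
  have t3 := kt_term (x := z) (y := x) (z := y) h1 he
    (by rw [abs_sub_comm z x, abs_sub_comm z y]; tauto)
  simp only [Sk]
  refine (abs_add_le _ _).trans ?_
  have := abs_add_le (kt m a e x y * kt m a e x z) (kt m a e y x * kt m a e y z)
  linarith

lemma ke_Sk_nonneg {e : ℝ} (he : 0 < e) (p : ℝ × ℝ × ℝ) : 0 ≤ Sk (ke e) p := by
  unfold Sk
  have := ke_nonneg he
  exact add_nonneg (add_nonneg (mul_nonneg (this _ _) (this _ _)) (mul_nonneg (this _ _)
    (this _ _))) (mul_nonneg (this _ _) (this _ _))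

lemma kt_main {m : ℕ} {a : Fin m → ℝ → ℝ} (ha : ∀ j, Integrable (a j))
    (h1 : ∀ j x y, |Adiff (a j) x y| ≤ |x - y|) {e : ℝ} (he : 0 < e) (p : ℝ × ℝ × ℝ) :
    |Sk (kt m a e) p| ≤ m * ∑ j, (Sk (kt 1 (fun _ => a j) e) p + Sk (ke e) p) +
      Sk (ke e) p := by
  obtain ⟨x, y, z⟩ := p
  have hn := ke_Sk_nonneg he (x, y, z)
  by_cases h : e < |x - y| ∧ e < |x - z| ∧ e < |y - z|
  · have hs : ∀ (n : ℕ) (b : Fin n → ℝ → ℝ), Sk (kt n b e) (x, y, z) = Sk (Kq n b) (x, y, z) := by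
      intro n b
      obtain ⟨h1, h2, h3⟩ := h
      simp only [Sk, kt, abs_sub_comm y x, abs_sub_comm z x, abs_sub_comm z y, if_pos h1,
        if_pos h2, if_pos h3]
    rw [hs]
    simp only [hs]
    have hne : ∀ {x y : ℝ}, e < |x - y| → x ≠ y := by
      rintro x y h rfl
      simp at h; linarith
    have := Kq_triple' ha h1 (hne h.1) (hne h.2.2) (hne h.2.1)
    rw [Finset.sum_add_distrib, mul_add]
    have : 0 ≤ (m : ℝ) * ∑ j : Fin m, Sk (ke e) (x, y, z) :=
      mul_nonneg (Nat.cast_nonneg _) (Finset.sum_nonneg fun _ _ => hn)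
    linarith
  · have := kt_err h1 he h
    have h3 : 0 ≤ ∑ j, (Sk (kt 1 (fun _ => a j) e) (x, y, z) + Sk (ke e) (x, y, z)) := by
      refine Finset.sum_nonneg fun j _ => ?_
      have := kt_err (m := 1) (a := fun _ => a j) (fun _ => h1 j) he h
      have := (abs_le.1 this).1
      linarith
    have : 0 ≤ (m : ℝ) * ∑ j, (Sk (kt 1 (fun _ => a j) e) (x, y, z) + Sk (ke e) (x, y, z)) :=
      mul_nonneg (Nat.cast_nonneg _) h3
    linarith

lemma trunc_ae {u v x e : ℝ} (hx : x ∈ Icc u v) (he : 0 < e) :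
    (Ioc u v ∩ {y : ℝ | e < |x - y|} : Set ℝ) =ᵐ[volume]
      (Ioc u (max u (x - e)) ∪ Ioc (min v (x + e)) v : Set ℝ) := by
  have hne : ∀ᵐ y : ℝ, y ≠ x - e := by
    simp [ae_iff]
  filter_upwards [hne] with y hy
  refine propext ?_
  change y ∈ (Ioc u v ∩ {y : ℝ | e < |x - y|} : Set ℝ) ↔ y ∈ (Ioc u (max u (x - e)) ∪ Ioc (min v (x + e)) v : Set ℝ)
  simp only [mem_inter_iff, mem_Ioc, mem_ofPred_eq, mem_union, lt_abs, le_max_iff, min_lt_iff]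
  obtain ⟨h1, h2⟩ := hx
  constructor
  · rintro ⟨⟨h3, h4⟩, h5 | h5⟩
    · exact Or.inl ⟨h3, Or.inr (by linarith)⟩
    · exact Or.inr ⟨Or.inr (by linarith), h4⟩
  · rintro (⟨h3, h4 | h4⟩ | ⟨h3 | h3, h4⟩)
    · linarith
    · have : y < x - e := lt_of_le_of_ne h4 hy
      exact ⟨⟨h3, by linarith⟩, Or.inl (by linarith)⟩
    · linarith
    · exact ⟨⟨by linarith, h4⟩, Or.inr (by linarith)⟩

lemma trunc_split {u v x e : ℝ} (hx : x ∈ Icc u v) (he : 0 < e) {h : ℝ → ℝ}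
    (hi : IntegrableOn h (Ioc u v ∩ {y : ℝ | e < |x - y|})) :
    ∫ y in Ioc u v ∩ {y : ℝ | e < |x - y|}, h y =
      (∫ y in u..(max u (x - e)), h y) + ∫ y in (min v (x + e))..v, h y := by
  rw [IntegrableOn, Measure.restrict_congr_set (trunc_ae hx he)] at hi
  rw [Measure.restrict_congr_set (trunc_ae hx he)]
  have hd : Disjoint (Ioc u (max u (x - e))) (Ioc (min v (x + e)) v) := by
    rw [Set.disjoint_left]
    intro y hy hy'
    have h1 := hy.2
    have h2 := hy'.1
    have h3 := hy.1
    have h4 := hy'.2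
    rw [le_max_iff] at h1
    rw [min_lt_iff] at h2
    rcases h1 with h1 | h1 <;> rcases h2 with h2 | h2 <;> linarith
  rw [setIntegral_union hd measurableSet_Ioc (IntegrableOn.left_of_union hi)
    (IntegrableOn.right_of_union hi),
    intervalIntegral.integral_of_le (le_max_left _ _),
    intervalIntegral.integral_of_le (min_le_left _ _)]

lemma Adiff_ac {a : ℝ → ℝ} (ha : Integrable a) (x c d : ℝ) :
    AbsolutelyContinuousOnInterval (fun y => Adiff a x y) c d := by
  have h1 : IntervalIntegrable a volume (min x c ⊓ d) (max x c ⊔ d) := ha.intervalIntegrable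
  have h2 := h1.absolutelyContinuousOnInterval_intervalIntegral (c := x)
    (by rw [mem_uIcc]; left; exact ⟨by simp, by simp⟩)
  have h3 := (h2.mono (c := c) (d := d) (by
    rw [uIcc_subset_uIcc_iff_mem, mem_uIcc, mem_uIcc]
    exact ⟨Or.inl ⟨by simp, by simp⟩, Or.inl ⟨by simp, by simp⟩⟩)).neg
  refine (congrArg (fun F => AbsolutelyContinuousOnInterval F c d) ?_).mp h3
  ext y
  simp only [Pi.neg_apply, Adiff]
  rw [intervalIntegral.integral_symm y x]; ring

lemma Adiff_ae_deriv {a : ℝ → ℝ} (ha : Integrable a) :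
    ∀ᵐ y, ∀ x, HasDerivAt (fun y => Adiff a x y) (-a y) y := by
  filter_upwards [_root_.LocallyIntegrable.ae_hasDerivAt_integral ha.locallyIntegrable] with y hy x
  refine (congrArg (fun F => HasDerivAt F (-a y) y) ?_).mp (hy x).neg
  ext z
  simp only [Pi.neg_apply, Adiff]
  rw [intervalIntegral.integral_symm z x]; ring

lemma ibp_one {a : ℝ → ℝ} (ha : Integrable a) (h1 : ∀ x y, |Adiff a x y| ≤ |x - y|)
    {x c d : ℝ} (hcd : c ≤ d) (hx : x ∉ Icc c d) :
    |∫ y in c..d, (Adiff a x y / (x - y) ^ 2 - a y / (x - y))| ≤ 2 := by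
  have hne : ∀ y ∈ uIcc c d, x - y ≠ 0 := by
    intro y hy h0
    rw [uIcc_of_le hcd] at hy
    rw [sub_eq_zero] at h0
    exact hx (h0 ▸ hy)
  have hg : AbsolutelyContinuousOnInterval (fun y => (x - y)⁻¹) c d := by
    refine ContDiffOn.absolutelyContinuousOnInterval ?_
    exact ContDiffOn.inv (by fun_prop) hne
  have hF := (Adiff_ac ha x c d).fun_mul hg
  have hI := hF.integral_deriv_eq_sub
  have he : ∫ y in c..d, (Adiff a x y / (x - y) ^ 2 - a y / (x - y)) =
      ∫ y in c..d, deriv (fun y => Adiff a x y * (x - y)⁻¹) y := by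
    refine intervalIntegral.integral_congr_ae ?_
    filter_upwards [Adiff_ae_deriv ha] with y hy hm
    have hn := hne y (uIoc_subset_uIcc hm)
    have h2 : HasDerivAt (fun y => (x - y)⁻¹) (1 / (x - y) ^ 2) y := by
      have := ((hasDerivAt_id y).const_sub x).fun_inv hn
      simpa using this
    rw [((hy x).fun_mul h2).deriv]
    ring
  rw [he, hI]
  have hb : ∀ y ∈ uIcc c d, |Adiff a x y * (x - y)⁻¹| ≤ 1 := by
    intro y hy
    rw [abs_mul, abs_inv, ← div_eq_mul_inv, div_le_one (abs_pos.2 (hne y hy))]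
    exact h1 x y
  have := abs_sub (Adiff a x d * (x - d)⁻¹) (Adiff a x c * (x - c)⁻¹)
  have := hb c left_mem_uIcc
  have := hb d right_mem_uIcc
  linarith

lemma kt_integral {m : ℕ} (a : Fin m → ℝ → ℝ) (f : ℝ → ℝ) (e x : ℝ) (u v : ℝ) :
    ∫ y in Ioc u v, kt m a e x y * f y = ∫ y in Ioc u v ∩ {y : ℝ | e < |x - y|}, Kq m a x y * f y := by
  rw [← setIntegral_indicator (measurableSet_trunc e x)]
  congr 1; ext y
  unfold kt
  by_cases h : e < |x - y|
  · rw [if_pos h, indicator_of_mem (by exact h)]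
  · rw [if_neg h, indicator_of_notMem (by exact h), zero_mul]

lemma kt_one_diff {a : ℝ → ℝ} (ha : Integrable a) (h1 : ∀ x y, |Adiff a x y| ≤ |x - y|)
    {u v x e : ℝ} (hx : x ∈ Icc u v) (he : 0 < e) :
    |(∫ y in Ioc u v, kt 1 (fun _ => a) e x y * 1) -
      ∫ y in Ioc u v, kt 0 Fin.elim0 e x y * a y| ≤ 4 := by
  rw [kt_integral (f := fun _ => (1:ℝ)), kt_integral]
  have i2 := (Tr_integrable (m := 0) (a := Fin.elim0) (fun j => j.elim0) ha he x).mono_set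
    (inter_subset_right (s := Ioc u v))
  have i1' : IntegrableOn (fun y => Kq 1 (fun _ => a) x y * (Ioc u v).indicator 1 y)
      {y | e < |x - y|} :=
    Tr_integrable (m := 1) (a := fun _ => a) (fun j => ha) (f := (Ioc u v).indicator 1)
      ((integrable_indicator_iff measurableSet_Ioc).2 (integrableOn_const (by simp))) he x
  have i1 : IntegrableOn (fun y => Kq 1 (fun _ => a) x y * 1) (Ioc u v ∩ {y | e < |x - y|}) := by
    refine (i1'.mono_set inter_subset_right).congr_fun (fun y hy => ?_)
      (measurableSet_Ioc.inter (measurableSet_trunc e x))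
    simp only
    rw [indicator_of_mem hy.1]; rfl
  rw [← integral_sub i1 i2, trunc_split hx he (h := fun y => Kq 1 (fun _ => a) x y * 1 - Kq 0 Fin.elim0 x y * a y) (by exact i1.sub i2)]
  have hk : ∀ y, Kq 1 (fun _ => a) x y * 1 - Kq 0 Fin.elim0 x y * a y =
      Adiff a x y / (x - y) ^ 2 - a y / (x - y) := by
    intro y
    simp only [Kq_eq, Finset.univ_unique, Finset.prod_singleton, Finset.univ_eq_empty,
      Finset.prod_empty]
    ring
  have b1 : |∫ y in u..(max u (x - e)), (Kq 1 (fun _ => a) x y * 1 - Kq 0 Fin.elim0 x y * a y)| ≤ 2 := by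
    simp only [hk]
    rcases le_or_gt (x - e) u with h | h
    · rw [max_eq_left h]; simp
    · rw [max_eq_right h.le]
      exact ibp_one ha h1 h.le (fun h' => by have := h'.2; linarith)
  have b2 : |∫ y in (min v (x + e))..v, (Kq 1 (fun _ => a) x y * 1 - Kq 0 Fin.elim0 x y * a y)| ≤ 2 := by
    simp only [hk]
    rcases le_or_gt v (x + e) with h | h
    · rw [min_eq_left h]; simp
    · rw [min_eq_right h.le]
      exact ibp_one ha h1 h.le (fun h' => by have := h'.1; linarith)
  refine (abs_add_le _ _).trans ?_
  linarith

lemma Adiff_le_of_bdd {a : ℝ → ℝ} (h : ∀ x, |a x| ≤ 1) (x y : ℝ) : |Adiff a x y| ≤ |x - y| := by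
  unfold Adiff
  have := intervalIntegral.norm_integral_le_of_norm_le_const (a := y) (b := x) (C := 1) (f := a)
    (fun t _ => h t)
  simpa using this

/-- local `L²` bound -/
theorem L2_bound {m : ℕ} {a : Fin m → ℝ → ℝ} (ha : ∀ j, Integrable (a j)) 
    (ham : ∀ j, Measurable (a j)) (ha1 : ∀ j x, |a j x| ≤ 1) {f : ℝ → ℝ} (hf : Measurable f)
    (hf1 : ∀ x, |f x| ≤ 1) {u v e : ℝ} (huv : u ≤ v) (he : 0 < e) :
    ∫ x in Ioc u v, (∫ y in Ioc u v, kt m a e x y * f y) ^ 2 ≤ (3680 * m ^ 2 + 160) * (v - u) := by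
  set μ := volume.restrict (Ioc u v) with hμ
  have : IsFiniteMeasure μ := by rw [hμ]; infer_instance
  have hE : ∫ p, Sk (ke e) p ∂(μ.prod (μ.prod μ)) ≤ 48 * (v - u) := ke_Sk huv he μ hμ
  have hEi : Integrable (Sk (ke e)) (μ.prod (μ.prod μ)) :=
    integrable_bdd3 (Sk_measurable (ke_measurable e)) (Sk_bound (ke_bound he))
  have hA : ∀ j x y, |Adiff (a j) x y| ≤ |x - y| := fun j => Adiff_le_of_bdd (ha1 j)
  have hSi : ∀ {n : ℕ} {b : Fin n → ℝ → ℝ}, (∀ j, Integrable (b j)) →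
      (∀ j x y, |Adiff (b j) x y| ≤ |x - y|) →
      Integrable (Sk (kt n b e)) (μ.prod (μ.prod μ)) := fun hb hb1 =>
    integrable_bdd3 (Sk_measurable (kt_measurable hb e)) (Sk_bound (kt_bound hb1 he))
  -- m = 0
  have z1 : ∫ p, |Sk (kt 0 Fin.elim0 e) p| ∂(μ.prod (μ.prod μ)) ≤ 48 * (v - u) := by
    refine le_trans (integral_mono (hSi (fun j => j.elim0) (fun j => j.elim0)).abs hEi ?_) hE
    intro p
    have := kt_main (m := 0) (a := Fin.elim0) (fun j => j.elim0) (fun j => j.elim0) he p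
    simpa using this
  have z2 := symm_one (μ := μ) (kt_measurable (m := 0) (a := Fin.elim0) (fun j => j.elim0) e)
    (kt_bound (fun j => j.elim0) he)
  have z3 := (le_abs_self _).trans
    (abs_integral_le_integral_abs (f := Sk (kt 0 Fin.elim0 e)) (μ := μ.prod (μ.prod μ)))
  have z4 : ∀ j, ∫ x, (∫ y, kt 0 Fin.elim0 e x y * a j y ∂μ) ^ 2 ∂μ ≤ 160 * (v - u) := by
    intro j
    have := symm_bound (μ := μ) (kt_measurable (m := 0) (a := Fin.elim0) (fun j => j.elim0) e)
      (kt_bound (fun j => j.elim0) he) (ham j) (ha1 j)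
    linarith
  -- m = 1
  have o1 : ∀ j, ∫ x, (∫ y, kt 1 (fun _ => a j) e x y * 1 ∂μ) ^ 2 ∂μ ≤ 352 * (v - u) := by
    intro j
    have i0 : Integrable (fun x => (∫ y, kt 0 Fin.elim0 e x y * a j y ∂μ) ^ 2) μ := by
      refine integrable_bdd1 ((kT_measurable (kt_measurable (fun j => j.elim0) e) (ham j)).pow_const 2)
        (C := (1 / e * μ.real univ) ^ 2) fun x => ?_
      rw [abs_pow]
      gcongr
      exact kT_bound (kt_bound (fun j => j.elim0) he) (ha1 j) x
    have h3 : ∫ x, (∫ y, kt 1 (fun _ => a j) e x y * 1 ∂μ) ^ 2 ∂μ ≤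
        ∫ x, (2 * (∫ y, kt 0 Fin.elim0 e x y * a j y ∂μ) ^ 2 + 32) ∂μ := by
      refine integral_mono_of_nonneg (ae_of_all _ fun x => sq_nonneg _)
        ((i0.const_mul 2).add (integrable_const _)) ?_
      rw [hμ]
      refine (ae_restrict_iff' measurableSet_Ioc).2 (ae_of_all _ fun x hx => ?_)
      have hd := kt_one_diff (ha j) (hA j) (Ioc_subset_Icc_self hx) he
      simp only
      set P := ∫ y in Ioc u v, kt 1 (fun _ => a j) e x y * 1
      set Q := ∫ y in Ioc u v, kt 0 Fin.elim0 e x y * a j y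
      obtain ⟨d1, d2⟩ := abs_le.1 hd
      nlinarith [sq_nonneg (P - 2 * Q), mul_nonneg (show 0 ≤ 4 - (P - Q) by linarith) (show 0 ≤ 4 + (P - Q) by linarith)]
    rw [integral_add (i0.const_mul 2) (integrable_const _), integral_const_mul, integral_const,
      smul_eq_mul] at h3
    have hr : μ.real univ = v - u := by
      rw [hμ, Measure.real, Measure.restrict_apply_univ, Real.volume_Ioc,
        ENNReal.toReal_ofReal (by linarith)]
    rw [hr] at h3
    have := z4 j
    linarith
  have o2 : ∀ j, ∫ p, Sk (kt 1 (fun _ => a j) e) p ∂(μ.prod (μ.prod μ)) ≤ 1056 * (v - u) := by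
    intro j
    rw [← symm_one (μ := μ) (kt_measurable (fun _ => ha j) e) (kt_bound (fun _ => hA j) he)]
    have := o1 j
    linarith
  -- general m
  have g1 : ∫ p, |Sk (kt m a e) p| ∂(μ.prod (μ.prod μ)) ≤ (1104 * m ^ 2 + 48) * (v - u) := by
    have h3 := integral_mono (hSi ha hA).abs (((integrable_finsetSum Finset.univ fun j _ =>
      (hSi (fun _ => ha j) (fun _ => hA j) : Integrable (Sk (kt 1 (fun _ => a j) e)) _).add
        hEi).const_mul (m : ℝ)).add hEi) (fun p => by
          simpa using kt_main ha hA he p)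
    refine h3.trans ?_
    simp only [Pi.add_apply]
    rw [integral_add _ hEi, integral_const_mul, integral_finsetSum]
    · have : ∀ j : Fin m, ∫ p, (Sk (kt 1 (fun _ => a j) e) p + Sk (ke e) p) ∂(μ.prod (μ.prod μ)) ≤
          1104 * (v - u) := by
        intro j
        rw [integral_add (hSi (fun _ => ha j) (fun _ => hA j)) hEi]
        have := o2 j
        linarith
      have h4 := Finset.sum_le_sum fun (j : Fin m) (_ : j ∈ Finset.univ) => this j
      rw [Finset.sum_const, Finset.card_univ, Fintype.card_fin, nsmul_eq_mul] at h4
      have h5 := mul_le_mul_of_nonneg_left h4 (Nat.cast_nonneg (α := ℝ) m)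
      refine (add_le_add h5 hE).trans (le_of_eq ?_)
      ring
    · intro j _
      exact (hSi (fun _ => ha j) (fun _ => hA j)).add hEi
    · exact (integrable_finsetSum Finset.univ fun j _ =>
        (hSi (fun _ => ha j) (fun _ => hA j) : Integrable (Sk (kt 1 (fun _ => a j) e)) _).add
        hEi).const_mul (m : ℝ)
  have g2 := symm_one (μ := μ) (kt_measurable ha e) (kt_bound hA he)
  have g3 := (le_abs_self _).trans
    (abs_integral_le_integral_abs (f := Sk (kt m a e)) (μ := μ.prod (μ.prod μ)))
  have g4 := symm_bound (μ := μ) (kt_measurable ha e) (kt_bound hA he) hf hf1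
  linarith

lemma prod_reg {ι : Type*} (s : Finset ι) {q q' α : ι → ℝ} {r : ℝ} (hα : ∀ j, 0 ≤ α j) 
    (h1 : ∀ j, |q j| ≤ α j) (h2 : ∀ j, |q' j| ≤ α j) (h3 : ∀ j, |q j - q' j| ≤ r * α j) :
    |∏ j ∈ s, q j - ∏ j ∈ s, q' j| ≤ s.card * r * ∏ j ∈ s, α j := by
  classical
  induction s using Finset.induction_on with
  | empty => simp
  | insert i s hi ih =>
    rw [Finset.prod_insert hi, Finset.prod_insert hi, Finset.prod_insert hi, Finset.card_insert_of_notMem hi]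
    have e : q i * ∏ j ∈ s, q j - q' i * ∏ j ∈ s, q' j =
      (q i - q' i) * ∏ j ∈ s, q j + q' i * (∏ j ∈ s, q j - ∏ j ∈ s, q' j) := by ring
    have hp : |∏ j ∈ s, q j| ≤ ∏ j ∈ s, α j := by
      rw [Finset.abs_prod]
      exact Finset.prod_le_prod (fun j _ => abs_nonneg _) (fun j _ => h1 j)
    have hp0 : 0 ≤ ∏ j ∈ s, α j := Finset.prod_nonneg (fun j _ => hα j)
    rw [e]
    refine (abs_add_le _ _).trans ?_
    rw [abs_mul, abs_mul]
    have t1 := mul_le_mul (h3 i) hp (abs_nonneg _) ((abs_nonneg _).trans (h3 i))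
    have t2 := mul_le_mul (h2 i) ih (abs_nonneg _) (hα i)
    push_cast
    nlinarith

lemma inv_reg {d d' D δ : ℝ} (hD : 0 < D) (h1 : D ≤ |d|) (h2 : D ≤ |d'|) (h3 : |d - d'| ≤ δ) :
    |d⁻¹ - d'⁻¹| ≤ δ / D ^ 2 := by
  have hd : d ≠ 0 := by intro h; rw [h, abs_zero] at h1; linarith
  have hd' : d' ≠ 0 := by intro h; rw [h, abs_zero] at h2; linarith
  rw [inv_sub_inv hd hd', abs_div, abs_sub_comm, abs_mul, sq]
  have : 0 ≤ δ := (abs_nonneg _).trans h3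
  gcongr

lemma Kq_sub_le {m : ℕ} {a : Fin m → ℝ → ℝ} {α : Fin m → ℝ} (hα : ∀ j, 0 ≤ α j)
    {x y x' y' D δ : ℝ} (hD : 0 < D)
    (h1 : ∀ j, |Adiff (a j) x y| ≤ α j * |x - y|) (h2 : ∀ j, |Adiff (a j) x' y'| ≤ α j * |x' - y'|)
    (h3 : ∀ j, |Adiff (a j) x y - Adiff (a j) x' y'| ≤ α j * δ)
    (h4 : |(x - y) - (x' - y')| ≤ δ) (h5 : D ≤ |x - y|) (h6 : D ≤ |x' - y'|) :
    |Kq m a x y - Kq m a x' y'| ≤ (2 * m + 1) * (∏ j, α j) * δ / D ^ 2 := by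
  have hδ : 0 ≤ δ := (abs_nonneg _).trans h4
  have hx : 0 < |x - y| := hD.trans_le h5
  have hx' : 0 < |x' - y'| := hD.trans_le h6
  have q1 : ∀ j, |Adiff (a j) x y / (x - y)| ≤ α j := fun j => by
    rw [abs_div, div_le_iff₀ hx]; exact h1 j
  have q2 : ∀ j, |Adiff (a j) x' y' / (x' - y')| ≤ α j := fun j => by
    rw [abs_div, div_le_iff₀ hx']; exact h2 j
  have q3 : ∀ j, |Adiff (a j) x y / (x - y) - Adiff (a j) x' y' / (x' - y')| ≤ (2 * δ / D) * α j := by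
    intro j
    have e : Adiff (a j) x y / (x - y) - Adiff (a j) x' y' / (x' - y') =
      (Adiff (a j) x y - Adiff (a j) x' y') / (x - y) + 
        Adiff (a j) x' y' / (x' - y') * (((x' - y') - (x - y)) / (x - y)) := by
      have := abs_pos.1 hx
      have := abs_pos.1 hx'
      field_simp
      ring
    rw [e]
    refine (abs_add_le _ _).trans ?_
    rw [abs_mul, abs_div (Adiff (a j) x y - Adiff (a j) x' y'), abs_div ((x' - y') - (x - y)), abs_sub_comm (x' - y')]
    have t1 : |Adiff (a j) x y - Adiff (a j) x' y'| / |x - y| ≤ α j * δ / D := by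
      have := mul_nonneg (hα j) hδ
      have := h3 j
      gcongr
    have t2 : |(x - y) - (x' - y')| / |x - y| ≤ δ / D := by gcongr
    have t3 := mul_le_mul (q2 j) t2 (by positivity) (hα j)
    refine (add_le_add t1 t3).trans (le_of_eq (by ring))
  have P := prod_reg Finset.univ hα q1 q2 q3
  rw [Finset.card_univ, Fintype.card_fin] at P
  have hp : |∏ j, Adiff (a j) x' y' / (x' - y')| ≤ ∏ j, α j := by
    rw [Finset.abs_prod]
    exact Finset.prod_le_prod (fun j _ => abs_nonneg _) (fun j _ => q2 j)
  have hp0 : 0 ≤ ∏ j, α j := Finset.prod_nonneg (fun j _ => hα j)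
  have hi := inv_reg hD h5 h6 h4
  have e : Kq m a x y - Kq m a x' y' =
    (∏ j, Adiff (a j) x y / (x - y) - ∏ j, Adiff (a j) x' y' / (x' - y')) * (x - y)⁻¹ +
      (∏ j, Adiff (a j) x' y' / (x' - y')) * ((x - y)⁻¹ - (x' - y')⁻¹) := by
    unfold Kq; ring
  rw [e]
  refine (abs_add_le _ _).trans ?_
  rw [abs_mul, abs_mul, abs_inv]
  have t1 : |x - y|⁻¹ ≤ D⁻¹ := by gcongr
  have t2 := mul_le_mul P t1 (by positivity) ((abs_nonneg _).trans P)
  have t3 := mul_le_mul hp hi (abs_nonneg _) hp0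
  refine (add_le_add t2 t3).trans (le_of_eq ?_)
  field_simp

/-- tail function -/
noncomputable def Tl (f : ℝ → ℝ) (x r : ℝ) : ℝ := ∫ y in {y | r < |x - y|}, |f y| * ((x - y) ^ 2)⁻¹

lemma Tl_integrable {f : ℝ → ℝ} (hf : Integrable f) {r : ℝ} (hr : 0 < r) (x : ℝ) :
    IntegrableOn (fun y => |f y| * ((x - y) ^ 2)⁻¹) {y | r < |x - y|} := by
  refine Integrable.mul_bdd (c := (r ^ 2)⁻¹) hf.abs.integrableOn (by fun_prop) ?_
  filter_upwards [ae_restrict_mem (measurableSet_trunc r x)] with y hy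
  rw [Real.norm_eq_abs, abs_inv, abs_pow]
  have : r < |x - y| := hy
  gcongr

lemma Tl_crude {f : ℝ → ℝ} (hf : Integrable f) {r : ℝ} (hr : 0 < r) (x : ℝ) :
    Tl f x r ≤ (∫ y, |f y|) / r ^ 2 := by
  unfold Tl
  calc _ ≤ ∫ y in {y | r < |x - y|}, |f y| * (r ^ 2)⁻¹ := by
        refine setIntegral_mono_on (Tl_integrable hf hr x) (hf.abs.integrableOn.mul_const _)
          (measurableSet_trunc r x) (fun y hy => ?_)
        have : r < |x - y| := hy
        rw [← sq_abs (x - y)]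
        gcongr
    _ = (∫ y in {y | r < |x - y|}, |f y|) * (r ^ 2)⁻¹ := integral_mul_const _ _
    _ ≤ _ := by
        rw [div_eq_mul_inv]
        gcongr
        · exact Eventually.of_forall fun y => abs_nonneg _
        · exact hf.abs
        · exact Measure.restrict_le_self

lemma Bad_abs_le {f : ℝ → ℝ} {x L : ℝ} (hx : x ∉ Bad (fun y => |f y|) L)
    (y : ℝ) : |Adiff f x y| ≤ L * |x - y| := by
  unfold Adiff
  rcases le_total y x with h | h
  · have := not_Bad_le hx h le_rfl h
    rw [abs_of_nonneg (sub_nonneg.2 h)]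
    exact (intervalIntegral.abs_integral_le_integral_abs h).trans this
  · have := not_Bad_le hx le_rfl h h
    rw [abs_of_nonpos (sub_nonpos.2 h), intervalIntegral.integral_symm, abs_neg, neg_sub]
    exact (intervalIntegral.abs_integral_le_integral_abs h).trans this

lemma Tl_step {f : ℝ → ℝ} (hf : Integrable f) {x L : ℝ} (hx : x ∉ Bad (fun y => |f y|) L)
    {r : ℝ} (hr : 0 < r) : Tl f x r ≤ 4 * L / r + Tl f x (2 * r) := by
  have hsub : {y : ℝ | 2 * r < |x - y|} ⊆ {y | r < |x - y|} := fun y hy => by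
    simp only [mem_ofPred_eq] at *; linarith
  have hi := Tl_integrable hf hr x
  unfold Tl
  rw [← sdiff_union_of_subset hsub, setIntegral_union disjoint_sdiff_left (measurableSet_trunc _ x)
    (hi.mono_set sdiff_subset) (hi.mono_set hsub)]
  gcongr
  calc ∫ y in {y : ℝ | r < |x - y|} \ {y | 2 * r < |x - y|}, |f y| * ((x - y) ^ 2)⁻¹
      ≤ ∫ y in {y : ℝ | r < |x - y|} \ {y | 2 * r < |x - y|}, |f y| * (r ^ 2)⁻¹ := by
        refine setIntegral_mono_on (hi.mono_set sdiff_subset) (hf.abs.integrableOn.mul_const _)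
          ((measurableSet_trunc r x).diff (measurableSet_trunc _ x)) (fun y hy => ?_)
        have : r < |x - y| := hy.1
        rw [← sq_abs (x - y)]
        gcongr
    _ ≤ ∫ y in Icc (x - 2 * r) (x + 2 * r), |f y| * (r ^ 2)⁻¹ := by
        refine setIntegral_mono_set (hf.abs.integrableOn.mul_const _)
          (Eventually.of_forall fun y => ?_) (LE.le.eventuallyLE fun y hy => ?_)
        · simp only [Pi.zero_apply]; positivity
        · have : ¬ (2 * r < |x - y|) := hy.2
          rw [not_lt, abs_le] at this
          exact ⟨by linarith [this.2], by linarith [this.1]⟩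
    _ = (∫ y in (x - 2 * r)..(x + 2 * r), |f y|) * (r ^ 2)⁻¹ := by
        rw [integral_mul_const, intervalIntegral.integral_of_le (by linarith), integral_Icc_eq_integral_Ioc]
    _ ≤ (L * ((x + 2 * r) - (x - 2 * r))) * (r ^ 2)⁻¹ := by
        gcongr
        exact not_Bad_le hx (by linarith) (by linarith) (by linarith)
    _ = 4 * L / r := by field_simp; ring

lemma Tl_Bad {f : ℝ → ℝ} (hf : Integrable f) {x L : ℝ} (hx : x ∉ Bad (fun y => |f y|) L)
    {r : ℝ} (hr : 0 < r) : Tl f x r ≤ 8 * L / r := by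
  have h1 : ∀ n : ℕ, Tl f x r ≤ 8 * L / r * (1 - (1 / 2) ^ n) + Tl f x (2 ^ n * r) := by
    intro n
    induction n with
    | zero => simp
    | succ n ih =>
      have := Tl_step hf hx (r := 2 ^ n * r) (by positivity)
      rw [← mul_assoc, ← pow_succ'] at this
      have e : 4 * L / (2 ^ n * r) = 8 * L / r * ((1 / 2) ^ n - (1 / 2) ^ (n + 1)) := by
        rw [pow_succ, div_pow, one_pow]; field_simp; ring
      rw [e] at this
      linarith
  have hL : 0 ≤ L := by
    have := not_Bad_le hx (u := x - 1) (v := x + 1) (by linarith) (by linarith) (by linarith)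
    have h0 : 0 ≤ ∫ t in (x-1)..(x+1), |f t| :=
      intervalIntegral.integral_nonneg (by linarith) (fun _ _ => abs_nonneg _)
    linarith
  have h2 : ∀ n : ℕ, Tl f x r ≤ 8 * L / r + (∫ y, |f y|) / r ^ 2 * (1 / 4) ^ n := by
    intro n
    have e := Tl_crude hf (r := 2 ^ n * r) (by positivity) x
    have e2 : (∫ y, |f y|) / (2 ^ n * r) ^ 2 = (∫ y, |f y|) / r ^ 2 * (1 / 4) ^ n := by
      rw [mul_pow, ← pow_mul, mul_comm n 2, pow_mul, div_pow, one_pow]; norm_num; field_simp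
    have : 0 ≤ 8 * L / r * (1 / 2) ^ n := by positivity
    have := h1 n
    rw [e2] at e
    linarith
  have h3 : Tendsto (fun n : ℕ => 8 * L / r + (∫ y, |f y|) / r ^ 2 * (1 / 4 : ℝ) ^ n) atTop
      (nhds (8 * L / r + (∫ y, |f y|) / r ^ 2 * 0)) :=
    ((tendsto_pow_atTop_nhds_zero_of_lt_one (by norm_num) (by norm_num)).const_mul _).const_add _
  rw [mul_zero, add_zero] at h3
  exact ge_of_tendsto' h3 h2

lemma Tl_bdd {f : ℝ → ℝ} (hf : Integrable f) (h1 : ∀ y, |f y| ≤ 1) (x : ℝ) {r : ℝ} (hr : 0 < r) :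
    Tl f x r ≤ 2 / r := by
  rw [← tail_integral hr x]
  refine setIntegral_mono_on (Tl_integrable hf hr x) (tail_integrableOn hr x)
    (measurableSet_trunc r x) (fun y hy => ?_)
  exact mul_le_of_le_one_left (by positivity) (h1 y)

lemma KX {m : ℕ} {a : Fin m → ℝ → ℝ} (ha : ∀ j, Integrable (a j)) {α : Fin m → ℝ} (hα : ∀ j, 0 ≤ α j)
    {x x' y : ℝ} (h : ∀ j z, |Adiff (a j) x' z| ≤ α j * |x' - z|) (hy : |x - x'| ≤ |x - y|)
    (hxy : x' ≠ y) :
    |Kq m a x y - Kq m a x' y| ≤ 4 * (2 * m + 1) * 3 ^ m * (∏ j, α j) * |x - x'| * ((x' - y) ^ 2)⁻¹ := by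
  have hd : |x' - y| ≤ 2 * |x - y| := by
    have := abs_sub_le x' x y
    rw [abs_sub_comm x' x] at this
    linarith
  have hp : 0 < |x' - y| := abs_pos.2 (sub_ne_zero.2 hxy)
  have hA : ∀ j, |Adiff (a j) x x'| ≤ α j * |x - x'| := fun j => by
    have h1 := h j x; rw [Adiff_symm, abs_neg, abs_sub_comm]; exact h1
  have := Kq_sub_le (m := m) (a := a) (α := fun j => 3 * α j) (x := x) (y := y) (x' := x') (y' := y)
    (D := |x' - y| / 2) (δ := |x - x'|) (fun j => by have := hα j; positivity) (by positivity)
    (fun j => ?_) (fun j => ?_) (fun j => ?_) (by rw [sub_sub_sub_cancel_right]) (by linarith) (by linarith)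
  · refine this.trans (le_of_eq ?_)
    rw [Finset.prod_mul_distrib, Finset.prod_const, Finset.card_univ, Fintype.card_fin, div_pow, sq_abs]
    have : x' - y ≠ 0 := sub_ne_zero.2 hxy
    field_simp
    norm_num
    ring
  · rw [← Adiff_add (ha j) x x' y]
    refine (abs_add_le _ _).trans ?_
    have h1 := hA j
    have h2 := h j y
    have h3 := mul_le_mul_of_nonneg_left hd (hα j)
    have h4 := mul_le_mul_of_nonneg_left hy (hα j)
    linarith
  · have := h j y
    have := mul_nonneg (hα j) hp.le
    linarith
  · rw [← Adiff_add (ha j) x x' y, add_sub_cancel_right]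
    have := mul_nonneg (hα j) (abs_nonneg (x - x'))
    linarith [hA j]

noncomputable def C1 (m : ℕ) : ℝ := 4 * (2 * m + 1) * 3 ^ m
lemma C1_pos (m : ℕ) : 0 < C1 m := by unfold C1; positivity

lemma Kf_integrableOn {m : ℕ} {a : Fin m → ℝ → ℝ} (ha : ∀ j, Integrable (a j)) {f : ℝ → ℝ}
    (hf : Integrable f) {r : ℝ} (hr : 0 < r) {x : ℝ} {Y : Set ℝ} (hY : ∀ y ∈ Y, r < |x - y|) :
    IntegrableOn (fun y => Kq m a x y * f y) Y :=
  (Tr_integrable ha hf hr x).mono_set hY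

lemma tail_compare {m : ℕ} {a : Fin m → ℝ → ℝ} (ha : ∀ j, Integrable (a j)) {α : Fin m → ℝ}
    (hα : ∀ j, 0 ≤ α j) {f : ℝ → ℝ} (hf : Integrable f) {x x' r φ : ℝ}
    (h : ∀ j z, |Adiff (a j) x' z| ≤ α j * |x' - z|) (hr : 0 < r) (hφ : Tl f x' r ≤ φ / r)
    {Y : Set ℝ} (hYm : MeasurableSet Y) (hY1 : ∀ y ∈ Y, r < |x' - y|) (hY2 : ∀ y ∈ Y, r < |x - y|)
    (hY3 : ∀ y ∈ Y, |x - x'| ≤ |x - y|) :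
    |(∫ y in Y, Kq m a x y * f y) - ∫ y in Y, Kq m a x' y * f y| ≤
      C1 m * (∏ j, α j) * |x - x'| * (φ / r) := by
  rw [← integral_sub (Kf_integrableOn ha hf hr hY2) (Kf_integrableOn ha hf hr hY1)]
  have hP : 0 ≤ ∏ j, α j := Finset.prod_nonneg (fun j _ => hα j)
  have hC := C1_pos m
  have hi := Tl_integrable hf hr x'
  calc |∫ y in Y, (Kq m a x y * f y - Kq m a x' y * f y)|
      ≤ ∫ y in Y, C1 m * (∏ j, α j) * |x - x'| * (|f y| * ((x' - y) ^ 2)⁻¹) := by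
        rw [← Real.norm_eq_abs]
        refine norm_integral_le_of_norm_le ((hi.mono_set hY1).const_mul _) ?_
        filter_upwards [ae_restrict_mem hYm] with y hy
        have hne : x' ≠ y := by
          rintro rfl
          have := hY1 _ hy
          simp at this; linarith
        rw [← sub_mul, Real.norm_eq_abs, abs_mul]
        have := mul_le_mul_of_nonneg_right (KX ha hα h (hY3 y hy) hne) (abs_nonneg (f y))
        refine this.trans (le_of_eq ?_)
        unfold C1; ring
    _ = C1 m * (∏ j, α j) * |x - x'| * ∫ y in Y, (|f y| * ((x' - y) ^ 2)⁻¹) := integral_const_mul _ _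
    _ ≤ C1 m * (∏ j, α j) * |x - x'| * Tl f x' r := by
        gcongr
        exact setIntegral_mono_set hi (Eventually.of_forall fun y => by simp only [Pi.zero_apply]; positivity) (LE.le.eventuallyLE hY1)
    _ ≤ _ := by gcongr

lemma ring_bound {m : ℕ} {a : Fin m → ℝ → ℝ} {α : Fin m → ℝ}
    (hα : ∀ j, 0 ≤ α j) {f : ℝ → ℝ} (hf : Integrable f) {x' r R φ : ℝ}
    (h : ∀ j z, |Adiff (a j) x' z| ≤ α j * |x' - z|) (hr : 0 < r) (hφ : Tl f x' r ≤ φ / r)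
    {Y : Set ℝ} (hYm : MeasurableSet Y) (hY1 : ∀ y ∈ Y, r < |x' - y|) (hY2 : ∀ y ∈ Y, |x' - y| ≤ R)
    (hR : 0 ≤ R) :
    |∫ y in Y, Kq m a x' y * f y| ≤ (∏ j, α j) * R * (φ / r) := by
  have hP : 0 ≤ ∏ j, α j := Finset.prod_nonneg (fun j _ => hα j)
  have hi := Tl_integrable hf hr x'
  calc |∫ y in Y, Kq m a x' y * f y|
      ≤ ∫ y in Y, (∏ j, α j) * R * (|f y| * ((x' - y) ^ 2)⁻¹) := by
        rw [← Real.norm_eq_abs]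
        refine norm_integral_le_of_norm_le ((hi.mono_set hY1).const_mul _) ?_
        filter_upwards [ae_restrict_mem hYm] with y hy
        have hp : 0 < |x' - y| := hr.trans (hY1 y hy)
        rw [Real.norm_eq_abs, abs_mul]
        have h1 := Kq_abs_le (m := m) (a := a) (x := x') (y := y) (α := α) (fun j => h j y)
        have h2 : (∏ j, α j) / |x' - y| ≤ (∏ j, α j) * R * ((x' - y) ^ 2)⁻¹ := by
          rw [← sq_abs (x' - y), div_le_iff₀ hp]
          have e : (∏ j, α j) * R * (|x' - y| ^ 2)⁻¹ * |x' - y| = (∏ j, α j) * (R / |x' - y|) := by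
            field_simp
          rw [e]
          refine le_mul_of_one_le_right hP ?_
          rw [one_le_div hp]; exact hY2 y hy
        have := mul_le_mul_of_nonneg_right (h1.trans h2) (abs_nonneg (f y))
        refine this.trans (le_of_eq ?_)
        ring
    _ = (∏ j, α j) * R * ∫ y in Y, (|f y| * ((x' - y) ^ 2)⁻¹) := integral_const_mul _ _
    _ ≤ (∏ j, α j) * R * Tl f x' r := by
        gcongr
        exact setIntegral_mono_set hi (Eventually.of_forall fun y => by simp only [Pi.zero_apply]; positivity) (LE.le.eventuallyLE hY1)
    _ ≤ _ := by gcongr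

/-- one-step comparison -/
theorem one_step {m : ℕ} {a : Fin m → ℝ → ℝ} (ha : ∀ j, Integrable (a j)) {α : Fin m → ℝ}
    (hα : ∀ j, 0 ≤ α j) {f : ℝ → ℝ} (hf : Integrable f) {u v x x' φ τ e : ℝ} (huv : u < v)
    (hx : x ∈ Icc u v) (hx' : x' ∈ Icc u v)
    (h : ∀ j z, |Adiff (a j) x' z| ≤ α j * |x' - z|) (hφ : ∀ r, 0 < r → Tl f x' r ≤ φ / r)
    (hτ : ∀ r, 0 < r → |Tr m a f r x'| ≤ τ) (he : 0 < e) :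
    |∫ y in {y | e < |x - y|} \ Icc (u - (v - u)) (v + (v - u)), Kq m a x y * f y| ≤
      τ + (2 * C1 m + 8) * (∏ j, α j) * φ := by
  set ℓ := v - u with hℓ
  have hℓ0 : 0 < ℓ := by rw [hℓ]; linarith
  set ρ := max e (2 * ℓ) with hρ
  have hρ1 : e ≤ ρ := le_max_left _ _
  have hρ2 : 2 * ℓ ≤ ρ := le_max_right _ _
  have hρ0 : 0 < ρ := by linarith
  have hxx : |x - x'| ≤ ℓ := by
    rw [abs_le]; exact ⟨by linarith [hx.1, hx'.2], by linarith [hx.2, hx'.1]⟩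
  set Y := {y | e < |x - y|} \ Icc (u - ℓ) (v + ℓ) with hY
  have hYm : MeasurableSet Y := (measurableSet_trunc e x).diff measurableSet_Icc
  have hout : ∀ z ∈ Icc u v, ∀ y ∉ Icc (u - ℓ) (v + ℓ), ℓ < |z - y| := by
    intro z hz y hy
    rw [lt_abs]
    by_contra! hc
    exact hy ⟨by linarith [hc.1, hz.1], by linarith [hc.2, hz.2]⟩
  have hP : 0 ≤ ∏ j, α j := Finset.prod_nonneg (fun j _ => hα j)
  have hφ0 : 0 ≤ φ := by
    have h1 := hφ 1 one_pos
    have h2 : 0 ≤ Tl f x' 1 := integral_nonneg (fun y => by positivity)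
    simpa using h2.trans h1
  have hmax : ∀ y ∈ Y, ρ / 2 ≤ |x' - y| ∧ ρ / 2 ≤ |x - y| := by
    intro y hy
    have h1 : e < |x - y| := hy.1
    have h2 := hout x hx y hy.2
    have h3 := hout x' hx' y hy.2
    have h4 := abs_sub_le x x' y
    rcases max_choice e (2 * ℓ) with hm | hm <;> rw [← hρ] at hm
    · constructor <;> linarith
    · constructor <;> linarith
  have s1 := tail_compare ha hα hf h (r := ρ / 4) (by positivity) (hφ _ (by positivity)) hYm
    (fun y hy => by linarith [(hmax y hy).1]) (fun y hy => by linarith [(hmax y hy).2])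
    (fun y hy => hxx.trans (hout x hx y hy.2).le)
  have hsub : {y | 2 * ρ < |x' - y|} ⊆ Y := by
    intro y hy
    have h1 : 2 * ρ < |x' - y| := hy
    have h4 := abs_sub_le x' x y
    rw [abs_sub_comm x' x] at h4
    refine ⟨show e < |x - y| by linarith, fun hc => ?_⟩
    have : |x' - y| ≤ 2 * ℓ := by
      rw [abs_le]; exact ⟨by linarith [hc.2, hx'.1], by linarith [hc.1, hx'.2]⟩
    linarith
  have s2 := ring_bound hα hf h (r := ρ / 4) (R := 2 * ρ) (by positivity) (hφ _ (by positivity))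
    (Y := Y \ {y | 2 * ρ < |x' - y|}) (hYm.diff (measurableSet_trunc _ _))
    (fun y hy => by linarith [(hmax y hy.1).1]) (fun y hy => not_lt.1 hy.2) (by positivity)
  have hiY : IntegrableOn (fun y => Kq m a x' y * f y) Y := 
    Kf_integrableOn ha hf (r := ρ / 4) (by positivity) (fun y hy => by linarith [(hmax y hy).1])
  have s3 : ∫ y in Y, Kq m a x' y * f y = (∫ y in Y \ {y | 2 * ρ < |x' - y|}, Kq m a x' y * f y) + 
      Tr m a f (2 * ρ) x' := by
    unfold Tr
    rw [← setIntegral_union disjoint_sdiff_left (measurableSet_trunc _ _) (hiY.mono_set sdiff_subset)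
      (hiY.mono_set hsub), sdiff_union_of_subset hsub]
  have s4 := hτ (2 * ρ) (by positivity)
  have e1 : C1 m * (∏ j, α j) * |x - x'| * (φ / (ρ / 4)) ≤ 2 * C1 m * (∏ j, α j) * φ := by
    have hC := C1_pos m
    have : |x - x'| * (φ / (ρ / 4)) ≤ 2 * φ := by
      have e : |x - x'| * (φ / (ρ / 4)) = φ * (4 * |x - x'| / ρ) := by field_simp
      rw [e, mul_comm 2]
      gcongr
      rw [div_le_iff₀ hρ0]; linarith
    calc _ = C1 m * (∏ j, α j) * (|x - x'| * (φ / (ρ / 4))) := by ring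
      _ ≤ C1 m * (∏ j, α j) * (2 * φ) := by gcongr
      _ = _ := by ring
  have e2 : (∏ j, α j) * (2 * ρ) * (φ / (ρ / 4)) = 8 * (∏ j, α j) * φ := by field_simp; ring
  rw [s3] at s1
  rw [e2] at s2
  rw [abs_le] at *
  constructor <;> nlinarith [s1.1, s1.2, s2.1, s2.2, s4.1, s4.2]

lemma Tr_eq_kt (m : ℕ) (a : Fin m → ℝ → ℝ) (f : ℝ → ℝ) (e x : ℝ) :
    Tr m a f e x = ∫ y, kt m a e x y * f y := by
  unfold Tr
  rw [← integral_indicator (measurableSet_trunc e x)]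
  congr 1; ext y
  unfold kt
  by_cases h : e < |x - y|
  · rw [if_pos h, indicator_of_mem (by exact h)]
  · rw [if_neg h, indicator_of_notMem (by exact h), zero_mul]

lemma Tr_measurable {m : ℕ} {a : Fin m → ℝ → ℝ} (ha : ∀ j, Integrable (a j)) {f : ℝ → ℝ}
    (hf : Measurable f) (e : ℝ) : Measurable (Tr m a f e) := by
  have h1 : Tr m a f e = fun x => ∫ y, kt m a e x y * f y := funext (Tr_eq_kt m a f e)
  rw [h1]
  have h2 : StronglyMeasurable (Function.uncurry fun x y => kt m a e x y * f y) :=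
    ((kt_measurable ha e).mul (hf.comp measurable_snd)).stronglyMeasurable
  exact h2.integral_prod_right.measurable

lemma loc_measurable {m : ℕ} {a : Fin m → ℝ → ℝ} (ha : ∀ j, Integrable (a j)) {f : ℝ → ℝ}
    (hf : Measurable f) (e : ℝ) (s : Set ℝ) : Measurable fun x => ∫ y in s, kt m a e x y * f y := by
  have h2 : StronglyMeasurable (Function.uncurry fun x y => kt m a e x y * f y) :=
    ((kt_measurable ha e).mul (hf.comp measurable_snd)).stronglyMeasurable
  exact (h2.integral_prod_right (ν := volume.restrict s)).measurable

lemma loc_bound {m : ℕ} {a : Fin m → ℝ → ℝ} 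
    (h1 : ∀ j x y, |Adiff (a j) x y| ≤ |x - y|) {f : ℝ → ℝ}
    (hf : Integrable f) {e : ℝ} (he : 0 < e) (s : Set ℝ) (x : ℝ) :
    |∫ y in s, kt m a e x y * f y| ≤ 1 / e * ∫ y, |f y| := by
  calc _ ≤ ∫ y in s, 1 / e * |f y| := by
        rw [← Real.norm_eq_abs]
        refine norm_integral_le_of_norm_le (hf.abs.integrableOn.const_mul _) (Eventually.of_forall fun y => ?_)
        rw [Real.norm_eq_abs, abs_mul]
        gcongr
        exact kt_bound h1 he x y
    _ = 1 / e * ∫ y in s, |f y| := integral_const_mul _ _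
    _ ≤ _ := by
      gcongr
      · exact Eventually.of_forall fun y => abs_nonneg _
      · exact hf.abs
      · exact Measure.restrict_le_self

noncomputable def C2 (m : ℕ) : ℝ := C1 m + 1 / 2 + 4 * (3680 * m ^ 2 + 160)

lemma cotlar_pt {m : ℕ} {a : Fin m → ℝ → ℝ} (ha : ∀ j, Integrable (a j))
    (ham : ∀ j, Measurable (a j)) (ha1 : ∀ j x, |a j x| ≤ 1) {f : ℝ → ℝ} (hf : Measurable f)
    (hfi : Integrable f) (hf1 : ∀ x, |f x| ≤ 1) {x p q δ e : ℝ} (hδ : 0 < δ) (he : 2 * δ ≤ e)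
    (hp : p ≤ x) (hq : x ≤ q) (hpq : q - p = e / 4) :
    |Tr m a f e x| * (e / 4) ≤ C2 m * (e / 4) + ∫ x' in p..q, |Tr m a f δ x'| := by
  have he0 : 0 < e := by linarith
  have hA : ∀ j x y, |Adiff (a j) x y| ≤ |x - y| := fun j => Adiff_le_of_bdd (ha1 j)
  set g : ℝ → ℝ := fun x' => ∫ y in Ioc (x - e) (x + e), kt m a δ x' y * f y with hg
  set Y := {y : ℝ | e < |x - y|} with hY
  have hcl : ∀ x' ∈ Icc p q, |x - x'| ≤ e / 4 := fun x' hx' => by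
    rw [abs_le]; exact ⟨by linarith [hx'.2], by linarith [hx'.1]⟩
  have key : ∀ x' ∈ Icc p q, |Tr m a f e x| ≤ C1 m + 1 / 2 + |Tr m a f δ x'| + g x' ^ 2 / 2 := by
    intro x' hx'
    have hxx := hcl x' hx'
    have hYx : ∀ y ∈ Y, 3 * e / 4 < |x' - y| := by
      intro y hy
      have h1 : e < |x - y| := hy
      have := abs_sub_le x x' y
      linarith
    have s1 := tail_compare ha (α := fun _ => 1) (fun _ => zero_le_one) hfi (x := x) (x' := x')
      (r := e / 2) (φ := 2) (fun j z => by simpa using hA j x' z) (by positivity) 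
      (Tl_bdd hfi hf1 x' (by positivity)) (measurableSet_trunc e x) 
      (fun y hy => by linarith [hYx y hy]) (fun y hy => by have : e < |x - y| := hy; linarith)
      (fun y hy => by have : e < |x - y| := hy; linarith)
    have hsub : Y ⊆ {y | δ < |x' - y|} := fun y hy => by
      have := hYx y hy
      show δ < |x' - y|
      linarith
    have hi := Tr_integrable ha hfi hδ x'
    have s2 : Tr m a f δ x' = (∫ y in {y | δ < |x' - y|} \ Y, Kq m a x' y * f y) + 
        ∫ y in Y, Kq m a x' y * f y := by
      unfold Tr
      rw [← setIntegral_union disjoint_sdiff_left (measurableSet_trunc _ _) (hi.mono_set sdiff_subset)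
        (hi.mono_set hsub), sdiff_union_of_subset hsub]
    have s3 : g x' = ∫ y in {y | δ < |x' - y|} \ Y, Kq m a x' y * f y := by
      rw [hg]
      simp only
      rw [kt_integral]
      have e1 : {y | δ < |x' - y|} \ Y = Icc (x - e) (x + e) ∩ {y | δ < |x' - y|} := by
        ext y
        simp only [hY, Set.mem_sdiff, mem_ofPred_eq, mem_inter_iff, mem_Icc, not_lt, abs_le]
        constructor
        · rintro ⟨h1, h2, h3⟩; exact ⟨⟨by linarith, by linarith⟩, h1⟩
        · rintro ⟨⟨h2, h3⟩, h1⟩; exact ⟨h1, by linarith, by linarith⟩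
      rw [e1]
      exact setIntegral_congr_set (Ioc_ae_eq_Icc.inter (ae_eq_refl _))
    rw [← s3] at s2
    have hT : Tr m a f e x = ∫ y in Y, Kq m a x y * f y := rfl
    rw [← hT] at s1
    have e2 : C1 m * (∏ j : Fin m, (1:ℝ)) * |x - x'| * (2 / (e / 2)) ≤ C1 m := by
      have hC := C1_pos m
      rw [Finset.prod_const_one, mul_one, mul_assoc]
      refine mul_le_of_le_one_right hC.le ?_
      have : |x - x'| * (2 / (e / 2)) = 4 * |x - x'| / e := by field_simp; norm_num
      rw [this, div_le_one he0]; linarith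
    have h5 : |∫ y in Y, Kq m a x' y * f y| ≤ |Tr m a f δ x'| + |g x'| := by
      have : ∫ y in Y, Kq m a x' y * f y = Tr m a f δ x' - g x' := by linarith
      rw [this]; exact abs_sub _ _
    have h6 : |g x'| ≤ 1 / 2 + g x' ^ 2 / 2 := by
      have := sq_nonneg (|g x'| - 1)
      have := sq_abs (g x')
      nlinarith
    have h7 := abs_sub_abs_le_abs_sub (Tr m a f e x) (∫ y in Y, Kq m a x' y * f y)
    linarith
  have hpq' : p ≤ q := by linarith
  have i1 : IntervalIntegrable (fun x' => |Tr m a f δ x'|) volume p q := by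
    rw [intervalIntegrable_iff_integrableOn_Ioc_of_le hpq']
    refine Measure.integrableOn_of_bounded (M := 1 / δ * ∫ y, |f y|) (by simp) (Tr_measurable ha hf δ).abs.aestronglyMeasurable
      (Eventually.of_forall fun x => ?_)
    rw [Real.norm_eq_abs, abs_abs, Tr_eq_kt, ← setIntegral_univ]
    exact loc_bound hA hfi hδ univ x
  have i2' : ∀ c d : ℝ, IntegrableOn (fun x' => g x' ^ 2) (Ioc c d) := by
    intro c d
    refine Measure.integrableOn_of_bounded (M := (1 / δ * ∫ y, |f y|) ^ 2) (by simp) ((loc_measurable ha hf δ _).pow_const 2).aestronglyMeasurable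
      (Eventually.of_forall fun x => ?_)
    rw [Real.norm_eq_abs, abs_pow]
    have := loc_bound hA hfi hδ (Ioc (x - e) (x + e)) x
    gcongr
    exact loc_bound hA hfi hδ _ x
  have i2 : IntervalIntegrable (fun x' => g x' ^ 2 / 2) volume p q := by
    rw [intervalIntegrable_iff_integrableOn_Ioc_of_le hpq']
    exact (i2' p q).div_const 2
  have hL := L2_bound ha ham ha1 hf hf1 (u := x - e) (v := x + e) (by linarith) hδ
  have hG : ∫ x' in p..q, g x' ^ 2 / 2 ≤ (3680 * m ^ 2 + 160) * e := by
    rw [intervalIntegral.integral_of_le hpq', integral_div]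
    have : ∫ x' in Ioc p q, g x' ^ 2 ≤ ∫ x' in Ioc (x - e) (x + e), g x' ^ 2 :=
      setIntegral_mono_set (i2' _ _) (Eventually.of_forall fun y => sq_nonneg _)
        (LE.le.eventuallyLE (Ioc_subset_Ioc (by linarith) (by linarith)))
    linarith
  have hM : ∫ x' in p..q, |Tr m a f e x| ≤ ∫ x' in p..q, (C1 m + 1 / 2 + |Tr m a f δ x'| + g x' ^ 2 / 2) :=
    intervalIntegral.integral_mono_on hpq' (by simp) 
      ((intervalIntegrable_const.add i1).add i2) key
  rw [intervalIntegral.integral_add (by exact intervalIntegrable_const.add i1) i2,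
    intervalIntegral.integral_add intervalIntegrable_const i1, intervalIntegral.integral_const,
    intervalIntegral.integral_const, hpq, smul_eq_mul, smul_eq_mul] at hM
  unfold C2
  nlinarith

lemma Tr_supp_zero {m : ℕ} {a : Fin m → ℝ → ℝ} {f : ℝ → ℝ} {u v x e : ℝ}
    (hs : ∀ y ∉ Ioc u v, f y = 0) (hx : x ∈ Icc u v) (he : v - u ≤ e) : Tr m a f e x = 0 := by
  unfold Tr
  refine setIntegral_eq_zero_of_forall_eq_zero (fun y hy => ?_)
  have h1 : e < |x - y| := hy
  rw [hs y, mul_zero]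
  intro hm
  have : |x - y| ≤ v - u := by
    rw [abs_le]; exact ⟨by linarith [hm.2, hx.1], by linarith [hm.1, hx.2]⟩
  linarith

lemma Tr_supp {m : ℕ} {a : Fin m → ℝ → ℝ} {f : ℝ → ℝ} {u v : ℝ}
    (hs : ∀ y ∉ Ioc u v, f y = 0) (e x : ℝ) : Tr m a f e x = ∫ y in Ioc u v, kt m a e x y * f y := by
  rw [Tr_eq_kt, setIntegral_eq_integral_of_forall_compl_eq_zero]
  intro y hy
  rw [hs y hy, mul_zero]

noncomputable def C3 (m : ℕ) : ℝ := 5 * (1 / 2 + (3680 * m ^ 2 + 160) / 2)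

theorem cotlar_weak {m : ℕ} {a : Fin m → ℝ → ℝ} (ha : ∀ j, Integrable (a j))
    (ham : ∀ j, Measurable (a j)) (ha1 : ∀ j x, |a j x| ≤ 1) {f : ℝ → ℝ} (hf : Measurable f)
    (hf1 : ∀ x, |f x| ≤ 1) {u v : ℝ} (huv : u < v) (hs : ∀ y ∉ Ioc u v, f y = 0)
    {s : ℝ} (hs0 : 0 < s) :
    volume {x | x ∈ Icc u v ∧ ∃ e, 0 < e ∧ C2 m + s < |Tr m a f e x|} ≤
      ENNReal.ofReal (C3 m * (v - u) / s) := by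
  have hA : ∀ j x y, |Adiff (a j) x y| ≤ |x - y| := fun j => Adiff_le_of_bdd (ha1 j)
  have hfi : Integrable f := by
    have : IntegrableOn f (Ioc u v) :=
      Measure.integrableOn_of_bounded (M := 1) (by simp) hf.aestronglyMeasurable
        (Eventually.of_forall fun x => hf1 x)
    exact this.integrable_of_forall_notMem_eq_zero hs
  have hC2 : 0 ≤ C2 m := by have := C1_pos m; unfold C2; positivity
  set S : ℕ → Set ℝ := fun n => {x | x ∈ Icc u v ∧ ∃ e, 2 * (1 / ((n : ℝ) + 1)) ≤ e ∧ C2 m + s < |Tr m a f e x|}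
  have hmono : Monotone S := by
    rintro n k hnk x ⟨h1, e, h2, h3⟩
    refine ⟨h1, e, le_trans ?_ h2, h3⟩
    gcongr
  have hU : {x | x ∈ Icc u v ∧ ∃ e, 0 < e ∧ C2 m + s < |Tr m a f e x|} ⊆ ⋃ n, S n := by
    rintro x ⟨h1, e, h2, h3⟩
    obtain ⟨n, hn⟩ := exists_nat_one_div_lt (show 0 < e / 2 by positivity)
    exact mem_iUnion.2 ⟨n, h1, e, by linarith, h3⟩
  refine (measure_mono hU).trans ?_
  rw [hmono.measure_iUnion]
  refine iSup_le (fun n => ?_)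
  set δ : ℝ := 1 / ((n : ℝ) + 1) with hδ
  have hδ0 : 0 < δ := by positivity
  set h : ℝ → ℝ := (Ioc u v).indicator fun x => |Tr m a f δ x| with hh
  have hbd : ∀ x, |Tr m a f δ x| ≤ 1 / δ * ∫ y, |f y| := fun x => by
    rw [Tr_eq_kt, ← setIntegral_univ]
    exact loc_bound hA hfi hδ0 univ x
  have hintg : IntegrableOn (fun x => |Tr m a f δ x|) (Ioc u v) := by
    refine Measure.integrableOn_of_bounded (M := 1 / δ * ∫ y, |f y|) (by simp) (Tr_measurable ha hf δ).abs.aestronglyMeasurable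
      (Eventually.of_forall fun x => ?_)
    rw [Real.norm_eq_abs, abs_abs]; exact hbd x
  have hint2 : IntegrableOn (fun x => (Tr m a f δ x) ^ 2) (Ioc u v) := by
    refine Measure.integrableOn_of_bounded (M := (1 / δ * ∫ y, |f y|) ^ 2) (by simp) ((Tr_measurable ha hf δ).pow_const 2).aestronglyMeasurable
      (Eventually.of_forall fun x => ?_)
    rw [Real.norm_eq_abs, abs_pow]
    have := hbd x
    gcongr
  have hhi : Integrable h := (integrable_indicator_iff measurableSet_Ioc).2 hintg
  have hh0 : ∀ x, 0 ≤ h x := fun x => indicator_nonneg (fun y _ => abs_nonneg _) x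
  have hsub : S n ⊆ Bad h s := by
    rintro x ⟨hx, e, he, hlt⟩
    rcases le_or_gt (v - u) e with hc | hc
    · rw [Tr_supp_zero hs hx hc, abs_zero] at hlt
      linarith
    have he0 : 0 < e := by linarith
    have fin : ∀ p q, p ≤ x → x ≤ q → q - p = e / 4 → u ≤ p → q ≤ v → x ∈ Bad h s := by
      intro p q hp hq hpq hup hqv
      refine ⟨p, q, hp, hq, by linarith, ?_⟩
      have h1 := cotlar_pt ha ham ha1 hf hfi hf1 hδ0 he hp hq hpq
      have h2 : ∫ t in p..q, h t = ∫ x' in p..q, |Tr m a f δ x'| := by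
        rw [intervalIntegral.integral_of_le (by linarith), intervalIntegral.integral_of_le (by linarith)]
        refine setIntegral_congr_fun measurableSet_Ioc (fun y hy => ?_)
        exact indicator_of_mem (Ioc_subset_Ioc hup hqv hy) _
      rw [h2, hpq]
      nlinarith
    rcases le_or_gt (x + e / 4) v with h5 | h5
    · exact fin x (x + e / 4) le_rfl (by linarith) (by ring) hx.1 h5
    · exact fin (x - e / 4) x (by linarith) le_rfl (by ring) (by linarith) hx.2
  refine (measure_mono hsub).trans ((volume_Bad_le hhi hh0 hs0).trans ?_)
  refine ENNReal.ofReal_le_ofReal ?_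
  have hL := L2_bound ha ham ha1 hf hf1 (u := u) (v := v) huv.le hδ0
  have hT : ∫ x, h x ≤ (1 / 2 + (3680 * m ^ 2 + 160) / 2) * (v - u) := by
    rw [hh, integral_indicator measurableSet_Ioc]
    have h1 : ∫ x in Ioc u v, |Tr m a f δ x| ≤ ∫ x in Ioc u v, (1 / 2 + (Tr m a f δ x) ^ 2 / 2) := by
      refine integral_mono hintg ((integrable_const _).add (hint2.div_const 2)) (fun x => ?_)
      have := sq_nonneg (|Tr m a f δ x| - 1)
      have := sq_abs (Tr m a f δ x)
      simp only
      nlinarith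
    rw [integral_add (integrable_const _) (hint2.div_const 2), integral_div _ (fun x => Tr m a f δ x ^ 2)] at h1
    simp only [← Tr_supp hs] at hL
    have h3 : ∫ x in Ioc u v, (1/2 : ℝ) = (v - u) * (1 / 2) := by
      rw [setIntegral_const]; simp [huv.le]
    rw [h3] at h1
    linarith
  unfold C3
  have : 0 < 1/s := by positivity
  rw [div_eq_mul_one_div, div_eq_mul_one_div (5 * _ * _)]
  refine mul_le_mul_of_nonneg_right ?_ this.le
  linarith

lemma Kq_smul (m : ℕ) (a : Fin m → ℝ → ℝ) (c : ℝ) (x y : ℝ) :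
    Kq m (fun j t => c * a j t) x y = c ^ m * Kq m a x y := by
  unfold Kq Adiff
  simp only [intervalIntegral.integral_const_mul, mul_div_assoc]
  rw [Finset.prod_mul_distrib, Finset.prod_const, Finset.card_univ, Fintype.card_fin]
  ring

lemma Tr_smul (m : ℕ) (a : Fin m → ℝ → ℝ) (f : ℝ → ℝ) (c d e x : ℝ) :
    Tr m (fun j t => c * a j t) (fun t => d * f t) e x = c ^ m * d * Tr m a f e x := by
  unfold Tr
  rw [← integral_const_mul]
  congr 1; ext y
  rw [Kq_smul]; ring

theorem cotlar_weak_L {m : ℕ} {a : Fin m → ℝ → ℝ} (ha : ∀ j, Integrable (a j))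
    (ham : ∀ j, Measurable (a j)) {L : ℝ} (hL : 0 < L) (ha1 : ∀ j x, |a j x| ≤ L) {f : ℝ → ℝ}
    (hf : Measurable f)
    (hf1 : ∀ x, |f x| ≤ L) {u v : ℝ} (huv : u < v) (hs : ∀ y ∉ Ioc u v, f y = 0)
    {s : ℝ} (hs0 : 0 < s) :
    volume {x | x ∈ Icc u v ∧ ∃ e, 0 < e ∧ L ^ (m + 1) * (C2 m + s) < |Tr m a f e x|} ≤
      ENNReal.ofReal (C3 m * (v - u) / s) := by
  have hb : ∀ (g : ℝ → ℝ), (∀ x, |g x| ≤ L) → ∀ x, |L⁻¹ * g x| ≤ 1 := by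
    intro g hg x
    rw [abs_mul, abs_inv, abs_of_pos hL, inv_mul_le_iff₀ hL, mul_one]
    exact hg x
  have := cotlar_weak (m := m) (a := fun j t => L⁻¹ * a j t) (fun j => (ha j).const_mul _)
    (fun j => (ham j).const_mul _) (fun j => hb _ (ha1 j)) (f := fun t => L⁻¹ * f t) (hf.const_mul _)
    (hb f hf1) huv (fun y hy => by rw [hs y hy, mul_zero]) hs0
  refine (measure_mono ?_).trans this
  rintro x ⟨hx, e, he, h⟩
  refine ⟨hx, e, he, ?_⟩
  rw [Tr_smul, abs_mul, ← pow_succ, abs_pow, abs_inv, abs_of_pos hL, inv_pow,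
    lt_inv_mul_iff₀ (by positivity)]
  exact h

lemma Adiff_congr_Icc {g g' : ℝ → ℝ} {u v x y : ℝ} (h : ∀ t ∈ Ioc u v, g t = g' t)
    (hx : x ∈ Icc u v) (hy : y ∈ Icc u v) : Adiff g x y = Adiff g' x y := by
  unfold Adiff
  refine intervalIntegral.integral_congr_ae (Eventually.of_forall fun t ht => h t ?_)
  rw [mem_uIoc] at ht
  rcases ht with ht | ht
  · exact ⟨by linarith [hy.1], by linarith [hx.2]⟩
  · exact ⟨by linarith [hx.1], by linarith [hy.2]⟩

lemma lip_ext {g : ℝ → ℝ} (hg : Integrable g) {F : Set ℝ} (hF : IsClosed F) {L : ℝ} (hL : 0 < L)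
    (h : ∀ x ∈ F, ∀ y, |Adiff g x y| ≤ L * |x - y|) {u v : ℝ} :
    ∃ g' : ℝ → ℝ, Measurable g' ∧ Integrable g' ∧ (∀ t, |g' t| ≤ L) ∧ (∀ t ∉ Ioc u v, g' t = 0) ∧
      ∀ x ∈ F, x ∈ Icc u v → ∀ y ∈ Icc u v,
        |Adiff g x y - Adiff g' x y| ≤ 2 * L * Metric.infDist y F := by
  have hLip : LipschitzOnWith (Real.toNNReal L) (fun x => ∫ t in (0:ℝ)..x, g t) F := by
    refine LipschitzOnWith.of_dist_le_mul (fun x hx y hy => ?_)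
    rw [Real.dist_eq, Real.dist_eq, Real.coe_toNNReal _ hL.le]
    have : (∫ t in (0:ℝ)..x, g t) - ∫ t in (0:ℝ)..y, g t = Adiff g x y := 
      intervalIntegral.integral_interval_sub_left hg.intervalIntegrable hg.intervalIntegrable
    rw [this]
    exact h x hx y
  obtain ⟨G, hG, hGe⟩ := hLip.extend_real
  have hd : ∀ t, |deriv G t| ≤ L := fun t => by
    have := norm_deriv_le_of_lipschitz hG (x₀ := t)
    rwa [Real.coe_toNNReal _ hL.le] at this
  have hGi : ∀ x y, Adiff (deriv G) x y = G x - G y := fun x y =>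
    ((hG.lipschitzOnWith (s := uIcc y x)).absolutelyContinuousOnInterval).integral_deriv_eq_sub
  have hGl : ∀ x y, |G x - G y| ≤ L * |x - y| := fun x y => by
    have := hG.dist_le_mul x y
    rwa [Real.dist_eq, Real.dist_eq, Real.coe_toNNReal _ hL.le] at this
  refine ⟨(Ioc u v).indicator (deriv G), (measurable_deriv G).indicator measurableSet_Ioc, ?_, ?_, ?_, ?_⟩
  · rw [integrable_indicator_iff measurableSet_Ioc]
    exact Measure.integrableOn_of_bounded (M := L) (by simp) (measurable_deriv G).aestronglyMeasurable
      (Eventually.of_forall fun x => hd x)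
  · intro t
    by_cases ht : t ∈ Ioc u v
    · rw [indicator_of_mem ht]; exact hd t
    · rw [indicator_of_notMem ht, abs_zero]; exact hL.le
  · intro t ht; exact indicator_of_notMem ht _
  · intro x hxF hx y hy
    rw [Adiff_congr_Icc (g := (Ioc u v).indicator (deriv G)) (g' := deriv G) (fun t ht => indicator_of_mem ht _) hx hy,
      hGi]
    obtain ⟨z, hzF, hz⟩ := hF.exists_infDist_eq_dist ⟨x, hxF⟩ y
    have e1 : Adiff g x y = Adiff g x z + Adiff g z y := (Adiff_add hg x z y).symm
    have e2 : Adiff g x z = G x - G z := by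
      rw [← hGe hxF, ← hGe hzF]
      exact (intervalIntegral.integral_interval_sub_left hg.intervalIntegrable hg.intervalIntegrable).symm
    rw [e1, e2, hz, Real.dist_eq, abs_sub_comm y z]
    have h1 := h z hzF y
    have h2 := hGl z y
    have : G x - G z + Adiff g z y - (G x - G y) = Adiff g z y - (G z - G y) := by ring
    rw [this]
    refine (abs_sub _ _).trans ?_
    linarith

lemma Adiff_bdd_L {g : ℝ → ℝ} {L : ℝ} (h : ∀ x, |g x| ≤ L) (x y : ℝ) :
    |Adiff g x y| ≤ L * |x - y| := by
  unfold Adiff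
  rw [← Real.norm_eq_abs]
  exact intervalIntegral.norm_integral_le_of_norm_le_const (fun t _ => h t)

lemma K_lip {m : ℕ} {a : Fin m → ℝ → ℝ} (ha : ∀ j, Integrable (a j)) {L : ℝ} (hL : 0 < L)
    (ha1 : ∀ j x, |a j x| ≤ L) {x y y' D : ℝ} (hD : 0 < D) (h1 : D ≤ |x - y|) (h2 : D ≤ |x - y'|) :
    |Kq m a x y - Kq m a x y'| ≤ (2 * m + 1) * L ^ m * |y - y'| / D ^ 2 := by
  have := Kq_sub_le (m := m) (a := a) (α := fun _ => L) (x := x) (y := y) (x' := x) (y' := y')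
    (D := D) (δ := |y - y'|) (fun _ => hL.le) hD (fun j => Adiff_bdd_L (ha1 j) _ _)
    (fun j => Adiff_bdd_L (ha1 j) _ _) (fun j => ?_) ?_ h1 h2
  · simpa using this
  · rw [← Adiff_add (ha j) x y' y, add_sub_cancel_left, abs_sub_comm y y']
    exact Adiff_bdd_L (ha1 j) _ _
  · rw [sub_sub_sub_cancel_left, abs_sub_comm]

lemma K_deriv {m : ℕ} {a : Fin m → ℝ → ℝ} (ha : ∀ j, Integrable (a j)) {L : ℝ} (hL : 0 < L)
    (ha1 : ∀ j x, |a j x| ≤ L) {x y : ℝ} (hxy : x ≠ y) :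
    |deriv (fun y => Kq m a x y) y| ≤ 4 * (2 * m + 1) * L ^ m * ((x - y) ^ 2)⁻¹ := by
  have hp : 0 < |x - y| := abs_pos.2 (sub_ne_zero.2 hxy)
  rw [← Real.norm_eq_abs]
  refine norm_deriv_le_of_lip' (by positivity) ?_
  have hnear : ∀ᶠ y' in nhds y, |x - y| / 2 < |x - y'| := by
    have hc : Continuous fun y' : ℝ => |x - y'| := by fun_prop
    exact hc.continuousAt.eventually (lt_mem_nhds (by simpa using half_lt_self hp))
  filter_upwards [hnear] with y' hy'
  have := K_lip ha hL ha1 (x := x) (y := y') (y' := y) (D := |x - y| / 2) (by positivity) hy'.le (by linarith)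
  rw [Real.norm_eq_abs, Real.norm_eq_abs]
  refine this.trans (le_of_eq ?_)
  rw [div_pow, sq_abs]
  have : x - y ≠ 0 := sub_ne_zero.2 hxy
  field_simp
  norm_num
  ring

lemma ibp_K {m : ℕ} {a : Fin m → ℝ → ℝ} (ha : ∀ j, Integrable (a j)) {L : ℝ} (hL : 0 < L)
    (ha1 : ∀ j x, |a j x| ≤ L) {g : ℝ → ℝ} (hg : Integrable g) {x c d : ℝ} (hcd : c ≤ d)
    (hx : x ∉ Icc c d) {ω : ℝ → ℝ} (hω1 : ∀ y ∈ Icc c d, |Adiff g x y| ≤ 2 * L * ω y)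
    (hω2 : ∀ y ∈ Icc c d, ω y ≤ |x - y|) (hωc : Continuous ω) :
    |∫ y in c..d, Kq m a x y * g y| ≤ 4 * L ^ (m + 1) + 
      8 * (2 * m + 1) * L ^ (m + 1) * ∫ y in c..d, ω y * ((x - y) ^ 2)⁻¹ := by
  have hne : ∀ y ∈ Icc c d, x - y ≠ 0 := by
    intro y hy h0
    rw [sub_eq_zero] at h0
    exact hx (h0 ▸ hy)
  obtain ⟨D, hD, hDl⟩ : ∃ D > 0, ∀ y ∈ Icc c d, D ≤ |x - y| := by
    obtain ⟨y0, hy0, hm⟩ := isCompact_Icc.exists_isMinOn (nonempty_Icc.2 hcd) 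
      (f := fun y => |x - y|) (by fun_prop)
    exact ⟨|x - y0|, abs_pos.2 (hne y0 hy0), fun y hy => hm hy⟩
  have hK : AbsolutelyContinuousOnInterval (fun y => Kq m a x y) c d := by
    refine LipschitzOnWith.absolutelyContinuousOnInterval (K := Real.toNNReal ((2 * m + 1) * L ^ m / D ^ 2)) ?_
    rw [uIcc_of_le hcd]
    refine LipschitzOnWith.of_dist_le_mul (fun y hy y' hy' => ?_)
    rw [Real.dist_eq, Real.dist_eq, Real.coe_toNNReal _ (by positivity)]
    refine (K_lip ha hL ha1 hD (hDl y hy) (hDl y' hy')).trans (le_of_eq (by ring))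
  have hA := Adiff_ac hg x c d
  have hI := hK.integral_mul_deriv_eq_deriv_mul hA
  have e1 : ∫ y in c..d, Kq m a x y * g y = - ∫ y in c..d, Kq m a x y * deriv (fun y => Adiff g x y) y := by
    rw [← intervalIntegral.integral_neg]
    refine intervalIntegral.integral_congr_ae ?_
    filter_upwards [Adiff_ae_deriv hg] with y hy _
    rw [(hy x).deriv]; ring
  have hb : ∀ y ∈ Icc c d, |Kq m a x y * Adiff g x y| ≤ 2 * L ^ (m + 1) := by
    intro y hy
    have hp : 0 < |x - y| := abs_pos.2 (hne y hy)
    have k1 := Kq_abs_le (m := m) (a := a) (x := x) (y := y) (α := fun _ => L) (fun j => Adiff_bdd_L (ha1 j) _ _)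
    rw [Finset.prod_const, Finset.card_univ, Fintype.card_fin] at k1
    have k2 : |Adiff g x y| ≤ 2 * L * |x - y| := (hω1 y hy).trans (by have := hω2 y hy; gcongr)
    rw [abs_mul]
    refine (mul_le_mul k1 k2 (abs_nonneg _) (by positivity)).trans (le_of_eq ?_)
    rw [pow_succ]
    field_simp
  have hwi : IntervalIntegrable (fun y => ω y * ((x - y) ^ 2)⁻¹) volume c d := by
    refine ContinuousOn.intervalIntegrable ?_
    rw [uIcc_of_le hcd]
    refine hωc.continuousOn.mul (ContinuousOn.inv₀ (by fun_prop) (fun y hy => pow_ne_zero 2 (hne y hy)))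
  have hintg : |∫ y in c..d, deriv (fun y => Kq m a x y) y * Adiff g x y| ≤ 
      8 * (2 * m + 1) * L ^ (m + 1) * ∫ y in c..d, ω y * ((x - y) ^ 2)⁻¹ := by
    rw [← intervalIntegral.integral_const_mul, ← Real.norm_eq_abs]
    refine intervalIntegral.norm_integral_le_of_norm_le hcd (Eventually.of_forall fun y hy => ?_) (hwi.const_mul _)
    have hy' := Ioc_subset_Icc_self hy
    rw [Real.norm_eq_abs, abs_mul]
    have k1 := K_deriv ha hL ha1 (m := m) (sub_ne_zero.1 (hne y hy'))
    refine (mul_le_mul k1 (hω1 y hy') (abs_nonneg _) (by positivity)).trans (le_of_eq ?_)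
    ring
  rw [e1, hI, abs_neg]
  have h1 := hb c (left_mem_Icc.2 hcd)
  have h2 := hb d (right_mem_Icc.2 hcd)
  refine (abs_sub _ _).trans (add_le_add ((abs_sub _ _).trans ?_) hintg)
  linarith

lemma Tr_supp' {m : ℕ} {a : Fin m → ℝ → ℝ} {f : ℝ → ℝ} {u v : ℝ}
    (hs : ∀ y ∉ Ioc u v, f y = 0) (e x : ℝ) :
    Tr m a f e x = ∫ y in Ioc u v ∩ {y | e < |x - y|}, Kq m a x y * f y := by
  rw [Tr_supp hs, kt_integral]

lemma core_diff {m : ℕ} {a a' : Fin m → ℝ → ℝ} (ha : ∀ j, Integrable (a j))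
    (ha' : ∀ j, Integrable (a' j)) {f f' : ℝ → ℝ} (hf : Integrable f) (hf' : Integrable f') {u v : ℝ}
    (hs : ∀ y ∉ Ioc u v, f y = 0) (hs' : ∀ y ∉ Ioc u v, f' y = 0) {L : ℝ} (hL : 0 < L)
    (hb : ∀ j t, |a' j t| ≤ L) {F : Set ℝ} {x : ℝ} (hxF : x ∈ F) (hx : x ∈ Icc u v)
    (h1 : ∀ j y, |Adiff (a j) x y| ≤ L * |x - y|)
    (h2 : ∀ j, ∀ y ∈ Icc u v, |Adiff (a j) x y - Adiff (a' j) x y| ≤ 2 * L * Metric.infDist y F)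
    (h3 : ∀ y ∈ Icc u v, |Adiff f x y - Adiff f' x y| ≤ 2 * L * Metric.infDist y F)
    {M : ℝ} (hM0 : 0 ≤ M) (hM : ∫⁻ y in Ioc u v, 
      ENNReal.ofReal (Metric.infDist y F * (1 + |f y|) * ((x - y) ^ 2)⁻¹) ≤ ENNReal.ofReal M)
    {e : ℝ} (he : 0 < e) :
    |Tr m a f e x - Tr m a' f' e x| ≤ 8 * L ^ (m + 1) +
      (2 * (2 * m + 1) * L ^ m + 8 * (2 * m + 1) * L ^ (m + 1)) * M := by
  set ω : ℝ → ℝ := fun y => Metric.infDist y F with hω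
  have hω0 : ∀ y, 0 ≤ ω y := fun y => Metric.infDist_nonneg
  have hωc : Continuous ω := Metric.continuous_infDist_pt F
  have hω2 : ∀ y, ω y ≤ |x - y| := fun y => by
    have := Metric.infDist_le_dist_of_mem (x := y) hxF
    rwa [Real.dist_eq, abs_sub_comm] at this
  set S := Ioc u v ∩ {y | e < |x - y|} with hS
  have hSm : MeasurableSet S := measurableSet_Ioc.inter (measurableSet_trunc e x)
  have hSx : ∀ y ∈ S, e < |x - y| := fun y hy => hy.2
  have hSne : ∀ y ∈ S, x - y ≠ 0 := fun y hy => abs_pos.1 (he.trans (hSx y hy))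
  -- integrability of the majorant
  have hWi : IntegrableOn (fun y => ω y * (1 + |f y|) * ((x - y) ^ 2)⁻¹) (Ioc u v) := by
    refine ⟨?_, ?_⟩
    · refine AEStronglyMeasurable.mul (hωc.aestronglyMeasurable.mul
        (aestronglyMeasurable_const.add hf.abs.aestronglyMeasurable.restrict)) ?_
      exact Measurable.aestronglyMeasurable (by fun_prop)
    · rw [hasFiniteIntegral_iff_ofReal]
      · exact hM.trans_lt ENNReal.ofReal_lt_top
      · exact Eventually.of_forall fun y => by have := hω0 y; simp only [Pi.zero_apply]; positivity
  have hWM : ∫ y in Ioc u v, ω y * (1 + |f y|) * ((x - y) ^ 2)⁻¹ ≤ M := by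
    rw [← ENNReal.ofReal_le_ofReal_iff hM0, ofReal_integral_eq_lintegral_ofReal hWi
      (Eventually.of_forall fun y => by have := hω0 y; simp only [Pi.zero_apply]; positivity)]
    exact hM
  have hSM : ∀ g : ℝ → ℝ, AEStronglyMeasurable g (volume.restrict S) → (∀ y, |g y| ≤ 1 + |f y|) → (∀ y, 0 ≤ g y) →
      IntegrableOn (fun y => ω y * g y * ((x - y) ^ 2)⁻¹) S ∧
      ∫ y in S, ω y * g y * ((x - y) ^ 2)⁻¹ ≤ M := by
    intro g hgm hg hg0
    have hi : IntegrableOn (fun y => ω y * g y * ((x - y) ^ 2)⁻¹) S := by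
      refine (hWi.mono_set inter_subset_left).mono' 
        ((hωc.aestronglyMeasurable.mul hgm).mul (Measurable.aestronglyMeasurable (by fun_prop))) 
        (Eventually.of_forall fun y => ?_)
      rw [Real.norm_eq_abs, abs_mul, abs_mul, abs_of_nonneg (hω0 y), abs_of_nonneg (show 0 ≤ ((x - y) ^ 2)⁻¹ by positivity)]
      have := hg y
      have := hω0 y
      gcongr
    refine ⟨hi, le_trans ?_ hWM⟩
    refine (setIntegral_mono_on hi (hWi.mono_set inter_subset_left) hSm (fun y hy => ?_)).trans ?_
    · have := (le_abs_self _).trans (hg y)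
      have := hω0 y
      gcongr
    · refine setIntegral_mono_set hWi (Eventually.of_forall fun y => ?_) (LE.le.eventuallyLE inter_subset_left)
      have := hω0 y; simp only [Pi.zero_apply]; positivity
  -- step 1
  have d1 : |Tr m a f e x - Tr m a' f e x| ≤ 2 * (2 * m + 1) * L ^ m * M := by
    rw [Tr_supp' hs, Tr_supp' hs, ← integral_sub (Kf_integrableOn ha hf he hSx) (Kf_integrableOn ha' hf he hSx)]
    obtain ⟨i1, i2⟩ := hSM (fun y => |f y|) hf.abs.aestronglyMeasurable.restrict (fun y => by rw [abs_abs]; linarith) (fun y => abs_nonneg _)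
    calc |∫ y in S, (Kq m a x y * f y - Kq m a' x y * f y)| 
        ≤ ∫ y in S, 2 * (2 * m + 1) * L ^ m * (ω y * |f y| * ((x - y) ^ 2)⁻¹) := by
          rw [← Real.norm_eq_abs]
          refine norm_integral_le_of_norm_le (i1.const_mul _) ?_
          filter_upwards [ae_restrict_mem hSm] with y hy
          have hyI : y ∈ Icc u v := Ioc_subset_Icc_self hy.1
          rw [← sub_mul, Real.norm_eq_abs, abs_mul]
          have k : |Kq m a x y - Kq m a' x y| ≤ 2 * (2 * m + 1) * L ^ m * (ω y * ((x - y) ^ 2)⁻¹) := by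
            have hp : 0 < |x - y| := he.trans hy.2
            have q1 : ∀ j, |Adiff (a j) x y / (x - y)| ≤ L := fun j => by
              rw [abs_div, div_le_iff₀ hp]; exact h1 j y
            have q2 : ∀ j, |Adiff (a' j) x y / (x - y)| ≤ L := fun j => by
              rw [abs_div, div_le_iff₀ hp]; exact Adiff_bdd_L (hb j) x y
            have q3 : ∀ j, |Adiff (a j) x y / (x - y) - Adiff (a' j) x y / (x - y)| ≤ 
                (2 * ω y / |x - y|) * L := fun j => by
              rw [← sub_div, abs_div, div_le_iff₀ hp]
              refine (h2 j y hyI).trans (le_of_eq ?_)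
              field_simp
              rfl
            have P := prod_reg Finset.univ (fun _ => hL.le) q1 q2 q3
            rw [Finset.card_univ, Fintype.card_fin, Finset.prod_const, Finset.card_univ, Fintype.card_fin] at P
            unfold Kq
            rw [← sub_div, abs_div, div_le_iff₀ hp]
            refine P.trans ?_
            have e1 : 2 * (2 * m + 1) * L ^ m * (ω y * ((x - y) ^ 2)⁻¹) * |x - y| = 
              (2 * m + 1) * (2 * ω y / |x - y|) * L ^ m := by
              rw [← sq_abs (x - y)]; field_simp
            rw [e1]
            have := hω0 y
            have : (0:ℝ) ≤ m := Nat.cast_nonneg m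
            gcongr
            linarith
          refine (mul_le_mul_of_nonneg_right k (abs_nonneg (f y))).trans (le_of_eq (by ring))
      _ = 2 * (2 * m + 1) * L ^ m * ∫ y in S, (ω y * |f y| * ((x - y) ^ 2)⁻¹) := integral_const_mul _ _
      _ ≤ _ := by gcongr
  -- step 2
  have d2 : |Tr m a' f e x - Tr m a' f' e x| ≤ 8 * L ^ (m + 1) + 8 * (2 * m + 1) * L ^ (m + 1) * M := by
    have hgi : Integrable (fun y => f y - f' y) := hf.sub hf'
    have hAg : ∀ y, Adiff (fun y => f y - f' y) x y = Adiff f x y - Adiff f' x y := fun y =>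
      intervalIntegral.integral_sub hf.intervalIntegrable hf'.intervalIntegrable
    obtain ⟨i1, i2⟩ := hSM (fun y => 1) aestronglyMeasurable_const (fun y => by rw [abs_one]; linarith [abs_nonneg (f y)]) (fun y => zero_le_one)
    simp only [mul_one] at i1 i2
    rw [trunc_split hx he i1] at i2
    have hsub : Tr m a' f e x - Tr m a' f' e x = ∫ y in S, Kq m a' x y * (f y - f' y) := by
      rw [Tr_supp' hs, Tr_supp' hs', ← integral_sub (Kf_integrableOn ha' hf he hSx) (Kf_integrableOn ha' hf' he hSx)]
      simp only [mul_sub, hS]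
    rw [hsub, trunc_split hx he (Kf_integrableOn ha' hgi he hSx)]
    have seg : ∀ c d, u ≤ c → c ≤ d → d ≤ v → (c = d ∨ x ∉ Icc c d) → 
        |∫ y in c..d, Kq m a' x y * (f y - f' y)| ≤ 4 * L ^ (m + 1) + 
      8 * (2 * m + 1) * L ^ (m + 1) * ∫ y in c..d, ω y * ((x - y) ^ 2)⁻¹ := by
      intro c d huc hcd hdv hor
      rcases hor with rfl | hor
      · simp; positivity
      · refine ibp_K ha' hL hb hgi hcd hor (fun y hy => ?_) (fun y _ => hω2 y) hωc
        rw [hAg]; exact h3 y ⟨huc.trans hy.1, hy.2.trans hdv⟩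
    have b1 := seg u (max u (x - e)) le_rfl (le_max_left _ _) (max_le (hx.1.trans hx.2) (by linarith [hx.2])) (by
      rcases le_or_gt (x - e) u with h | h
      · left; rw [max_eq_left h]
      · right; rw [max_eq_right h.le]; intro h'; have := h'.2; linarith)
    have b2 := seg (min v (x + e)) v (le_min (hx.1.trans hx.2) (by linarith [hx.1])) (min_le_left _ _) le_rfl (by
      rcases le_or_gt v (x + e) with h | h
      · left; rw [min_eq_left h]
      · right; rw [min_eq_right h.le]; intro h'; have := h'.1; linarith)
    refine (abs_add_le _ _).trans ((add_le_add b1 b2).trans ?_)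
    have : 0 ≤ 8 * (2 * m + 1) * L ^ (m + 1) := by positivity
    nlinarith
  have := abs_sub_le (Tr m a f e x) (Tr m a' f e x) (Tr m a' f' e x)
  refine this.trans ((add_le_add d1 d2).trans (le_of_eq (by ring)))

lemma mz_tonelli {F : Set ℝ} (hF : IsClosed F) {g : ℝ → ℝ} (hg : Measurable g) (hg0 : ∀ y, 0 ≤ g y)
    (I : Set ℝ) :
    ∫⁻ x in F, ∫⁻ y in I, ENNReal.ofReal (Metric.infDist y F * g y * ((x - y) ^ 2)⁻¹) ≤
      4 * ∫⁻ y in I, ENNReal.ofReal (g y) := by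
  rcases F.eq_empty_or_nonempty with rfl | hne
  · simp
  have hm : Measurable (Function.uncurry fun x y : ℝ => ENNReal.ofReal (Metric.infDist y F * g y * ((x - y) ^ 2)⁻¹)) := by
    have := (Metric.continuous_infDist_pt F).measurable
    unfold Function.uncurry
    fun_prop
  rw [lintegral_lintegral_swap hm.aemeasurable, ← lintegral_const_mul _ (by fun_prop)]
  refine lintegral_mono fun y => ?_
  rcases (Metric.infDist_nonneg (x := y) (s := F)).eq_or_lt with h0 | h0
  · simp [← h0]
  set d := Metric.infDist y F with hd
  have hsub : F ⊆ {x | d / 2 < |y - x|} := fun x hx => by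
    have := Metric.infDist_le_dist_of_mem (x := y) hx
    rw [Real.dist_eq] at this
    simp only [mem_ofPred_eq]; linarith
  calc ∫⁻ x in F, ENNReal.ofReal (d * g y * ((x - y) ^ 2)⁻¹)
      ≤ ∫⁻ x in {x | d / 2 < |y - x|}, ENNReal.ofReal (d * g y * ((x - y) ^ 2)⁻¹) := lintegral_mono_set hsub
    _ = ENNReal.ofReal (∫ x in {x | d / 2 < |y - x|}, d * g y * ((x - y) ^ 2)⁻¹) := by
        rw [ofReal_integral_eq_lintegral_ofReal]
        · have := (tail_integrableOn (half_pos h0) y).const_mul (d * g y)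
          simpa only [← sub_sq_comm y] using this
        · exact Eventually.of_forall fun x => by have := hg0 y; simp only [Pi.zero_apply]; positivity
    _ = ENNReal.ofReal (4 * g y) := by
        congr 1
        simp_rw [sub_sq_comm _ y]
        rw [integral_const_mul, tail_integral (half_pos h0)]
        field_simp; norm_num
    _ = 4 * ENNReal.ofReal (g y) := by rw [ENNReal.ofReal_mul (by norm_num)]; simp
  
lemma core0 (m : ℕ) {η : ℝ} (hη : 0 < η) : ∃ Λ : ℝ, 0 < Λ ∧ ∀ (a : Fin m → ℝ → ℝ) (f : ℝ → ℝ) (u v : ℝ),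
    (∀ j, Integrable (a j)) → Integrable f → (∀ y ∉ Ioc u v, f y = 0) → u < v →
    (∀ j, ∫ y, |a j y| ≤ v - u) → ∫ y, |f y| ≤ v - u →
    volume {x | x ∈ Icc u v ∧ ∃ e, 0 < e ∧ Λ < |Tr m a f e x|} ≤ ENNReal.ofReal (η * (v - u)) := by
  set L : ℝ := 15 * (m + 1) / η with hLd
  have hL : 0 < L := by positivity
  set M : ℝ := 24 / η with hMd
  have hM : 0 < M := by positivity
  set s : ℝ := 3 * C3 m / η with hsd
  have hC3 : 0 < C3 m := by unfold C3; positivity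
  have hC2 : 0 < C2 m := by unfold C2; have := C1_pos m; positivity
  have hs : 0 < s := by positivity
  refine ⟨L ^ (m + 1) * (C2 m + s) + (8 * L ^ (m + 1) +
      (2 * (2 * m + 1) * L ^ m + 8 * (2 * m + 1) * L ^ (m + 1)) * M), by positivity, ?_⟩
  intro a f u v ha hf hfs huv ha1 hf1
  set B : Set ℝ := (⋃ j, Bad (fun y => |a j y|) L) ∪ Bad (fun y => |f y|) L with hB
  have hBo : IsOpen B := (isOpen_iUnion fun j => isOpen_Bad (ha j).abs L).union (isOpen_Bad hf.abs L)
  have hF : IsClosed Bᶜ := hBo.isClosed_compl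
  have hBv : volume B ≤ ENNReal.ofReal (η / 3 * (v - u)) := by
    have e1 : ∀ g : ℝ → ℝ, Integrable g → ∫ y, |g y| ≤ v - u → volume (Bad (fun y => |g y|) L) ≤ ENNReal.ofReal (5 * (v - u) / L) := by
      intro g hg h1
      refine (volume_Bad_le hg.abs (fun _ => abs_nonneg _) hL).trans (ENNReal.ofReal_le_ofReal ?_)
      gcongr
    calc volume B ≤ (∑ j : Fin m, ENNReal.ofReal (5 * (v - u) / L)) + ENNReal.ofReal (5 * (v - u) / L) := by
          refine (measure_union_le _ _).trans (add_le_add ?_ (e1 f hf hf1))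
          refine (measure_iUnion_fintype_le _ _).trans (Finset.sum_le_sum fun j _ => e1 _ (ha j) (ha1 j))
      _ = ENNReal.ofReal (η / 3 * (v - u)) := by
          have : 0 ≤ 5 * (v - u) / L := by have := sub_pos.2 huv; positivity
          rw [← ENNReal.ofReal_sum_of_nonneg (fun _ _ => this), ← ENNReal.ofReal_add (Finset.sum_nonneg fun _ _ => this) this]
          congr 1
          simp only [Finset.sum_const, Finset.card_univ, Fintype.card_fin, nsmul_eq_mul]
          rw [hLd]; field_simp; ring
  have hbda : ∀ x ∈ Bᶜ, ∀ j y, |Adiff (a j) x y| ≤ L * |x - y| := fun x hx j y =>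
    Bad_abs_le (fun h => hx (Or.inl (mem_iUnion.2 ⟨j, h⟩))) y
  have hbdf : ∀ x ∈ Bᶜ, ∀ y, |Adiff f x y| ≤ L * |x - y| := fun x hx y =>
    Bad_abs_le (fun h => hx (Or.inr h)) y
  choose a' h1 h2 h3 h4 h5 using fun j => lip_ext (ha j) hF hL (fun x hx y => hbda x hx j y) (u := u) (v := v)
  obtain ⟨f', k1, k2, k3, k4, k5⟩ := lip_ext hf hF hL hbdf (u := u) (v := v)
  set f0 := hf.aestronglyMeasurable.mk f with hf0
  have hf0m : Measurable f0 := hf.aestronglyMeasurable.stronglyMeasurable_mk.measurable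
  have hf0e : f =ᵐ[volume] f0 := hf.aestronglyMeasurable.ae_eq_mk
  set Z : ℝ → ℝ≥0∞ := fun x => ∫⁻ y in Ioc u v, ENNReal.ofReal (Metric.infDist y Bᶜ * (1 + |f0 y|) * ((x - y) ^ 2)⁻¹) with hZ
  have hZm : Measurable Z := by
    have := (Metric.continuous_infDist_pt Bᶜ).measurable
    refine Measurable.lintegral_prod_right' (f := fun x : ℝ × ℝ => ENNReal.ofReal (Metric.infDist x.2 Bᶜ * (1 + |f0 x.2|) * ((x.1 - x.2) ^ 2)⁻¹)) ?_
    have : Measurable fun x => |f0 x| := by simpa [Real.norm_eq_abs] using hf0m.norm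
    fun_prop
  have hZI : ∫⁻ x in Bᶜ, Z x ≤ ENNReal.ofReal (8 * (v - u)) := by
    have hff : Measurable fun x => |f0 x| := by simpa [Real.norm_eq_abs] using hf0m.norm
    refine (mz_tonelli hF (g := fun y => 1 + |f0 y|) (by fun_prop) (fun y => by positivity) _).trans ?_
    have hi : IntegrableOn (fun y => 1 + |f0 y|) (Ioc u v) := by
      refine Integrable.add (integrableOn_const (by simp)) (hf.congr hf0e).abs.integrableOn
    rw [← ofReal_integral_eq_lintegral_ofReal hi (Eventually.of_forall fun y => by simp only [Pi.zero_apply]; positivity)]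
    have : (4 : ℝ≥0∞) = ENNReal.ofReal 4 := by simp
    rw [this, ← ENNReal.ofReal_mul (by norm_num)]
    refine ENNReal.ofReal_le_ofReal ?_
    have i1 : Integrable (fun _ : ℝ => (1:ℝ)) (volume.restrict (Ioc u v)) := integrableOn_const (by simp)
    rw [integral_add i1 (hf.congr hf0e).abs.integrableOn]
    have q1 : ∫ y in Ioc u v, |f0 y| ≤ v - u := by
      refine (setIntegral_le_integral (hf.congr hf0e).abs (Eventually.of_forall fun y => by simp only [Pi.zero_apply]; positivity)).trans ?_
      refine le_trans (le_of_eq ?_) hf1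
      refine integral_congr_ae ?_
      filter_upwards [hf0e] with y hy; rw [hy]
    have q2 : ∫ y in Ioc u v, (1:ℝ) = v - u := by simp [huv.le]
    linarith
  have hZC : volume {x | x ∈ Bᶜ ∧ ENNReal.ofReal M < Z x} ≤ ENNReal.ofReal (η / 3 * (v - u)) := by
    have hMne : ENNReal.ofReal M ≠ 0 := (ENNReal.ofReal_pos.2 hM).ne'
    have := mul_meas_ge_le_lintegral₀ (μ := volume.restrict Bᶜ) hZm.aemeasurable (ENNReal.ofReal M)
    have k : volume {x | x ∈ Bᶜ ∧ ENNReal.ofReal M < Z x} ≤ (volume.restrict Bᶜ) {x | ENNReal.ofReal M ≤ Z x} := by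
      rw [Measure.restrict_apply (measurableSet_le measurable_const hZm)]
      exact measure_mono fun x hx => ⟨hx.2.le, hx.1⟩
    refine k.trans ?_
    rw [mul_comm, ← ENNReal.le_div_iff_mul_le (Or.inl hMne) (Or.inl ENNReal.ofReal_ne_top)] at this
    refine this.trans ((ENNReal.div_le_div_right hZI _).trans ?_)
    rw [← ENNReal.ofReal_div_of_pos hM]
    refine ENNReal.ofReal_le_ofReal (le_of_eq ?_)
    rw [hMd]; field_simp; ring
  have hcot := cotlar_weak_L (m := m) h2 h1 hL h3 k1 k3 huv k4 hs
  have hcot' : C3 m * (v - u) / s = η / 3 * (v - u) := by rw [hsd]; field_simp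
  rw [hcot'] at hcot
  have hsub : {x | x ∈ Icc u v ∧ ∃ e, 0 < e ∧ (L ^ (m + 1) * (C2 m + s) + (8 * L ^ (m + 1) +
      (2 * (2 * m + 1) * L ^ m + 8 * (2 * m + 1) * L ^ (m + 1)) * M)) < |Tr m a f e x|} ⊆
      B ∪ ({x | x ∈ Bᶜ ∧ ENNReal.ofReal M < Z x} ∪ 
      {x | x ∈ Icc u v ∧ ∃ e, 0 < e ∧ L ^ (m + 1) * (C2 m + s) < |Tr m a' f' e x|}) := by
    rintro x ⟨hx, e, he, hlt⟩
    by_cases hxB : x ∈ B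
    · exact Or.inl hxB
    right
    by_cases hxZ : ENNReal.ofReal M < Z x
    · exact Or.inl ⟨hxB, hxZ⟩
    right
    refine ⟨hx, e, he, ?_⟩
    have := core_diff ha h2 hf k2 hfs k4 hL h3 (F := Bᶜ) (x := x) hxB hx (hbda x hxB)
      (fun j y hy => h5 j x hxB hx y hy) (fun y hy => k5 x hxB hx y hy) hM.le (by
        refine le_trans (le_of_eq ?_) (not_lt.1 hxZ)
        refine lintegral_congr_ae ?_
        filter_upwards [ae_restrict_of_ae hf0e] with y hy
        rw [hy]) he
    have h6 := abs_sub_abs_le_abs_sub (Tr m a f e x) (Tr m a' f' e x)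
    linarith
  refine (measure_mono hsub).trans ((measure_union_le _ _).trans ((add_le_add hBv ((measure_union_le _ _).trans (add_le_add hZC hcot))).trans ?_))
  have := sub_pos.2 huv
  rw [← ENNReal.ofReal_add (by positivity) (by positivity), ← ENNReal.ofReal_add (by positivity) (by positivity)]
  exact ENNReal.ofReal_le_ofReal (by linarith)

lemma Kq_smul' {m : ℕ} (a : Fin m → ℝ → ℝ) (c : Fin m → ℝ) (x y : ℝ) :
    Kq m (fun j t => c j * a j t) x y = (∏ j, c j) * Kq m a x y := by
  unfold Kq
  have : ∀ j, Adiff (fun t => c j * a j t) x y / (x - y) = c j * (Adiff (a j) x y / (x - y)) := fun j => by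
    unfold Adiff; rw [intervalIntegral.integral_const_mul]; ring
  simp_rw [this]
  rw [Finset.prod_mul_distrib]; ring

lemma Tr_smul' {m : ℕ} (a : Fin m → ℝ → ℝ) (f : ℝ → ℝ) (c : Fin m → ℝ) (d e x : ℝ) :
    Tr m (fun j t => c j * a j t) (fun t => d * f t) e x = (∏ j, c j) * d * Tr m a f e x := by
  unfold Tr
  rw [← integral_const_mul]
  refine integral_congr_ae (Eventually.of_forall fun y => ?_)
  simp only [Kq_smul']
  ring

lemma ae_zero_of_int {g : ℝ → ℝ} (hg : Integrable g) (h : ∫ y, |g y| ≤ 0) : g =ᵐ[volume] 0 := by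
  have h1 : ∫ y, |g y| = 0 := le_antisymm h (integral_nonneg fun _ => abs_nonneg _)
  have := (integral_eq_zero_iff_of_nonneg (fun _ => abs_nonneg _) hg.abs).1 h1
  filter_upwards [this] with y hy
  simpa using hy

lemma Adiff_zero_of_ae {g : ℝ → ℝ} (h : g =ᵐ[volume] 0) (x y : ℝ) : Adiff g x y = 0 := by
  unfold Adiff
  rw [intervalIntegral.integral_congr_ae (g := fun _ => 0)]
  · simp
  · filter_upwards [h] with t ht _ using ht

theorem core (m : ℕ) {η : ℝ} (hη : 0 < η) : ∃ Λ : ℝ, 0 < Λ ∧ ∀ (a : Fin m → ℝ → ℝ) (f : ℝ → ℝ) (u v : ℝ)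
    (α : Fin m → ℝ) (φ : ℝ), (∀ j, 0 ≤ α j) → 0 ≤ φ →
    (∀ j, Integrable (a j)) → Integrable f → (∀ y ∉ Ioc u v, f y = 0) → u < v →
    (∀ j, ∫ y, |a j y| ≤ α j * (v - u)) → ∫ y, |f y| ≤ φ * (v - u) →
    volume {x | x ∈ Icc u v ∧ ∃ e, 0 < e ∧ Λ * ((∏ j, α j) * φ) < |Tr m a f e x|} ≤
      ENNReal.ofReal (η * (v - u)) := by
  obtain ⟨Λ, hΛ, H⟩ := core0 m hη
  refine ⟨Λ, hΛ, ?_⟩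
  intro a f u v α φ hα hφ ha hf hs huv ha1 hf1
  have hzero : (∀ e x, Tr m a f e x = 0) → volume {x | x ∈ Icc u v ∧ ∃ e, 0 < e ∧ Λ * ((∏ j, α j) * φ) < |Tr m a f e x|} ≤
      ENNReal.ofReal (η * (v - u)) := by
    intro h0
    have : {x | x ∈ Icc u v ∧ ∃ e, 0 < e ∧ Λ * ((∏ j, α j) * φ) < |Tr m a f e x|} = ∅ := by
      ext x
      simp only [mem_ofPred_eq, mem_empty_iff_false, iff_false]
      rintro ⟨-, e, -, h⟩
      rw [h0, abs_zero] at h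
      have : 0 ≤ Λ * ((∏ j, α j) * φ) := by
        have := Finset.prod_nonneg (s := Finset.univ) fun j _ => hα j
        positivity
      linarith
    rw [this]; simp
  rcases hφ.eq_or_lt with h0 | hφ
  · apply hzero
    intro e x
    rw [← h0, zero_mul] at hf1
    have := ae_zero_of_int hf hf1
    unfold Tr
    rw [integral_congr_ae (g := fun _ => 0)]
    · simp
    · filter_upwards [ae_restrict_of_ae this] with y hy
      rw [hy]; simp
  by_cases hall : ∀ j, 0 < α j
  · have := H (fun j t => (α j)⁻¹ * a j t) (fun t => φ⁻¹ * f t) u v (fun j => (ha j).const_mul _) (hf.const_mul _)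
      (fun y hy => by rw [hs y hy, mul_zero]) huv (fun j => by
        have := hall j
        simp_rw [abs_mul, abs_inv, abs_of_pos this]
        rw [integral_const_mul, inv_mul_le_iff₀ this]; exact ha1 j) (by
        simp_rw [abs_mul, abs_inv, abs_of_pos hφ]
        rw [integral_const_mul, inv_mul_le_iff₀ hφ]; exact hf1)
    refine le_trans (measure_mono ?_) this
    rintro x ⟨hx, e, he, hl⟩
    refine ⟨hx, e, he, ?_⟩
    have hP : 0 < ∏ j, α j := Finset.prod_pos fun j _ => hall j
    rw [Tr_smul', abs_mul, abs_of_pos (by rw [Finset.prod_inv_distrib]; positivity), Finset.prod_inv_distrib, ← mul_inv]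
    rw [← div_eq_inv_mul, lt_div_iff₀ (by positivity)]
    exact hl
  · push Not at hall
    obtain ⟨j, hj⟩ := hall
    have hj0 : α j = 0 := le_antisymm hj (hα j)
    apply hzero
    intro e x
    have h2 := ha1 j
    rw [hj0, zero_mul] at h2
    have h3 := ae_zero_of_int (ha j) h2
    have : ∀ y, Kq m a x y = 0 := fun y => by
      unfold Kq
      rw [Finset.prod_eq_zero (Finset.mem_univ j), zero_div]
      rw [Adiff_zero_of_ae h3, zero_div]
    unfold Tr
    simp [this]

/-- almost everywhere locally constant -/
def LC (g : ℝ → ℝ) : Prop := ∀ᵐ x, ∃ r > 0, ∀ y, |x - y| < r → g y = g x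

lemma conv_of_approx {I : Set ℝ} {G : ℝ → ℝ → ℝ}
    (h : ∀ η > 0, ∀ δ > 0, ∃ G' : ℝ → ℝ → ℝ,
      (∀ᵐ x, x ∈ I → ∃ l, Tendsto (fun e => G' e x) (nhdsWithin 0 (Ioi 0)) (nhds l)) ∧
      volume {x | x ∈ I ∧ ∃ e, 0 < e ∧ δ < |G e x - G' e x|} ≤ ENNReal.ofReal η) :
    ∀ᵐ x, x ∈ I → ∃ l, Tendsto (fun e => G e x) (nhdsWithin 0 (Ioi 0)) (nhds l) := by
  have key : ∀ n : ℕ, ∀ᵐ x, x ∈ I → ∃ e0 > 0, ∀ e ∈ Ioo 0 e0, ∀ e' ∈ Ioo 0 e0, |G e x - G e' x| ≤ 4 / (n + 1 : ℝ) := by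
    intro n
    have hδ : (0:ℝ) < 1 / (n + 1) := by positivity
    rw [ae_iff]
    refine le_antisymm (ENNReal.le_of_forall_pos_le_add fun η hη _ => ?_) (zero_le)
    obtain ⟨G', h1, h2⟩ := h η hη (1 / (n + 1)) hδ
    rw [zero_add]
    rw [ENNReal.ofReal_coe_nnreal] at h2
    refine le_trans ?_ h2
    rw [ae_iff] at h1
    refine (measure_mono (t := {x | ¬(x ∈ I → ∃ l, Tendsto (fun e => G' e x) (nhdsWithin 0 (Ioi 0)) (nhds l))} ∪ {x | x ∈ I ∧ ∃ e, 0 < e ∧ 1 / (n + 1 : ℝ) < |G e x - G' e x|}) ?_).trans ((measure_union_le _ _).trans (by rw [h1, zero_add]))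
    intro x hx
    by_contra hc
    simp only [mem_union, mem_ofPred_eq, not_or, not_not] at hc
    refine hx fun hxI => ?_
    obtain ⟨l, hl⟩ := hc.1 hxI
    have hc2 := hc.2
    push Not at hc2
    have := (Metric.tendsto_nhdsWithin_nhds.1 hl) (1 / (n + 1)) hδ
    obtain ⟨e0, he0, H⟩ := this
    refine ⟨e0, he0, fun e he e' he' => ?_⟩
    have q1 := H he.1 (by rw [Real.dist_eq, sub_zero, abs_of_pos he.1]; exact he.2)
    have q2 := H he'.1 (by rw [Real.dist_eq, sub_zero, abs_of_pos he'.1]; exact he'.2)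
    have q3 := hc2 hxI e he.1
    have q4 := hc2 hxI e' he'.1
    rw [Real.dist_eq] at q1 q2
    have : (4:ℝ) / (n + 1) = 4 * (1 / (n + 1)) := by ring
    rw [this, abs_le]
    rw [abs_lt] at q1 q2
    rw [abs_le] at q3 q4
    constructor <;> linarith
  have := ae_all_iff.2 key
  filter_upwards [this] with x hx hxI
  apply cauchy_map_iff_exists_tendsto.1
  refine Metric.cauchy_iff.2 ⟨inferInstance, fun ε hε => ?_⟩
  obtain ⟨n, hn⟩ := exists_nat_gt (4 / ε)
  obtain ⟨e0, he0, H⟩ := hx n hxI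
  refine ⟨(fun e => G e x) '' Ioo 0 e0, image_mem_map (Ioo_mem_nhdsGT he0), ?_⟩
  rintro _ ⟨e, he, rfl⟩ _ ⟨e', he', rfl⟩
  rw [Real.dist_eq]
  refine (H e he e' he').trans_lt ?_
  rw [div_lt_iff₀ (by positivity)]
  rw [div_lt_iff₀ hε] at hn
  nlinarith

lemma LC_approx {g : ℝ → ℝ} (hg : Integrable g) {ε : ℝ} (hε : 0 < ε) :
    ∃ b : ℝ → ℝ, Integrable b ∧ LC b ∧ ∫ y, |g y - b y| ≤ ε := by
  obtain ⟨k, hk1, hk2, hk3, hk4⟩ := hg.exists_hasCompactSupport_integral_sub_le (half_pos hε)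
  obtain ⟨R, hR⟩ := hk1.isCompact.isBounded.subset_closedBall (0:ℝ)
  have hR' : ∀ y, |R| < |y| → k y = 0 := fun y hy => by
    by_contra hc
    have := hR (subset_tsupport _ hc)
    rw [mem_closedBall_zero_iff, Real.norm_eq_abs] at this
    linarith [le_abs_self R]
  have huc := hk1.uniformContinuous_of_continuous hk3
  rw [Metric.uniformContinuous_iff] at huc
  obtain ⟨δ0, hδ0, H⟩ := huc (ε / 2 / (2 * (|R| + 1))) (by positivity)
  set δ := min (δ0 / 2) 1 with hδ
  have hδp : 0 < δ := by positivity
  have hδ1 : δ ≤ 1 := min_le_right _ _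
  have hδ2 : δ < δ0 := (min_le_left _ _).trans_lt (by linarith)
  set p : ℝ → ℝ := fun y => (⌊y / δ⌋ : ℝ) * δ with hp
  have hp1 : ∀ y, p y ≤ y := fun y => by
    have := Int.floor_le (y / δ)
    rwa [le_div_iff₀ hδp] at this
  have hp2 : ∀ y, y < p y + δ := fun y => by
    have := Int.lt_floor_add_one (y / δ)
    rw [div_lt_iff₀ hδp] at this
    simp only [hp]; linarith
  have hd : ∀ y, |k y - k (p y)| ≤ ε / 2 / (2 * (|R| + 1)) := fun y => by
    have := H (a := y) (b := p y) (by rw [Real.dist_eq, abs_of_nonneg (by linarith [hp1 y])]; linarith [hp2 y])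
    rw [Real.dist_eq] at this; exact this.le
  have hz : ∀ y ∉ Icc (-(|R| + 1)) (|R| + 1), k y - k (p y) = 0 := fun y hy => by
    have h1 : |R| + 1 < |y| := by
      by_contra hc
      exact hy (abs_le.1 (not_lt.1 hc))
    have h2 : |R| < |p y| := by
      have : |y - p y| ≤ 1 := by rw [abs_of_nonneg (by linarith [hp1 y])]; linarith [hp2 y]
      have := abs_sub_abs_le_abs_sub y (p y)
      linarith
    rw [hR' _ (by linarith), hR' _ h2, sub_zero]
  have hkp : Measurable fun y => k (p y) := hk3.measurable.comp (by simp only [hp]; fun_prop)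
  have hdi : Integrable fun y => k y - k (p y) := by
    have : IntegrableOn (fun y => k y - k (p y)) (Icc (-(|R| + 1)) (|R| + 1)) :=
      Measure.integrableOn_of_bounded (M := ε / 2 / (2 * (|R| + 1))) (by simp) (hk3.measurable.sub hkp).aestronglyMeasurable
        (Eventually.of_forall fun y => hd y)
    exact this.integrable_of_forall_notMem_eq_zero hz
  have hki : Integrable fun y => k (p y) := by
    have := hk4.sub hdi
    refine this.congr (Eventually.of_forall fun y => ?_)
    simp
  refine ⟨fun y => k (p y), hki, ?_, ?_⟩
  · have hcount : (range fun n : ℤ => (n:ℝ) * δ).Countable := countable_range _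
    have := hcount.ae_notMem volume
    unfold LC
    filter_upwards [this] with x hx
    have hne : p x < x := lt_of_le_of_ne (hp1 x) fun h => hx ⟨_, h⟩
    refine ⟨min (x - p x) (p x + δ - x), lt_min (by linarith) (by linarith [hp2 x]), fun y hy => ?_⟩
    have : ⌊y / δ⌋ = ⌊x / δ⌋ := by
      rw [Int.floor_eq_iff, le_div_iff₀ hδp, div_lt_iff₀ hδp]
      have h3 := hy.trans_le (min_le_left _ _)
      have h4 := hy.trans_le (min_le_right _ _)
      rw [abs_lt] at h3 h4
      constructor
      · change p x ≤ y; linarith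
      · have : ((⌊x / δ⌋:ℝ) + 1) * δ = p x + δ := by simp only [hp]; ring
        rw [this]; linarith
    simp only [hp, this]
  · have e1 : ∫ y, |k y - k (p y)| ≤ ε / 2 := by
      rw [← setIntegral_eq_integral_of_forall_compl_eq_zero (s := Icc (-(|R| + 1)) (|R| + 1)) (fun y hy => by rw [hz y hy, abs_zero])]
      calc ∫ y in Icc (-(|R| + 1)) (|R| + 1), |k y - k (p y)| 
          ≤ ∫ y in Icc (-(|R| + 1)) (|R| + 1), ε / 2 / (2 * (|R| + 1)) := by
            refine setIntegral_mono hdi.abs.integrableOn (integrableOn_const (by simp)) hd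
        _ = ε / 2 := by
            rw [setIntegral_const, Real.volume_real_Icc_of_le (by linarith [abs_nonneg R]), smul_eq_mul]
            have : 0 < |R| + 1 := by positivity
            field_simp; norm_num
    have e2 : ∫ y, |g y - k (p y)| ≤ ∫ y, (|g y - k y| + |k y - k (p y)|) :=
      integral_mono (hg.sub hki).abs ((hg.sub hk4).abs.add hdi.abs) fun y => abs_sub_le _ _ _
    have hgk : Integrable fun y => |g y - k y| := (hg.sub hk4).abs
    rw [integral_add hgk hdi.abs] at e2
    simp only [Real.norm_eq_abs] at hk2
    linarith

lemma LC_indicator {g : ℝ → ℝ} (hg : LC g) (u v : ℝ) : LC ((Ioc u v).indicator g) := by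
  unfold LC at *
  have h1 : ∀ᵐ x : ℝ, x ∉ ({u, v} : Set ℝ) := ((countable_singleton v).insert u).ae_notMem volume
  filter_upwards [hg, h1] with x ⟨r, hr, H⟩ hx
  simp only [mem_insert_iff, mem_singleton_iff, not_or] at hx
  have a1 : 0 < |x - u| := abs_pos.2 (sub_ne_zero.2 hx.1)
  have a2 : 0 < |x - v| := abs_pos.2 (sub_ne_zero.2 hx.2)
  refine ⟨min r (min |x - u| |x - v|), by positivity, fun y hy => ?_⟩
  rw [lt_min_iff, lt_min_iff] at hy
  have hiff : y ∈ Ioc u v ↔ x ∈ Ioc u v := by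
    simp only [mem_Ioc]
    obtain ⟨-, h2, h3⟩ := hy
    have q1 : u < y ↔ u < x := by
      rcases lt_or_gt_of_ne hx.1 with h | h
      · rw [abs_of_neg (by linarith : x - u < 0), abs_lt] at h2
        constructor <;> intro <;> linarith
      · rw [abs_of_pos (by linarith : 0 < x - u), abs_lt] at h2
        constructor <;> intro <;> linarith
    have q2 : y ≤ v ↔ x ≤ v := by
      rcases lt_or_gt_of_ne hx.2 with h | h
      · rw [abs_of_neg (by linarith : x - v < 0), abs_lt] at h3
        constructor <;> intro <;> linarith
      · rw [abs_of_pos (by linarith : 0 < x - v), abs_lt] at h3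
        constructor <;> intro <;> linarith
    rw [q1, q2]
  by_cases hm : x ∈ Ioc u v
  · rw [indicator_of_mem hm, indicator_of_mem (hiff.2 hm), H y hy.1]
  · rw [indicator_of_notMem hm, indicator_of_notMem (fun h => hm (hiff.1 h))]

lemma annulus_zero {e r : ℝ} (x : ℝ) :
    ∫ y in {y | e < |x - y| ∧ |x - y| ≤ r}, (x - y)⁻¹ = 0 := by
  have hm : MeasurableSet {y : ℝ | e < |x - y| ∧ |x - y| ≤ r} := 
    (measurableSet_trunc e x).inter (measurableSet_le (by fun_prop : Continuous fun y : ℝ => |x - y|).measurable measurable_const)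
  rw [← integral_indicator hm]
  set h : ℝ → ℝ := {t : ℝ | e < |t| ∧ |t| ≤ r}.indicator fun t => t⁻¹ with hh
  have h1 : (fun y => {y : ℝ | e < |x - y| ∧ |x - y| ≤ r}.indicator (fun y => (x - y)⁻¹) y) = fun y => h (x - y) := by
    ext y; simp only [hh, indicator, mem_ofPred_eq]; congr
  rw [h1, integral_sub_left_eq_self h volume x]
  have h2 := integral_neg_eq_self h volume
  have h3 : ∀ t, h (-t) = - h t := fun t => by
    simp only [hh, indicator, mem_ofPred_eq, abs_neg]
    split_ifs
    · rw [inv_neg]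
    · simp
  simp_rw [h3] at h2
  rw [integral_neg] at h2
  linarith

lemma conv_LC {m : ℕ} {a : Fin m → ℝ → ℝ} (ha : ∀ j, Integrable (a j)) (hl : ∀ j, LC (a j))
    {f : ℝ → ℝ} (hf : Integrable f) (hlf : LC f) :
    ∀ᵐ x, ∃ l, Tendsto (fun e => Tr m a f e x) (nhdsWithin 0 (Ioi 0)) (nhds l) := by
  have := ae_all_iff.2 hl
  filter_upwards [this, hlf] with x hx hfx
  choose R hR HR using hx
  obtain ⟨r0, hr0, H0⟩ := hfx
  obtain ⟨r1, hr1, H1⟩ : ∃ r1 > 0, ∀ j, r1 ≤ R j := by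
    rcases isEmpty_or_nonempty (Fin m) with h | h
    · exact ⟨1, one_pos, fun j => h.elim j⟩
    · obtain ⟨i, hi⟩ := Finite.exists_min R
      exact ⟨R i, hR i, hi⟩
  set r := min r0 r1 / 2 with hr
  have hrp : 0 < r := by positivity
  have hrl0 : r < r0 := by have := min_le_left r0 r1; have : 0 < min r0 r1 := by positivity
                           linarith
  have hrl1 : r < r1 := by have := min_le_right r0 r1; have : 0 < min r0 r1 := by positivity
                           linarith
  refine ⟨Tr m a f r x, ?_⟩
  refine Tendsto.congr' ?_ tendsto_const_nhds
  filter_upwards [Ioo_mem_nhdsGT hrp] with e he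
  have hsplit : {y : ℝ | e < |x - y|} = {y | r < |x - y|} ∪ {y | e < |x - y| ∧ |x - y| ≤ r} := by
    ext y; simp only [mem_ofPred_eq, mem_union]
    constructor
    · intro h; rcases lt_or_ge r |x - y| with h' | h'
      · exact Or.inl h'
      · exact Or.inr ⟨h, h'⟩
    · rintro (h | h)
      · exact he.2.trans h
      · exact h.1
  have hm : MeasurableSet {y : ℝ | e < |x - y| ∧ |x - y| ≤ r} := 
    (measurableSet_trunc e x).inter (measurableSet_le (by fun_prop : Continuous fun y : ℝ => |x - y|).measurable measurable_const)
  have hi := Tr_integrable ha hf he.1 x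
  unfold Tr
  rw [hsplit] at hi ⊢
  rw [setIntegral_union (s := {y | r < |x - y|}) (disjoint_left.2 fun y h1 h2 => not_lt.2 h2.2 h1) hm (hi.mono_set subset_union_left) (hi.mono_set subset_union_right)]
  have : ∫ y in {y | e < |x - y| ∧ |x - y| ≤ r}, Kq m a x y * f y = ∫ y in {y | e < |x - y| ∧ |x - y| ≤ r}, ((∏ j, a j x) * f x) * (x - y)⁻¹ := by
    refine setIntegral_congr_fun hm fun y hy => ?_
    have hy0 : x - y ≠ 0 := abs_pos.1 (he.1.trans hy.1)
    have h1 : ∀ j, Adiff (a j) x y / (x - y) = a j x := fun j => by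
      unfold Adiff
      rw [intervalIntegral.integral_congr (g := fun _ => a j x)]
      · rw [intervalIntegral.integral_const, smul_eq_mul]; field_simp
      · intro t ht
        refine HR j t ?_
        have : |x - t| ≤ |x - y| := by
          have := Set.abs_sub_right_of_mem_uIcc ht
          exact this
        linarith [H1 j, hy.2]
    unfold Kq
    simp only [h1]
    rw [H0 y (by linarith [hy.2])]
    field_simp
  rw [this, integral_const_mul, annulus_zero, mul_zero, add_zero]

lemma Adiff_sub {g h : ℝ → ℝ} (hg : Integrable g) (hh : Integrable h) (x y : ℝ) :
    Adiff (fun t => g t - h t) x y = Adiff g x y - Adiff h x y := 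
  intervalIntegral.integral_sub hg.intervalIntegrable hh.intervalIntegrable

lemma Kq_update_eq {m : ℕ} (a : Fin m → ℝ → ℝ) (i : Fin m) (b : ℝ → ℝ) (x y : ℝ) :
    Kq m (Function.update a i b) x y = 
      (Adiff b x y / (x - y)) * (∏ j ∈ Finset.univ.erase i, Adiff (a j) x y / (x - y)) / (x - y) := by
  unfold Kq
  rw [← Finset.mul_prod_erase _ _ (Finset.mem_univ i)]
  congr 2
  · simp
  · refine Finset.prod_congr rfl fun j hj => ?_
    rw [Function.update_of_ne (Finset.ne_of_mem_erase hj)]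

lemma Kq_update_sub {m : ℕ} (a : Fin m → ℝ → ℝ) (i : Fin m) (ha : Integrable (a i)) {b : ℝ → ℝ} (hb : Integrable b) (x y : ℝ) :
    Kq m a x y - Kq m (Function.update a i b) x y = Kq m (Function.update a i fun t => a i t - b t) x y := by
  have h1 : Kq m a x y = Kq m (Function.update a i (a i)) x y := by rw [Function.update_eq_self]
  rw [h1, Kq_update_eq, Kq_update_eq, Kq_update_eq, Adiff_sub ha hb]
  ring

lemma update_integrable {m : ℕ} {a : Fin m → ℝ → ℝ} (ha : ∀ j, Integrable (a j)) (i : Fin m) {b : ℝ → ℝ} (hb : Integrable b)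
    (j : Fin m) : Integrable (Function.update a i b j) := by
  by_cases h : j = i
  · subst h; simpa using hb
  · rw [Function.update_of_ne h]; exact ha j

lemma Tr_update_sub {m : ℕ} {a : Fin m → ℝ → ℝ} (ha : ∀ j, Integrable (a j)) (i : Fin m) {b : ℝ → ℝ} (hb : Integrable b)
    {f : ℝ → ℝ} (hf : Integrable f) {e : ℝ} (he : 0 < e) (x : ℝ) :
    Tr m a f e x - Tr m (Function.update a i b) f e x = Tr m (Function.update a i fun t => a i t - b t) f e x := by
  unfold Tr
  rw [← integral_sub (Tr_integrable ha hf he x) (Tr_integrable (update_integrable ha i hb) hf he x)]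
  refine integral_congr_ae (Eventually.of_forall fun y => ?_)
  simp only
  rw [← sub_mul, Kq_update_sub a i (ha i) hb]

lemma Tr_f_sub {m : ℕ} {a : Fin m → ℝ → ℝ} (ha : ∀ j, Integrable (a j)) 
    {f g : ℝ → ℝ} (hf : Integrable f) (hg : Integrable g) {e : ℝ} (he : 0 < e) (x : ℝ) :
    Tr m a f e x - Tr m a g e x = Tr m a (fun t => f t - g t) e x := by
  unfold Tr
  rw [← integral_sub (Tr_integrable ha hf he x) (Tr_integrable ha hg he x)]
  refine integral_congr_ae (Eventually.of_forall fun y => ?_)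
  simp only; ring

lemma conv_f {m : ℕ} {a : Fin m → ℝ → ℝ} (ha : ∀ j, Integrable (a j)) (hl : ∀ j, LC (a j))
    {f : ℝ → ℝ} (hf : Integrable f) {u v : ℝ} (huv : u < v) (hs : ∀ y ∉ Ioc u v, f y = 0) :
    ∀ᵐ x, x ∈ Icc u v → ∃ l, Tendsto (fun e => Tr m a f e x) (nhdsWithin 0 (Ioi 0)) (nhds l) := by
  have hvu := sub_pos.2 huv
  refine conv_of_approx (G := fun e x => Tr m a f e x) fun η hη δ hδ => ?_
  obtain ⟨Λ, hΛ, H⟩ := core m (div_pos hη hvu)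
  set P := ∏ j, ((∫ y, |a j y|) / (v - u)) with hP
  have hα : ∀ j, 0 ≤ (∫ y, |a j y|) / (v - u) := fun j => div_nonneg (integral_nonneg fun _ => abs_nonneg _) hvu.le
  have hP0 : 0 ≤ P := Finset.prod_nonneg fun j _ => hα j
  set φ := δ / (Λ * (P + 1)) with hφ
  have hφ0 : 0 < φ := by positivity
  obtain ⟨b, hb1, hb2, hb3⟩ := LC_approx hf (ε := φ * (v - u)) (by positivity)
  set b' := (Ioc u v).indicator b with hb'
  have hb'1 : Integrable b' := hb1.indicator measurableSet_Ioc
  refine ⟨fun e x => Tr m a b' e x, ?_, ?_⟩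
  · filter_upwards [conv_LC ha hl hb'1 (LC_indicator hb2 u v)] with x hx _ using hx
  · have := H a (fun t => f t - b' t) u v (fun j => (∫ y, |a j y|) / (v - u)) φ hα hφ0.le ha (hf.sub hb'1) (fun y hy => by
      rw [hs y hy, hb', indicator_of_notMem hy, sub_zero]) huv (fun j => by field_simp; exact le_rfl) (by
      refine le_trans (integral_mono (hf.sub hb'1).abs (hf.sub hb1).abs fun y => ?_) hb3
      by_cases hy : y ∈ Ioc u v
      · simp [hb', indicator_of_mem hy]
      · simp [hb', indicator_of_notMem hy, hs y hy])
    rw [div_mul_cancel₀ _ hvu.ne'] at this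
    refine le_trans (measure_mono ?_) this
    rintro x ⟨hx, e, he, hl⟩
    refine ⟨hx, e, he, ?_⟩
    rw [Tr_f_sub ha hf hb'1 he] at hl
    refine lt_of_le_of_lt ?_ hl
    change Λ * (P * φ) ≤ δ
    rw [hφ]
    have : Λ * (P * (δ / (Λ * (P + 1)))) = δ * (P / (P + 1)) := by field_simp
    rw [this]
    exact mul_le_of_le_one_right hδ.le ((div_le_one (by linarith)).2 (by linarith))

theorem conv_all {m : ℕ} {f : ℝ → ℝ} (hf : Integrable f) {u v : ℝ} (huv : u < v) (hs : ∀ y ∉ Ioc u v, f y = 0) 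
    (S : Finset (Fin m)) : ∀ a : Fin m → ℝ → ℝ, (∀ j, Integrable (a j)) → (∀ j ∉ S, LC (a j)) →
    ∀ᵐ x, x ∈ Icc u v → ∃ l, Tendsto (fun e => Tr m a f e x) (nhdsWithin 0 (Ioi 0)) (nhds l) := by
  have hvu := sub_pos.2 huv
  induction S using Finset.induction_on with
  | empty => intro a ha hl; exact conv_f ha (fun j => hl j (by simp)) hf huv hs
  | insert i S hi ih =>
    intro a ha hl
    refine conv_of_approx (G := fun e x => Tr m a f e x) fun η hη δ hδ => ?_
    obtain ⟨Λ, hΛ, H⟩ := core m (div_pos hη hvu)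
    set φ := (∫ y, |f y|) / (v - u) with hφ
    have hφ0 : 0 ≤ φ := div_nonneg (integral_nonneg fun _ => abs_nonneg _) hvu.le
    set P := ∏ j ∈ Finset.univ.erase i, ((∫ y, |a j y|) / (v - u)) with hP
    have hα : ∀ j, 0 ≤ (∫ y, |a j y|) / (v - u) := fun j => div_nonneg (integral_nonneg fun _ => abs_nonneg _) hvu.le
    have hP0 : 0 ≤ P := Finset.prod_nonneg fun j _ => hα j
    set τ := δ / (Λ * (P * φ + 1)) with hτ
    have hτ0 : 0 < τ := by positivity
    obtain ⟨b, hb1, hb2, hb3⟩ := LC_approx (ha i) (ε := τ * (v - u)) (by positivity)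
    refine ⟨fun e x => Tr m (Function.update a i b) f e x, ?_, ?_⟩
    · refine ih _ (update_integrable ha i hb1) fun j hj => ?_
      by_cases h : j = i
      · subst h; simpa using hb2
      · rw [Function.update_of_ne h]; exact hl j (by simp [h, hj])
    · have := H (Function.update a i fun t => a i t - b t) f u v (Function.update (fun j => (∫ y, |a j y|) / (v - u)) i τ) φ (fun j => by
          by_cases h : j = i
          · subst h; simpa using hτ0.le
          · rw [Function.update_of_ne h]; exact hα j) hφ0 (update_integrable ha i ((ha i).sub hb1)) hf hs huv (fun j => by
          by_cases h : j = i
          · subst h; simpa using hb3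
          · rw [Function.update_of_ne h, Function.update_of_ne h, div_mul_cancel₀ _ hvu.ne']) (by rw [hφ, div_mul_cancel₀ _ hvu.ne'])
      rw [div_mul_cancel₀ _ hvu.ne'] at this
      refine le_trans (measure_mono ?_) this
      rintro x ⟨hx, e, he, hl⟩
      refine ⟨hx, e, he, ?_⟩
      rw [Tr_update_sub ha i hb1 hf he] at hl
      refine lt_of_le_of_lt ?_ hl
      have hprod : ∏ j, Function.update (fun j => (∫ y, |a j y|) / (v - u)) i τ j = τ * P := by
        rw [← Finset.mul_prod_erase _ _ (Finset.mem_univ i)]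
        congr 1
        · simp
        · refine Finset.prod_congr rfl fun j hj => ?_
          rw [Function.update_of_ne (Finset.ne_of_mem_erase hj)]
      rw [hprod, hτ]
      have hPf : 0 ≤ P * φ := by positivity
      have : Λ * (δ / (Λ * (P * φ + 1)) * P * φ) = δ * ((P * φ) / (P * φ + 1)) := by field_simp
      rw [this]
      exact mul_le_of_le_one_right hδ.le ((div_le_one (by linarith)).2 (by linarith))

/-- almost everywhere convergence of the truncations -/
theorem conv_ae {m : ℕ} {a : Fin m → ℝ → ℝ} (ha : ∀ j, Integrable (a j)) {f : ℝ → ℝ} (hf : Integrable f)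
    {u v : ℝ} (huv : u < v) (hs : ∀ y ∉ Ioc u v, f y = 0) :
    ∀ᵐ x, x ∈ Icc u v → ∃ l, Tendsto (fun e => Tr m a f e x) (nhdsWithin 0 (Ioi 0)) (nhds l) :=
  conv_all hf huv hs Finset.univ a ha (by simp)

/-- the half of `J` containing `x` -/
noncomputable def child (J : ℝ × ℝ) (x : ℝ) : ℝ × ℝ :=
  if x ≤ (J.1 + J.2) / 2 then (J.1, (J.1 + J.2) / 2) else ((J.1 + J.2) / 2, J.2)

/-- interval as a set -/
def ivl (J : ℝ × ℝ) : Set ℝ := Ioc J.1 J.2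

lemma measurableSet_ivl (J : ℝ × ℝ) : MeasurableSet (ivl J) := measurableSet_Ioc

lemma volume_ivl (J : ℝ × ℝ) : volume (ivl J) = ENNReal.ofReal (J.2 - J.1) := Real.volume_Ioc

/-- stopping condition -/
def stops (E : ℝ × ℝ → Set ℝ) (I J : ℝ × ℝ) : Prop :=
  ENNReal.ofReal ((J.2 - J.1) / 4) < volume (ivl J ∩ E I)

open Classical in
/-- the chain of stopping intervals containing `x` strictly below `J`, stopped relative to `I`. -/
noncomputable def chain (E : ℝ × ℝ → Set ℝ) : ℕ → ℝ × ℝ → ℝ × ℝ → ℝ → List (ℝ × ℝ)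
  | 0, _, _, _ => []
  | n + 1, I, J, x =>
      if stops E I (child J x) then child J x :: chain E n (child J x) (child J x) x
      else chain E n I (child J x) x

lemma child_lt {J : ℝ × ℝ} (h : J.1 < J.2) (x : ℝ) : (child J x).1 < (child J x).2 := by
  unfold child; split_ifs <;> simp only <;> linarith

lemma child_len (J : ℝ × ℝ) (x : ℝ) : (child J x).2 - (child J x).1 = (J.2 - J.1) / 2 := by
  unfold child; split_ifs <;> simp only <;> ring

lemma mem_child {J : ℝ × ℝ} {x : ℝ} (h : x ∈ ivl J) : x ∈ ivl (child J x) := by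
  unfold child ivl at *
  split_ifs with h1
  · exact ⟨h.1, h1⟩
  · exact ⟨not_le.1 h1, h.2⟩

lemma child_sub {J : ℝ × ℝ} (h : J.1 < J.2) (x : ℝ) : ivl (child J x) ⊆ ivl J := by
  unfold child ivl
  split_ifs with h1
  · exact Ioc_subset_Ioc le_rfl (by simp only; linarith)
  · exact Ioc_subset_Ioc (by simp only; linarith) le_rfl

/-- split a set along the two halves -/
lemma split_halves (ν : Measure ℝ) {J : ℝ × ℝ} (h : J.1 < J.2) (S : Set ℝ) :
    ν (ivl J ∩ S) = ν (ivl (J.1, (J.1 + J.2) / 2) ∩ S) + ν (ivl ((J.1 + J.2) / 2, J.2) ∩ S) := by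
  rw [← measure_inter_add_sdiff (ivl J ∩ S) (measurableSet_ivl (J.1, (J.1 + J.2) / 2))]
  congr 2
  · ext x; simp only [ivl, mem_inter_iff, mem_Ioc]
    constructor
    · rintro ⟨⟨_, h3⟩, h4⟩; exact ⟨h4, h3⟩
    · rintro ⟨h1, h2⟩; exact ⟨⟨⟨h1.1, by linarith [h1.2]⟩, h2⟩, h1⟩
  · ext x; simp only [ivl, Set.mem_sdiff, mem_inter_iff, mem_Ioc]
    constructor
    · rintro ⟨⟨h2, h3⟩, h4⟩
      push Not at h4
      exact ⟨⟨h4 h2.1, h2.2⟩, h3⟩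
    · rintro ⟨h1, h2⟩
      exact ⟨⟨⟨by linarith [h1.1], h1.2⟩, h2⟩, fun h5 => by linarith [h1.1, h5.2]⟩

lemma child_left {J : ℝ × ℝ} {x : ℝ} (h : x ∈ ivl (J.1, (J.1 + J.2) / 2)) : child J x = (J.1, (J.1 + J.2) / 2) := by
  unfold child; rw [if_pos h.2]

lemma child_right {J : ℝ × ℝ} {x : ℝ} (h : x ∈ ivl ((J.1 + J.2) / 2, J.2)) : child J x = ((J.1 + J.2) / 2, J.2) := by
  unfold child; rw [if_neg (not_le.2 h.1)]

/-- an inequality for both children gives an inequality for the parent -/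
lemma halves_le (ν ν' : Measure ℝ) (c : ℝ≥0∞) {J : ℝ × ℝ} (h : J.1 < J.2) (S T : Set ℝ)
    (H : ∀ K : ℝ × ℝ, K.1 < K.2 → ivl K ⊆ ivl J → K.2 - K.1 = (J.2 - J.1) / 2 → (∀ x ∈ ivl K, child J x = K) →
      ν (ivl K ∩ S) ≤ c * ν' (ivl K ∩ T)) : ν (ivl J ∩ S) ≤ c * ν' (ivl J ∩ T) := by
  rw [split_halves ν h, split_halves ν' h, mul_add]
  refine add_le_add (H _ (by simp only; linarith) (Ioc_subset_Ioc le_rfl (by simp only; linarith)) (by simp only; ring)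
    fun x hx => child_left hx) (H _ (by simp only; linarith) (Ioc_subset_Ioc (by simp only; linarith) le_rfl) (by simp only; ring)
    fun x hx => child_right hx)

/-- the first stopping generation has small Lebesgue measure -/
lemma chain_first (E : ℝ × ℝ → Set ℝ) (n : ℕ) : ∀ I J : ℝ × ℝ, J.1 < J.2 →
    volume (ivl J ∩ {x | 1 ≤ (chain E n I J x).length}) ≤ 4 * volume (ivl J ∩ E I) := by
  induction n with
  | zero => intro I J _; simp [chain]
  | succ n ih =>
    intro I J hJ
    refine halves_le _ _ _ hJ _ _ fun K hK _ _ hc => ?_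
    by_cases hs : stops E I K
    · refine (measure_mono inter_subset_left).trans ?_
      have h1 : ENNReal.ofReal ((K.2 - K.1) / 4) < volume (ivl K ∩ E I) := hs
      have h2 : ENNReal.ofReal (K.2 - K.1) = 4 * ENNReal.ofReal ((K.2 - K.1) / 4) := by
        have : (4 : ℝ≥0∞) = ENNReal.ofReal 4 := by simp
        rw [this, ← ENNReal.ofReal_mul (by norm_num)]; congr 1; ring
      rw [volume_ivl, h2]
      gcongr
    · refine le_trans (measure_mono ?_) (ih I K hK)
      rintro x ⟨hx, hx2⟩
      refine ⟨hx, ?_⟩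
      simp only [mem_ofPred_eq, chain] at hx2 ⊢
      rwa [hc x hx, if_neg hs] at hx2

section ChainSec

variable {ν : Measure ℝ} {θ : ℝ≥0∞} {E : ℝ × ℝ → Set ℝ} 

lemma chain_decay (hE : ∀ I : ℝ × ℝ, I.1 < I.2 → volume (ivl I ∩ E I) ≤ ENNReal.ofReal ((I.2 - I.1) / 8))
    (hν : ∀ (I : ℝ × ℝ) (S : Set ℝ), I.1 < I.2 → S ⊆ ivl I → volume S ≤ ENNReal.ofReal ((I.2 - I.1) / 2) → ν S ≤ θ * ν (ivl I))
    (n : ℕ) : (∀ I J : ℝ × ℝ, J.1 < J.2 → ∀ k, ν (ivl J ∩ {x | k + 1 ≤ (chain E n I J x).length}) ≤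
      θ ^ k * ν (ivl J ∩ {x | 1 ≤ (chain E n I J x).length})) ∧
      (∀ J : ℝ × ℝ, J.1 < J.2 → ∀ k, ν (ivl J ∩ {x | k ≤ (chain E n J J x).length}) ≤ θ ^ k * ν (ivl J)) := by
  have B : (∀ I J : ℝ × ℝ, J.1 < J.2 → ∀ k, ν (ivl J ∩ {x | k + 1 ≤ (chain E n I J x).length}) ≤
      θ ^ k * ν (ivl J ∩ {x | 1 ≤ (chain E n I J x).length})) → 
      (∀ J : ℝ × ℝ, J.1 < J.2 → ∀ k, ν (ivl J ∩ {x | k ≤ (chain E n J J x).length}) ≤ θ ^ k * ν (ivl J)) := by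
    intro h J hJ k
    rcases k with _ | k
    · simp
    refine (h J J hJ k).trans ?_
    rw [pow_succ, mul_assoc]
    gcongr
    refine hν J _ hJ inter_subset_left ((chain_first E n J J hJ).trans ?_)
    have : (4 : ℝ≥0∞) = ENNReal.ofReal 4 := by simp
    calc 4 * volume (ivl J ∩ E J) ≤ 4 * ENNReal.ofReal ((J.2 - J.1) / 8) := by gcongr; exact hE J hJ
      _ = ENNReal.ofReal ((J.2 - J.1) / 2) := by
        rw [this, ← ENNReal.ofReal_mul (by norm_num)]; congr 1; ring
  induction n with
  | zero => 
    refine ⟨fun I J hJ k => by simp [chain], fun J hJ k => ?_⟩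
    rcases k with _ | k <;> simp [chain]
  | succ n ih =>
    obtain ⟨ih1, ih2⟩ := ih (fun h J hJ k => by
      rcases k with _ | k
      · simp
      refine (h J J hJ k).trans ?_
      rw [pow_succ, mul_assoc]
      gcongr
      refine hν J _ hJ inter_subset_left ((chain_first E n J J hJ).trans ?_)
      have : (4 : ℝ≥0∞) = ENNReal.ofReal 4 := by simp
      calc 4 * volume (ivl J ∩ E J) ≤ 4 * ENNReal.ofReal ((J.2 - J.1) / 8) := by gcongr; exact hE J hJ
        _ = ENNReal.ofReal ((J.2 - J.1) / 2) := by
          rw [this, ← ENNReal.ofReal_mul (by norm_num)]; congr 1; ring)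
    refine ⟨?_, B ?_⟩ <;>
    · intro I J hJ k
      refine halves_le _ _ _ hJ _ _ fun K hK _ _ hc => ?_
      by_cases hs : stops E I K
      · have e1 : ivl K ∩ {x | k + 1 ≤ (chain E (n + 1) I J x).length} = ivl K ∩ {x | k ≤ (chain E n K K x).length} := by
          ext x
          simp only [mem_inter_iff, mem_ofPred_eq, chain]
          refine and_congr_right fun hx => ?_
          rw [hc x hx, if_pos hs]; simp
        have e2 : ivl K ∩ {x | 1 ≤ (chain E (n + 1) I J x).length} = ivl K := by
          ext x
          simp only [mem_inter_iff, mem_ofPred_eq, chain, and_iff_left_iff_imp]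
          intro hx
          rw [hc x hx, if_pos hs]; simp
        rw [e1, e2]
        exact ih2 K hK k
      · have e1 : ∀ k, ivl K ∩ {x | k + 1 ≤ (chain E (n + 1) I J x).length} = ivl K ∩ {x | k + 1 ≤ (chain E n I K x).length} := by
          intro k
          ext x
          simp only [mem_inter_iff, mem_ofPred_eq, chain]
          refine and_congr_right fun hx => ?_
          rw [hc x hx, if_neg hs]
        have := e1 0
        simp only [zero_add] at this
        rw [e1, this]
        exact ih1 I K hK k

open Classical in
lemma chain_level (hE : ∀ I : ℝ × ℝ, I.1 < I.2 → volume (ivl I ∩ E I) ≤ ENNReal.ofReal ((I.2 - I.1) / 8))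
    (hν : ∀ (I : ℝ × ℝ) (S : Set ℝ), I.1 < I.2 → S ⊆ ivl I → volume S ≤ ENNReal.ofReal ((I.2 - I.1) / 2) → ν S ≤ θ * ν (ivl I))
    (L : ℝ × ℝ → Prop) (n : ℕ) : ∀ I J : ℝ × ℝ, J.1 < J.2 → ∀ k, 
      ν (ivl J ∩ {x | k + 1 ≤ (chain E n I J x).countP (fun K => L K)}) ≤
      θ ^ k * ν (ivl J ∩ {x | 1 ≤ (chain E n I J x).countP (fun K => L K)}) := by
  induction n with
  | zero => intro I J hJ k; simp [chain]
  | succ n ih =>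
    intro I J hJ k
    refine halves_le _ _ _ hJ _ _ fun K hK _ _ hc => ?_
    by_cases hs : stops E I K
    · by_cases hL : L K
      · have e1 : ivl K ∩ {x | k + 1 ≤ (chain E (n + 1) I J x).countP (fun K => L K)} ⊆ ivl K ∩ {x | k ≤ (chain E n K K x).length} := by
          rintro x ⟨hx, hx2⟩
          refine ⟨hx, ?_⟩
          simp only [mem_ofPred_eq, chain] at hx2 ⊢
          rw [hc x hx, if_pos hs, List.countP_cons_of_pos (by simpa using hL)] at hx2
          exact (Nat.le_of_succ_le_succ hx2).trans List.countP_le_length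
        have e2 : ivl K ∩ {x | 1 ≤ (chain E (n + 1) I J x).countP (fun K => L K)} = ivl K := by
          ext x
          simp only [mem_inter_iff, mem_ofPred_eq, chain, and_iff_left_iff_imp]
          intro hx
          rw [hc x hx, if_pos hs, List.countP_cons_of_pos (by simpa using hL)]; simp
        rw [e2]
        exact (measure_mono e1).trans ((chain_decay hE hν n).2 K hK k)
      · have e1 : ∀ k, ivl K ∩ {x | k + 1 ≤ (chain E (n + 1) I J x).countP (fun K => L K)} = ivl K ∩ {x | k + 1 ≤ (chain E n K K x).countP (fun K => L K)} := by
          intro k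
          ext x
          simp only [mem_inter_iff, mem_ofPred_eq, chain]
          refine and_congr_right fun hx => ?_
          rw [hc x hx, if_pos hs, List.countP_cons_of_neg (by simpa using hL)]
        have := e1 0
        simp only [zero_add] at this
        rw [e1, this]
        exact ih K K hK k
    · have e1 : ∀ k, ivl K ∩ {x | k + 1 ≤ (chain E (n + 1) I J x).countP (fun K => L K)} = ivl K ∩ {x | k + 1 ≤ (chain E n I K x).countP (fun K => L K)} := by
        intro k
        ext x
        simp only [mem_inter_iff, mem_ofPred_eq, chain]
        refine and_congr_right fun hx => ?_
        rw [hc x hx, if_neg hs]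
      have := e1 0
      simp only [zero_add] at this
      rw [e1, this]
      exact ih I K hK k

end ChainSec

lemma chain_mem {E : ℝ × ℝ → Set ℝ} {x : ℝ} (n : ℕ) : ∀ I J : ℝ × ℝ, J.1 < J.2 → x ∈ ivl J →
    ∀ K ∈ chain E n I J x, K.1 < K.2 ∧ x ∈ ivl K ∧ ivl K ⊆ ivl J := by
  induction n with
  | zero => intro I J _ _ K hK; simp [chain] at hK
  | succ n ih =>
    intro I J hJ hx K hK
    have h1 := child_lt hJ x
    have h2 := mem_child hx
    have h3 := child_sub hJ x
    simp only [chain] at hK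
    split_ifs at hK with hs
    · rcases List.mem_cons.1 hK with rfl | hK
      · exact ⟨h1, h2, h3⟩
      · obtain ⟨q1, q2, q3⟩ := ih _ _ h1 h2 K hK
        exact ⟨q1, q2, q3.trans h3⟩
    · obtain ⟨q1, q2, q3⟩ := ih _ _ h1 h2 K hK
      exact ⟨q1, q2, q3.trans h3⟩

lemma good_pt {J : ℝ × ℝ} (hJ : J.1 < J.2) {S : Set ℝ}
    (h : volume (ivl J ∩ S) ≤ ENNReal.ofReal ((J.2 - J.1) / 2)) : ∃ x' ∈ ivl J, x' ∉ S := by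
  by_contra hc
  push Not at hc
  have : ivl J ∩ S = ivl J := inter_eq_left.2 hc
  rw [this, volume_ivl, ENNReal.ofReal_le_ofReal_iff (by linarith)] at h
  linarith

lemma chain_pt {E : ℝ × ℝ → Set ℝ} {x : ℝ} {Psi μ : ℝ × ℝ → ℝ} {Λ δ ε : ℝ}
    (hE : ∀ I : ℝ × ℝ, I.1 < I.2 → volume (ivl I ∩ E I) ≤ ENNReal.ofReal ((I.2 - I.1) / 8))
    (hP : ∀ I J : ℝ × ℝ, I.1 < I.2 → J.1 < J.2 → ivl J ⊆ ivl I → x ∈ ivl J → (∃ x' ∈ ivl J, x' ∉ E I) →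
      Psi I ≤ Psi J + Λ * μ I)
    (hP0 : ∀ J : ℝ × ℝ, J.1 < J.2 → x ∈ ivl J → J.2 - J.1 ≤ δ → Psi J ≤ ε) (n : ℕ) :
    ∀ I J : ℝ × ℝ, I.1 < I.2 → J.1 < J.2 → ivl J ⊆ ivl I → x ∈ ivl J →
      volume (ivl J ∩ E I) ≤ ENNReal.ofReal ((J.2 - J.1) / 4) → (J.2 - J.1) / 2 ^ n ≤ δ →
      Psi I ≤ ε + Λ * (μ I + ((chain E n I J x).map μ).sum) := by
  induction n with
  | zero =>
    intro I J hI hJ hJI hx hv hd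
    have h1 := hP I J hI hJ hJI hx (good_pt hJ (hv.trans (ENNReal.ofReal_le_ofReal (by linarith))))
    have h2 := hP0 J hJ hx (by simpa using hd)
    simp only [chain, List.map_nil, List.sum_nil, add_zero]
    linarith
  | succ n ih =>
    intro I J hI hJ hJI hx hv hd
    have h1 := child_lt hJ x
    have h2 := mem_child hx
    have h3 := child_sub hJ x
    have h4 := child_len J x
    have h5 : ((child J x).2 - (child J x).1) / 2 ^ n ≤ δ := by
      rw [h4]; rw [pow_succ] at hd
      refine le_trans (le_of_eq ?_) hd
      field_simp
    simp only [chain]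
    split_ifs with hs
    · simp only [List.map_cons, List.sum_cons]
      have q1 : volume (ivl (child J x) ∩ E I) ≤ ENNReal.ofReal (((child J x).2 - (child J x).1) / 2) := by
        refine (measure_mono (inter_subset_inter_left _ h3)).trans (hv.trans (ENNReal.ofReal_le_ofReal ?_))
        rw [h4]; linarith
      have q2 := hP I _ hI h1 (h3.trans hJI) h2 (good_pt h1 q1)
      have q3 := ih (child J x) (child J x) h1 h1 le_rfl h2 ((hE _ h1).trans (ENNReal.ofReal_le_ofReal (by linarith))) h5
      linarith
    · exact ih I _ hI h1 (h3.trans hJI) h2 (not_lt.1 hs) h5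

open Classical in
lemma level_sum {μ : ℝ × ℝ → ℝ} {κ : ℝ} (hκ : 0 < κ) (l : List (ℝ × ℝ)) (h : ∀ K ∈ l, 0 ≤ μ K ∧ μ K ≤ κ) :
    ∃ N0 : ℕ, ∀ N ≥ N0, (l.map μ).sum ≤ ∑ i ∈ Finset.range N, κ * (1 / 2) ^ i *
      (l.countP (fun K => κ * (1 / 2) ^ (i + 1) < μ K ∧ μ K ≤ κ * (1 / 2) ^ i) : ℝ) := by
  induction l with
  | nil => exact ⟨0, fun N _ => by simp⟩
  | cons K l ih =>
    obtain ⟨N0, hN0⟩ := ih fun K hK => h K (List.mem_cons_of_mem _ hK)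
    obtain ⟨hK0, hK1⟩ := h K (List.mem_cons_self)
    rcases hK0.eq_or_lt with h0 | h0
    · refine ⟨N0, fun N hN => ?_⟩
      simp only [List.map_cons, List.sum_cons, ← h0, zero_add]
      refine (hN0 N hN).trans (Finset.sum_le_sum fun i _ => ?_)
      gcongr
      exact (List.sublist_cons_self K l).countP_le
    · obtain ⟨i0, hi1, hi2⟩ := exists_nat_pow_near_of_lt_one (x := μ K / κ) (y := (1/2:ℝ)) (by positivity) ((div_le_one hκ).2 hK1) (by norm_num) (by norm_num)
      rw [lt_div_iff₀ hκ] at hi1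
      rw [div_le_iff₀ hκ] at hi2
      refine ⟨max N0 (i0 + 1), fun N hN => ?_⟩
      have hN1 := hN0 N (le_trans (le_max_left _ _) hN)
      have hi0 : i0 ∈ Finset.range N := Finset.mem_range.2 (le_trans (le_max_right _ _) hN)
      simp only [List.map_cons, List.sum_cons]
      have : ∀ i, κ * (1 / 2) ^ i * (l.countP (fun K => κ * (1 / 2) ^ (i + 1) < μ K ∧ μ K ≤ κ * (1 / 2) ^ i) : ℝ) + 
          (if i = i0 then μ K else 0) ≤ κ * (1 / 2) ^ i * ((K :: l).countP (fun K => κ * (1 / 2) ^ (i + 1) < μ K ∧ μ K ≤ κ * (1 / 2) ^ i) : ℝ) := by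
        intro i
        by_cases hi : i = i0
        · subst hi
          rw [if_pos rfl, List.countP_cons_of_pos]
          · push_cast; linarith
          · simp only [decide_eq_true_eq]; constructor <;> linarith
        · rw [if_neg hi, add_zero]
          gcongr
          exact (List.sublist_cons_self K l).countP_le
      have h2 := Finset.sum_le_sum (s := Finset.range N) fun i _ => this i
      rw [Finset.sum_add_distrib, Finset.sum_ite_eq' (Finset.range N) i0 (fun _ => μ K), if_pos hi0] at h2
      linarith

lemma geom_sum_bd (N : ℕ) : ∑ i ∈ Finset.range N, ((i:ℝ) + 1) * (1 / 2) ^ i ≤ 4 := by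
  have : ∀ N : ℕ, ∑ i ∈ Finset.range N, ((i:ℝ) + 1) * (1 / 2) ^ i = 4 - (N + 2) * 2 * (1 / 2) ^ N := by
    intro N
    induction N with
    | zero => norm_num
    | succ N ih => rw [Finset.sum_range_succ, ih, pow_succ]; push_cast; ring
  rw [this]
  have : (0:ℝ) ≤ (N + 2) * 2 * (1 / 2) ^ N := by positivity
  linarith

theorem sparse_main {ν : Measure ℝ} {θ : ℝ≥0∞} {E : ℝ × ℝ → Set ℝ} {Psi : ℝ × ℝ → ℝ → ℝ} {μ : ℝ × ℝ → ℝ} {Λ δ : ℝ}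
    (hE : ∀ I : ℝ × ℝ, I.1 < I.2 → volume (ivl I ∩ E I) ≤ ENNReal.ofReal ((I.2 - I.1) / 8))
    (hν : ∀ (I : ℝ × ℝ) (S : Set ℝ), I.1 < I.2 → S ⊆ ivl I → volume S ≤ ENNReal.ofReal ((I.2 - I.1) / 2) → ν S ≤ θ * ν (ivl I))
    (hP : ∀ x, ∀ I J : ℝ × ℝ, I.1 < I.2 → J.1 < J.2 → ivl J ⊆ ivl I → x ∈ ivl J → (∃ x' ∈ ivl J, x' ∉ E I) →
      Psi I x ≤ Psi J x + Λ * μ I) (hΛ : 0 < Λ) (hδ : 0 < δ)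
    (hP0 : ∀ x, ∀ J : ℝ × ℝ, J.1 < J.2 → x ∈ ivl J → J.2 - J.1 ≤ δ → Psi J x ≤ 0) (hμ : ∀ K, 0 ≤ μ K)
    {M : ℕ} (hM : θ ^ M ≤ 8⁻¹) {I0 : ℝ × ℝ} (hI0 : I0.1 < I0.2) {R : ℝ≥0∞}
    (hΩ : ∀ τ : ℝ, 0 < τ → τ ≤ 1 → ν (⋃ K ∈ {K : ℝ × ℝ | K.1 < K.2 ∧ ivl K ⊆ ivl I0 ∧ τ < μ K}, ivl K) ≤ ENNReal.ofReal ((τ ^ 2)⁻¹) * R)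
    {κ : ℝ} (hκ : 0 < κ) (hκ1 : κ ≤ 1) (hκ2 : Λ * (κ + 4 * M * κ) ≤ 1) :
    ν (ivl I0 ∩ {x | 1 < Psi I0 x}) ≤ 2 * ENNReal.ofReal ((κ ^ 2)⁻¹) * R := by
  classical
  obtain ⟨n, hn⟩ := pow_unbounded_of_one_lt ((I0.2 - I0.1) / δ) (one_lt_two : (1:ℝ) < 2)
  have hn' : (I0.2 - I0.1) / 2 ^ n ≤ δ := by
    rw [div_lt_iff₀ hδ] at hn
    rw [div_le_iff₀ (by positivity)]; linarith
  set Ω : ℝ → Set ℝ := fun τ => ⋃ K ∈ {K : ℝ × ℝ | K.1 < K.2 ∧ ivl K ⊆ ivl I0 ∧ τ < μ K}, ivl K with hΩd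
  set L : ℕ → ℝ × ℝ → Prop := fun i K => κ * (1 / 2) ^ (i + 1) < μ K ∧ μ K ≤ κ * (1 / 2) ^ i with hL
  have hsub : ivl I0 ∩ {x | 1 < Psi I0 x} ⊆ Ω κ ∪ ⋃ i : ℕ, (ivl I0 ∩ {x | M * (i + 1) + 1 ≤ (chain E n I0 I0 x).countP (fun K => L i K)}) := by
    rintro x ⟨hx, hlt⟩
    by_contra hc
    simp only [mem_union, not_or, mem_iUnion, not_exists, mem_inter_iff, not_and, mem_ofPred_eq] at hc
    obtain ⟨hc1, hc2⟩ := hc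
    have hmem := chain_mem (E := E) n I0 I0 hI0 hx
    have hnotΩ : ∀ K : ℝ × ℝ, K.1 < K.2 → ivl K ⊆ ivl I0 → x ∈ ivl K → μ K ≤ κ := by
      intro K h1 h2 h3
      by_contra h4
      exact hc1 (mem_biUnion (show K ∈ {K : ℝ × ℝ | K.1 < K.2 ∧ ivl K ⊆ ivl I0 ∧ κ < μ K} from ⟨h1, h2, not_le.1 h4⟩) h3)
    have hpt := chain_pt hE (hP x) (hP0 x) n I0 I0 hI0 hI0 le_rfl hx ((hE I0 hI0).trans (ENNReal.ofReal_le_ofReal (by linarith))) hn'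
    obtain ⟨N, hN⟩ := level_sum hκ (chain E n I0 I0 x) fun K hK => ⟨hμ K, by
      obtain ⟨q1, q2, q3⟩ := hmem K hK
      exact hnotΩ K q1 q3 q2⟩
    have hs := hN N le_rfl
    have hs2 : ∑ i ∈ Finset.range N, κ * (1 / 2) ^ i *
      ((chain E n I0 I0 x).countP (fun K => κ * (1 / 2) ^ (i + 1) < μ K ∧ μ K ≤ κ * (1 / 2) ^ i) : ℝ) ≤ 
        ∑ i ∈ Finset.range N, κ * M * (((i:ℝ) + 1) * (1 / 2) ^ i) := by
      refine Finset.sum_le_sum fun i _ => ?_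
      have h1 : (chain E n I0 I0 x).countP (fun K => L i K) ≤ M * (i + 1) := Nat.lt_succ_iff.1 (not_le.1 (hc2 i hx))
      have h2 : ((chain E n I0 I0 x).countP (fun K => κ * (1 / 2) ^ (i + 1) < μ K ∧ μ K ≤ κ * (1 / 2) ^ i) : ℝ) ≤ M * (i + 1) := by
        exact_mod_cast h1
      calc _ ≤ κ * (1 / 2) ^ i * (M * (i + 1)) := by gcongr
        _ = _ := by ring
    rw [← Finset.mul_sum] at hs2
    have h3 := geom_sum_bd N
    have h4 : κ * M * ∑ i ∈ Finset.range N, ((i:ℝ) + 1) * (1 / 2) ^ i ≤ κ * M * 4 := by gcongr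
    have h5 := hnotΩ I0 hI0 le_rfl hx
    have h6 : Λ * (μ I0 + ((chain E n I0 I0 x).map μ).sum) ≤ Λ * (κ + 4 * M * κ) := by
      gcongr; linarith
    have hlt : 1 < Psi I0 x := hlt
    linarith
  have hcnt : ∀ i : ℕ, ν (ivl I0 ∩ {x | M * (i + 1) + 1 ≤ (chain E n I0 I0 x).countP (fun K => L i K)}) ≤ 
      (ENNReal.ofReal ((κ ^ 2)⁻¹) * R) * ENNReal.ofReal ((1 / 2) ^ (i + 1)) := by
    intro i
    have key : ν (ivl I0 ∩ {x | M * (i + 1) + 1 ≤ (chain E n I0 I0 x).countP (fun K => L i K)}) ≤ θ ^ (M * (i + 1)) * ν (ivl I0 ∩ {x | 1 ≤ (chain E n I0 I0 x).countP (fun K => L i K)}) := by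
      convert chain_level hE hν (L i) n I0 I0 hI0 (M * (i + 1))
    refine key.trans ?_
    have h1 : ν (ivl I0 ∩ {x | 1 ≤ (chain E n I0 I0 x).countP (fun K => L i K)}) ≤ ENNReal.ofReal (((κ * (1 / 2) ^ (i + 1)) ^ 2)⁻¹) * R := by
      refine le_trans (measure_mono ?_) (hΩ (κ * (1 / 2) ^ (i + 1)) (by positivity) (mul_le_one₀ hκ1 (by positivity) (pow_le_one₀ (by norm_num) (by norm_num))))
      rintro x ⟨hx, hx2⟩
      obtain ⟨K, hK, hLK⟩ := List.countP_pos_iff.1 hx2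
      obtain ⟨q1, q2, q3⟩ := chain_mem n I0 I0 hI0 hx K hK
      have hLK : L i K := by simpa using hLK
      exact mem_biUnion (show K ∈ {K : ℝ × ℝ | K.1 < K.2 ∧ ivl K ⊆ ivl I0 ∧ κ * (1 / 2) ^ (i + 1) < μ K} from ⟨q1, q3, hLK.1⟩) q2
    have h2 : θ ^ (M * (i + 1)) ≤ ENNReal.ofReal ((1 / 8) ^ (i + 1)) := by
      rw [pow_mul, ENNReal.ofReal_pow (by norm_num)]
      gcongr
      refine hM.trans (le_of_eq ?_)
      rw [one_div, ENNReal.ofReal_inv_of_pos (by norm_num)]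
      simp
    refine (mul_le_mul' h2 h1).trans (le_of_eq ?_)
    rw [← mul_assoc, ← ENNReal.ofReal_mul (by positivity), mul_right_comm, ← ENNReal.ofReal_mul (by positivity)]
    congr 2
    have e8 : (1 / 8 : ℝ) ^ (i + 1) = ((1 / 2) ^ (i + 1)) ^ 2 * (1 / 2) ^ (i + 1) := by
      rw [← pow_mul, ← pow_add, show (1 / 8 : ℝ) = (1 / 2) ^ 3 by norm_num, ← pow_mul]; congr 1; ring
    rw [e8]; field_simp
  refine (measure_mono hsub).trans ((measure_union_le _ _).trans ?_)
  have hsum : ∑' i : ℕ, ENNReal.ofReal ((1 / 2 : ℝ) ^ (i + 1)) = 1 := by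
    rw [← ENNReal.ofReal_tsum_of_nonneg (fun i => by positivity)]
    · have : ∑' i : ℕ, (1 / 2 : ℝ) ^ (i + 1) = 1 := by
        simp_rw [pow_succ]; rw [tsum_mul_right, tsum_geometric_two]; norm_num
      rw [this]; simp
    · simp_rw [pow_succ]; exact summable_geometric_two.mul_right _
  calc ν (Ω κ) + ν (⋃ i : ℕ, (ivl I0 ∩ {x | M * (i + 1) + 1 ≤ (chain E n I0 I0 x).countP (fun K => L i K)}))
      ≤ ENNReal.ofReal ((κ ^ 2)⁻¹) * R + ∑' i : ℕ, (ENNReal.ofReal ((κ ^ 2)⁻¹) * R) * ENNReal.ofReal ((1 / 2) ^ (i + 1)) := by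
        refine add_le_add (hΩ κ hκ hκ1) ((measure_iUnion_le _).trans (ENNReal.tsum_le_tsum hcnt))
    _ = 2 * ENNReal.ofReal ((κ ^ 2)⁻¹) * R := by
        rw [ENNReal.tsum_mul_left, hsum, mul_one, ← two_mul, mul_assoc]

lemma bmo_le {g : ℝ → ℝ} (h : bmoNorm g = 1) {u v : ℝ} (huv : u < v) :
    (v - u)⁻¹ * ∫ y in Ioc u v, |g y - (v - u)⁻¹ * ∫ z in Ioc u v, g z| ≤ 1 := by
  unfold bmoNorm at h
  have hb : BddAbove {c : ℝ | ∃ u v : ℝ, u < v ∧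
    c = (v - u)⁻¹ * ∫ y in Ioc u v, |g y - (v - u)⁻¹ * ∫ z in Ioc u v, g z|} := by
    by_contra hc
    rw [Real.sSup_of_not_bddAbove hc] at h
    exact zero_ne_one h
  rw [← h]
  exact le_csSup hb ⟨u, v, huv, rfl⟩

lemma int_abs_le {A A' : ℝ → ℝ} (hA : ∀ x, HasDerivAt A (A' x) x) (h : bmoNorm A' = 1) {c d : ℝ} (hcd : c < d)
    (hi : IntegrableOn A' (Icc c d)) : ∫ x in Icc c d, |A' x| ≤ (d - c) + |A d - A c| := by
  rw [integral_Icc_eq_integral_Ioc]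
  have hi' := hi.mono_set (Ioc_subset_Icc_self)
  have hft : ∫ x in Ioc c d, A' x = A d - A c := by
    rw [← intervalIntegral.integral_of_le hcd.le]
    exact intervalIntegral.integral_eq_sub_of_hasDerivAt (fun x _ => hA x) ((intervalIntegrable_iff_integrableOn_Ioc_of_le hcd.le).2 hi')
  have hb := bmo_le h hcd
  rw [hft, inv_mul_le_iff₀ (by linarith)] at hb
  set q := (d - c)⁻¹ * (A d - A c) with hq
  have i1 : Integrable (fun _ => q) (volume.restrict (Ioc c d)) := integrableOn_const (by simp)
  have i2 : Integrable (fun _ => |q|) (volume.restrict (Ioc c d)) := integrableOn_const (by simp)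
  have hdc : 0 < d - c := by linarith
  calc ∫ x in Ioc c d, |A' x| ≤ ∫ x in Ioc c d, (|A' x - q| + |q|) := by
        refine integral_mono hi'.abs ((hi'.sub i1).abs.add i2) fun x => ?_
        have := abs_add_le (A' x - q) q
        simpa using this
    _ = (∫ x in Ioc c d, |A' x - q|) + (d - c) * |q| := by
        have i3 : Integrable (fun x => |A' x - q|) (volume.restrict (Ioc c d)) := (hi'.sub i1).abs
        rw [integral_add i3 i2]
        simp [hcd.le]
    _ ≤ _ := by
        have : (d - c) * |q| = |A d - A c| := by
          rw [hq, abs_mul, abs_of_pos (inv_pos.2 hdc)]; field_simp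
        rw [this]; linarith

lemma lint_Ioo_le {A A' : ℝ → ℝ} (hA : ∀ x, HasDerivAt A (A' x) x) (h : bmoNorm A' = 1) {c d : ℝ} (hcd : c < d)
    (hi : ∀ x ∈ Ioo c d, IntegrableAtFilter A' (nhds x)) :
    ∫⁻ x in Ioo c d, ENNReal.ofReal |A' x| ≤ ENNReal.ofReal ((d - c) + |A d - A c|) := by
  have hm : Measurable A' := by
    have : A' = deriv A := funext fun x => (hA x).deriv.symm
    rw [this]; exact measurable_deriv A
  have hAc : Continuous A := continuous_iff_continuousAt.2 fun x => (hA x).continuousAt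
  set a : ℕ → ℝ := fun k => c + (d - c) / 2 * (1 / 2) ^ (k + 1)
  set b : ℕ → ℝ := fun k => d - (d - c) / 2 * (1 / 2) ^ (k + 1)
  have ht : Tendsto (fun k : ℕ => (d - c) / 2 * (1 / 2 : ℝ) ^ (k + 1)) atTop (nhds 0) := by
    have := ((tendsto_pow_atTop_nhds_zero_of_lt_one (r := (1/2:ℝ)) (by norm_num) (by norm_num)).comp (tendsto_add_atTop_nat 1)).const_mul ((d - c) / 2)
    simpa using this
  have ha : Tendsto a atTop (nhds c) := by have := ht.const_add c; rwa [add_zero] at this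
  have hb : Tendsto b atTop (nhds d) := by have := ht.const_sub d; rwa [sub_zero] at this
  have hcov := (aecover_Ioo_of_Icc (μ := volume) ha hb).lintegral_tendsto_of_countably_generated
    (f := fun x => ENNReal.ofReal |A' x|) (by fun_prop)
  have hr : Tendsto (fun k => ENNReal.ofReal ((b k - a k) + |A (b k) - A (a k)|)) atTop (nhds (ENNReal.ofReal ((d - c) + |A d - A c|))) := by
    apply ENNReal.tendsto_ofReal
    exact (hb.sub ha).add (((hAc.tendsto d).comp hb).sub ((hAc.tendsto c).comp ha)).abs
  refine le_of_tendsto_of_tendsto' hcov hr fun k => ?_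
  have hk0 : (0:ℝ) < (1/2) ^ (k + 1) := by positivity
  have hk1 : (1/2:ℝ) ^ (k + 1) < 1 := pow_lt_one₀ (by norm_num) (by norm_num) (by omega)
  have e0 : 0 < d - c := by linarith
  have hac : c < a k := by simp only [a]; nlinarith
  have hbd : b k < d := by simp only [b]; nlinarith
  have hab : a k < b k := by simp only [a, b]; nlinarith
  have hsub : Icc (a k) (b k) ⊆ Ioo c d := fun x hx => ⟨hac.trans_le hx.1, hx.2.trans_lt hbd⟩
  have hI : IntegrableOn A' (Icc (a k) (b k)) := by
    refine LocallyIntegrableOn.integrableOn_isCompact (fun x hx => ?_) isCompact_Icc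
    exact (hi x (hsub hx)).filter_mono nhdsWithin_le_nhds
  rw [Measure.restrict_restrict measurableSet_Icc, inter_eq_left.2 hsub, ← ofReal_integral_eq_lintegral_ofReal hI.abs (Eventually.of_forall fun x => abs_nonneg _)]
  exact ENNReal.ofReal_le_ofReal (int_abs_le hA h hab hI)

/-- derivative with BMO bounded by one is locally integrable -/
theorem locInt {A A' : ℝ → ℝ} (hA : ∀ x, HasDerivAt A (A' x) x) (h : bmoNorm A' = 1) : LocallyIntegrable A' := by
  have hm : Measurable A' := by
    have : A' = deriv A := funext fun x => (hA x).deriv.symm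
    rw [this]; exact measurable_deriv A
  have hAc : Continuous A := continuous_iff_continuousAt.2 fun x => (hA x).continuousAt
  set B : Set ℝ := {x | ¬ IntegrableAtFilter A' (nhds x)} with hB
  have hBc : IsClosed B := by
    rw [← isOpen_compl_iff, isOpen_iff_mem_nhds]
    intro x hx
    have hx : IntegrableAtFilter A' (nhds x) := by simpa [hB] using hx
    obtain ⟨s, hs, hs2⟩ := hx
    filter_upwards [eventually_mem_nhds_iff.2 hs] with y hy
    simp only [hB, mem_compl_iff, mem_ofPred_eq, not_not]
    exact ⟨s, hy, hs2⟩
  by_contra hne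
  have hne : B.Nonempty := by
    simp only [LocallyIntegrable, not_forall] at hne
    exact hne
  let Bn : ℕ → Set ℝ := fun n => {x | ∀ y, |y - x| * (n + 1) ≤ 1 → |A y - A x| ≤ (n + 1) * |y - x|}
  have hBn : ∀ n, IsClosed (Bn n) := by
    intro n
    rw [← isOpen_compl_iff, isOpen_iff_mem_nhds]
    intro x hx
    simp only [Bn, mem_compl_iff, mem_ofPred_eq, not_forall, not_le] at hx
    obtain ⟨y, hy1, hy2⟩ := hx
    -- translate
    have : ∀ᶠ z in nhds x, ((n:ℝ) + 1) * |y - x| < |A (y - x + z) - A z| := by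
      have hc : ContinuousAt (fun z => |A (y - x + z) - A z|) x := by fun_prop
      refine hc.eventually_const_lt ?_
      simpa using hy2
    filter_upwards [this] with z hz
    simp only [Bn, mem_compl_iff, mem_ofPred_eq, not_forall, not_le]
    refine ⟨y - x + z, by simpa using hy1, by simpa using hz⟩
  have hcov : ∀ x, ∃ n, x ∈ Bn n := by
    intro x
    obtain ⟨δ, hδ, hd⟩ : ∃ δ > 0, ∀ y, |y - x| < δ → |A y - A x| ≤ (|A' x| + 1) * |y - x| := by
      have h1 := (hA x).isBigO_sub
      have h2 := (hasDerivAt_iff_isLittleO.1 (hA x)).def (c := 1) one_pos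
      obtain ⟨δ, hδ, hd⟩ := Metric.eventually_nhds_iff.1 h2
      refine ⟨δ, hδ, fun y hy => ?_⟩
      have h3 := hd (y := y) (by rwa [Real.dist_eq])
      simp only [smul_eq_mul, Real.norm_eq_abs, one_mul] at h3
      calc |A y - A x| ≤ |A y - A x - (y - x) * A' x| + |(y - x) * A' x| := by
            have := abs_add_le (A y - A x - (y - x) * A' x) ((y - x) * A' x)
            simpa using this
        _ ≤ _ := by rw [abs_mul]; linarith
    obtain ⟨n, hn⟩ := exists_nat_gt (max (|A' x|) (1 / δ))
    refine ⟨n, fun y hy => ?_⟩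
    have h1 : |A' x| < n := (le_max_left _ _).trans_lt hn
    have h2 : 1 / δ < n := (le_max_right _ _).trans_lt hn
    rw [div_lt_iff₀ hδ] at h2
    have h3 : |y - x| < δ := by
      by_contra hc
      push Not at hc
      have : δ * (n + 1) ≤ |y - x| * (n + 1) := by gcongr
      nlinarith
    refine (hd y h3).trans ?_
    gcongr
  -- Baire
  haveI : CompleteSpace B := hBc.completeSpace_coe
  haveI : Nonempty B := hne.to_subtype
  obtain ⟨n, x0, hx0⟩ := nonempty_interior_of_iUnion_of_closed (X := B) (f := fun n => Subtype.val ⁻¹' (Bn n))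
    (fun n => (hBn n).preimage continuous_subtype_val) (by
      ext x; simp only [mem_iUnion, mem_preimage, mem_univ, iff_true]; exact hcov x)
  rw [mem_interior_iff_mem_nhds, Metric.mem_nhds_iff] at hx0
  obtain ⟨r0, hr0, hr⟩ := hx0
  obtain ⟨r, hrp, hr1, hr2⟩ : ∃ r > 0, r ≤ r0 ∧ 2 * r * (n + 1) ≤ 1 := by
    refine ⟨min r0 (1 / (2 * (n + 1))), by positivity, min_le_left _ _, ?_⟩
    have : min r0 (1 / (2 * ((n:ℝ) + 1))) ≤ 1 / (2 * (n + 1)) := min_le_right _ _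
    rw [le_div_iff₀ (by positivity)] at this
    linarith
  set p := (x0:ℝ) - r
  set q := (x0:ℝ) + r
  have hBp : ∀ x ∈ B, x ∈ Ioo p q → x ∈ Bn n := by
    intro x hx hpq
    have : (⟨x, hx⟩ : B) ∈ Metric.ball x0 r0 := by
      rw [Metric.mem_ball, Subtype.dist_eq, Real.dist_eq, abs_lt]
      have := hpq.1; have := hpq.2
      simp only [p, q] at *
      constructor <;> linarith
    exact hr this
  have hderiv : ∀ x ∈ B, x ∈ Ioo p q → |A' x| ≤ n + 1 := by
    intro x hx hpq
    have hx' := hBp x hx hpq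
    rw [← Real.norm_eq_abs]
    refine (hA x).le_of_lip' (by positivity) ?_
    have : ∀ᶠ y in nhds x, |y - x| * ((n:ℝ) + 1) < 1 := by
      have hc : ContinuousAt (fun y => |y - x| * ((n:ℝ) + 1)) x := by fun_prop
      exact hc.eventually_lt_const (by simp)
    filter_upwards [this] with y hy
    exact hx' y hy.le
  set G : Set ℝ := Ioo p q \ B
  have hGo : IsOpen G := isOpen_Ioo.sdiff hBc
  -- components
  have hcomp : ∀ x ∈ G, ∃ c d, c < d ∧ G.ordConnectedComponent x = Ioo c d ∧ |A d - A c| ≤ (n + 1) * (d - c) := by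
    intro x hx
    set s := G.ordConnectedComponent x with hs
    have hxs : x ∈ s := self_mem_ordConnectedComponent.2 hx
    have hsG : s ⊆ G := ordConnectedComponent_subset
    have hbb : BddBelow s := ⟨p, fun y hy => (hsG hy).1.1.le⟩
    have hba : BddAbove s := ⟨q, fun y hy => (hsG hy).1.2.le⟩
    have hoc : OrdConnected s := inferInstance
    have hmax : ∀ y z, y ∈ s → uIcc y z ⊆ G → z ∈ s := by
      intro y z hy hz
      rw [hs, mem_ordConnectedComponent] at hy ⊢
      exact (uIcc_subset_uIcc_union_uIcc (b := y)).trans (union_subset hy hz)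
    set c := sInf s with hc
    set d := sSup s with hd
    have hcG : c ∉ G := by
      intro hcG
      obtain ⟨e, he, hball⟩ := Metric.isOpen_iff.1 hGo c hcG
      obtain ⟨y, hys, hy⟩ := exists_lt_of_csInf_lt ⟨x, hxs⟩ (show sInf s < c + e / 2 by rw [← hc]; linarith)
      have hcy : c ≤ y := csInf_le hbb hys
      have : c - e / 2 ∈ s := by
        refine hmax y _ hys fun z hz => hball ?_
        rw [uIcc_of_ge (by linarith)] at hz
        rw [Metric.mem_ball, Real.dist_eq, abs_lt]
        constructor <;> linarith [hz.1, hz.2]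
      have := csInf_le hbb this
      linarith
    have hdG : d ∉ G := by
      intro hdG
      obtain ⟨e, he, hball⟩ := Metric.isOpen_iff.1 hGo d hdG
      obtain ⟨y, hys, hy⟩ := exists_lt_of_lt_csSup ⟨x, hxs⟩ (show d - e / 2 < sSup s by rw [← hd]; linarith)
      have hcy : y ≤ d := le_csSup hba hys
      have : d + e / 2 ∈ s := by
        refine hmax y _ hys fun z hz => hball ?_
        rw [uIcc_of_le (by linarith)] at hz
        rw [Metric.mem_ball, Real.dist_eq, abs_lt]
        constructor <;> linarith [hz.1, hz.2]
      have := le_csSup hba this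
      linarith
    have hsub1 : s ⊆ Ioo c d := fun y hy => ⟨lt_of_le_of_ne (csInf_le hbb hy) (fun he => hcG (he ▸ hsG hy)),
      lt_of_le_of_ne (le_csSup hba hy) (fun he => hdG (he ▸ hsG hy))⟩
    have hsub2 : Ioo c d ⊆ s := by
      intro y hy
      obtain ⟨z1, hz1, h1⟩ := exists_lt_of_csInf_lt ⟨x, hxs⟩ hy.1
      obtain ⟨z2, hz2, h2⟩ := exists_lt_of_lt_csSup ⟨x, hxs⟩ hy.2
      exact hoc.out hz1 hz2 ⟨h1.le, h2.le⟩
    have hcd : c < d := (hsub1 hxs).1.trans (hsub1 hxs).2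
    refine ⟨c, d, hcd, hsub1.antisymm hsub2, ?_⟩
    have hpc : p ≤ c := le_csInf ⟨x, hxs⟩ fun y hy => (hsG hy).1.1.le
    have hdq : d ≤ q := csSup_le ⟨x, hxs⟩ fun y hy => (hsG hy).1.2.le
    have hx0B : (x0:ℝ) ∉ Ioo c d := fun hh => (hsG (hsub2 hh)).2 x0.2
    have hlen : (d - c) * ((n:ℝ) + 1) ≤ 1 := by
      refine le_trans ?_ hr2
      gcongr
      simp only [p, q] at hpc hdq; linarith
    have hcx : (x0:ℝ) ≤ c ∨ d ≤ x0 := by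
      by_contra hc; push Not at hc; exact hx0B hc
    rcases hcx with h1 | h1
    · have hcB : c ∈ B := by
        by_contra hcB
        exact hcG ⟨⟨lt_of_lt_of_le (by simp only [p]; linarith) h1, hcd.trans_le hdq⟩, hcB⟩
      have := hBp c hcB ⟨lt_of_lt_of_le (by simp only [p]; linarith) h1, hcd.trans_le hdq⟩ d (by rwa [abs_of_pos (by linarith)])
      rwa [abs_of_pos (by linarith : 0 < d - c)] at this
    · have hdm : d ∈ Ioo p q := ⟨hpc.trans_lt hcd, lt_of_le_of_lt h1 (by simp only [q]; linarith)⟩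
      have hdB : d ∈ B := by
        by_contra hdB
        exact hdG ⟨hdm, hdB⟩
      have := hBp d hdB hdm c (by rwa [abs_sub_comm, abs_of_pos (by linarith)])
      rwa [abs_sub_comm c d, abs_of_pos (by linarith : 0 < d - c), abs_sub_comm] at this
  -- sum over components
  set S : Set (Set ℝ) := (fun x : ℚ => G.ordConnectedComponent (x:ℝ)) '' {x : ℚ | (x:ℝ) ∈ G} with hS
  have hScount : S.Countable := (Set.to_countable _).image _
  have hSform : ∀ s ∈ S, ∃ c d, c < d ∧ s = Ioo c d ∧ |A d - A c| ≤ (n + 1) * (d - c) := by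
    rintro s ⟨x, hx, rfl⟩
    exact hcomp x hx
  have hSsub : ∀ s ∈ S, s ⊆ G := by
    rintro s ⟨x, hx, rfl⟩
    exact ordConnectedComponent_subset
  have hSm : ∀ s ∈ S, MeasurableSet s := fun s hs => by
    obtain ⟨c, d, _, rfl, _⟩ := hSform s hs
    exact measurableSet_Ioo
  have hSd : S.PairwiseDisjoint id := by
    rintro s ⟨x, hx, rfl⟩ t ⟨y, hy, rfl⟩ hst
    simp only [Function.onFun, id]
    by_contra hc
    rw [Set.not_disjoint_iff] at hc
    obtain ⟨z, hz1, hz2⟩ := hc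
    exact hst ((ordConnectedComponent_eq hz1).trans (ordConnectedComponent_eq hz2).symm)
  have hGS : G ⊆ ⋃ s ∈ S, s := by
    intro x hx
    obtain ⟨c, d, hcd, he, _⟩ := hcomp x hx
    obtain ⟨y, hy1, hy2⟩ := exists_rat_btwn hcd
    have hyc : (y:ℝ) ∈ G.ordConnectedComponent x := by rw [he]; exact ⟨hy1, hy2⟩
    have hyG := ordConnectedComponent_subset hyc
    refine mem_biUnion (show G.ordConnectedComponent (y:ℝ) ∈ S from ⟨y, hyG, rfl⟩) ?_
    rw [← ordConnectedComponent_eq hyc]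
    exact self_mem_ordConnectedComponent.2 hx
  have hGint : ∫⁻ x in G, ENNReal.ofReal |A' x| ≤ ENNReal.ofReal (n + 2) * volume (⋃ s ∈ S, s) := by
    refine (lintegral_mono_set hGS).trans ?_
    have hmb : volume (⋃ s ∈ S, s) = ∑' s : S, volume (s : Set ℝ) := measure_biUnion (f := id) hScount hSd hSm
    rw [lintegral_biUnion hScount hSm hSd, hmb, ← ENNReal.tsum_mul_left]
    refine ENNReal.tsum_le_tsum fun ⟨s, hs⟩ => ?_
    obtain ⟨c, d, hcd, he, hAcd⟩ := hSform s hs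
    have hsG := hSsub s hs
    subst he
    refine (lint_Ioo_le hA h hcd fun x hx => ?_).trans ?_
    · have := (hsG hx).2
      simpa [hB] using this
    · simp only [Real.volume_Ioo]
      rw [← ENNReal.ofReal_mul (by positivity)]
      exact ENNReal.ofReal_le_ofReal (by linarith)
  have hfin : ∫⁻ x in Ioo p q, ENNReal.ofReal |A' x| < ⊤ := by
    have e1 : Ioo p q = G ∪ (Ioo p q ∩ B) := by
      ext x; simp only [G, mem_union, Set.mem_sdiff, mem_inter_iff]; tauto
    have h1 : ∫⁻ x in Ioo p q ∩ B, ENNReal.ofReal |A' x| ≤ ENNReal.ofReal (n + 1) * volume (Ioo p q ∩ B) := by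
      refine (setLIntegral_mono measurable_const fun x hx => ENNReal.ofReal_le_ofReal (hderiv x hx.2 hx.1)).trans ?_
      rw [setLIntegral_const]
    rw [e1]
    refine (lintegral_union_le _ _ _).trans_lt (ENNReal.add_lt_top.2 ⟨hGint.trans_lt ?_, h1.trans_lt ?_⟩)
    · refine ENNReal.mul_lt_top (by simp) ((measure_mono (t := Ioo p q) ?_).trans_lt (by simp))
      exact iUnion₂_subset fun s hs => (hSsub s hs).trans sdiff_subset
    · exact ENNReal.mul_lt_top (by simp) ((measure_mono inter_subset_left).trans_lt (by simp))
  refine x0.2 ⟨Ioo p q, Ioo_mem_nhds (by simp only [p]; linarith) (by simp only [q]; linarith), hm.aestronglyMeasurable, ?_⟩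
  rw [hasFiniteIntegral_iff_norm]
  exact hfin

lemma FTC_A {A A' : ℝ → ℝ} (hA : ∀ x, HasDerivAt A (A' x) x) (h : LocallyIntegrable A') (x y : ℝ) :
    A x - A y = Adiff A' x y := by
  unfold Adiff
  rw [intervalIntegral.integral_eq_sub_of_hasDerivAt (fun x _ => hA x) (h.integrableOn_isCompact isCompact_uIcc).intervalIntegrable]

/-- average over an interval -/
noncomputable def av (b : ℝ → ℝ) (u v : ℝ) : ℝ := (v - u)⁻¹ * ∫ z in Ioc u v, b z

lemma locInt_Ioc {b : ℝ → ℝ} (hb : LocallyIntegrable b) (u v : ℝ) : IntegrableOn b (Ioc u v) :=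
  (hb.integrableOn_isCompact isCompact_Icc).mono_set Ioc_subset_Icc_self

lemma av_sub_le {b : ℝ → ℝ} (hb : LocallyIntegrable b) (q : ℝ) {u v : ℝ} (huv : u < v) :
    |av b u v - q| ≤ (v - u)⁻¹ * ∫ y in Ioc u v, |b y - q| := by
  have i1 : Integrable (fun _ => q) (volume.restrict (Ioc u v)) := integrableOn_const (by simp)
  have h0 : 0 < v - u := by linarith
  have : av b u v - q = (v - u)⁻¹ * ∫ y in Ioc u v, (b y - q) := by
    rw [integral_sub (locInt_Ioc hb u v) i1]
    simp only [integral_const, smul_eq_mul, av]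
    simp [huv.le]
    field_simp
  rw [this, abs_mul, abs_of_pos (inv_pos.2 h0)]
  gcongr
  exact abs_integral_le_integral_abs

lemma leb_pt {b : ℝ → ℝ} (hb : LocallyIntegrable b) : ∀ᵐ x, ∃ δ > 0, ∀ u v, u < v → x ∈ Ioc u v → v - u ≤ δ → |b x - av b u v| ≤ 1 := by
  filter_upwards [_root_.LocallyIntegrable.ae_hasDerivAt_integral hb] with x hx
  have h2 := (hasDerivAt_iff_isLittleO.1 (hx 0)).def (c := 1) one_pos
  obtain ⟨δ, hδ, hd⟩ := Metric.eventually_nhds_iff.1 h2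
  refine ⟨δ / 2, by linarith, fun u v huv hxm hl => ?_⟩
  have h0 : 0 < v - u := by linarith
  have hu := hd (y := u) (by rw [Real.dist_eq, abs_lt]; constructor <;> linarith [hxm.1, hxm.2])
  have hv := hd (y := v) (by rw [Real.dist_eq, abs_lt]; constructor <;> linarith [hxm.1, hxm.2])
  have hii : ∀ p q, IntervalIntegrable b volume p q := fun p q => (hb.integrableOn_isCompact isCompact_uIcc).intervalIntegrable
  rw [intervalIntegral.integral_interval_sub_left (hii _ _) (hii _ _)] at hu hv
  simp only [smul_eq_mul, Real.norm_eq_abs, one_mul] at hu hv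
  rw [abs_of_nonpos (show u - x ≤ 0 by linarith [hxm.1])] at hu
  rw [abs_of_nonneg (show 0 ≤ v - x by linarith [hxm.2])] at hv
  have e1 : ∫ z in Ioc u v, b z = (∫ t in x..v, b t) - ∫ t in x..u, b t := by
    rw [← intervalIntegral.integral_of_le huv.le, intervalIntegral.integral_interval_sub_left (hii _ _) (hii _ _)]
  have e2 : b x - av b u v = (v - u)⁻¹ * ((v - u) * b x - ∫ z in Ioc u v, b z) := by
    unfold av; field_simp
  rw [e2, abs_mul, abs_of_pos (inv_pos.2 h0), inv_mul_le_iff₀ h0, e1]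
  rw [abs_le] at hu hv ⊢
  constructor <;> linarith [hu.1, hu.2, hv.1, hv.2]

lemma JN_level {b : ℝ → ℝ} (hb : LocallyIntegrable b) (hosc : ∀ u v, u < v → ∫ y in Ioc u v, |b y - av b u v| ≤ v - u)
    {u v : ℝ} (huv : u < v) (k : ℕ) :
    volume {x | x ∈ Ioc u v ∧ 1 + 40 * (1 + (k:ℝ)) < |b x - av b u v|} ≤ ENNReal.ofReal ((1 / 2) ^ k * (v - u)) := by
  set E : ℝ × ℝ → Set ℝ := fun I => Bad ((Ioc I.1 I.2).indicator fun y => |b y - av b I.1 I.2|) 40 with hEd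
  have hib : ∀ (I : ℝ × ℝ) (q : ℝ), IntegrableOn (fun y => |b y - q|) (Ioc I.1 I.2) := by
    intro I q
    have i1 : Integrable (fun _ => q) (volume.restrict (Ioc I.1 I.2)) := integrableOn_const (by simp)
    exact ((locInt_Ioc hb _ _).sub i1).abs
  have hE : ∀ I : ℝ × ℝ, I.1 < I.2 → volume (ivl I ∩ E I) ≤ ENNReal.ofReal ((I.2 - I.1) / 8) := by
    intro I hI
    refine (measure_mono inter_subset_right).trans ((volume_Bad_le ((hib I _).integrable_indicator measurableSet_Ioc)
      (fun x => indicator_nonneg (fun y _ => abs_nonneg _) x) (by norm_num)).trans (ENNReal.ofReal_le_ofReal ?_))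
    rw [integral_indicator measurableSet_Ioc]
    have := hosc _ _ hI
    linarith
  have hP : ∀ x, ∀ I J : ℝ × ℝ, I.1 < I.2 → J.1 < J.2 → ivl J ⊆ ivl I → x ∈ ivl J → (∃ x' ∈ ivl J, x' ∉ E I) →
      |b x - av b I.1 I.2| ≤ |b x - av b J.1 J.2| + 40 * 1 := by
    rintro x I J hI hJ hJI hx ⟨x', hx', hE'⟩
    have h1 := not_Bad_le hE' hx'.1.le hx'.2 hJ.le
    have h0 : 0 < J.2 - J.1 := by linarith
    rw [intervalIntegral.integral_of_le hJ.le, setIntegral_congr_fun (g := fun y => |b y - av b I.1 I.2|) measurableSet_Ioc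
      (fun y hy => indicator_of_mem (hJI hy) _)] at h1
    have h2 := av_sub_le hb (av b I.1 I.2) hJ
    have h3 : (J.2 - J.1)⁻¹ * ∫ y in Ioc J.1 J.2, |b y - av b I.1 I.2| ≤ 40 := by
      rw [inv_mul_le_iff₀ h0]; linarith
    have := abs_sub_le (b x) (av b J.1 J.2) (av b I.1 I.2)
    linarith
  have hν : ∀ (I : ℝ × ℝ) (S : Set ℝ), I.1 < I.2 → S ⊆ ivl I → volume S ≤ ENNReal.ofReal ((I.2 - I.1) / 2) → volume S ≤ ENNReal.ofReal (1/2) * volume (ivl I) := by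
    intro I S _ _ h
    rw [volume_ivl, ← ENNReal.ofReal_mul (by norm_num)]
    refine h.trans (ENNReal.ofReal_le_ofReal (by linarith))
  set T : ℕ → Set ℝ := fun n => ivl (u, v) ∩ {x | k ≤ (chain E n (u, v) (u, v) x).length}
  have hT : ∀ n, volume (T n) ≤ ENNReal.ofReal ((1 / 2) ^ k * (v - u)) := by
    intro n
    refine ((chain_decay hE hν n).2 (u, v) huv k).trans ?_
    rw [volume_ivl, ← ENNReal.ofReal_pow (by norm_num), ← ENNReal.ofReal_mul (by positivity)]
  have hsub : {x | x ∈ Ioc u v ∧ 1 + 40 * (1 + (k:ℝ)) < |b x - av b u v|} ≤ᵐ[volume] ⋃ N, ⋂ n ∈ Ici N, T n := by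
    filter_upwards [leb_pt hb] with x hx hxm
    obtain ⟨hxI, hlt⟩ : x ∈ Ioc u v ∧ 1 + 40 * (1 + (k:ℝ)) < |b x - av b u v| := hxm
    obtain ⟨δ, hδ, hd⟩ := hx
    obtain ⟨N, hN⟩ := pow_unbounded_of_one_lt ((v - u) / δ) (one_lt_two : (1:ℝ) < 2)
    refine mem_iUnion.2 ⟨N, mem_iInter₂.2 fun n hn => ⟨hxI, ?_⟩⟩
    have hpt := chain_pt (x := x) (E := E) (Psi := fun I => |b x - av b I.1 I.2|) (μ := fun _ => 1) (Λ := 40) (δ := δ) (ε := 1) hE (hP x)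
      (fun J hJ hxJ hl => hd _ _ hJ hxJ hl) n (u, v) (u, v) huv huv le_rfl hxI
      ((hE _ huv).trans (ENNReal.ofReal_le_ofReal (by linarith))) (by
        rw [div_lt_iff₀ hδ] at hN
        rw [div_le_iff₀ (by positivity)]
        have : (2:ℝ) ^ N ≤ 2 ^ n := pow_le_pow_right₀ (by norm_num) hn
        simp only
        nlinarith)
    simp only [List.map_const', List.sum_replicate, smul_eq_mul, mul_one, nsmul_eq_mul] at hpt
    have h3 : (k:ℝ) < (chain E n (u, v) (u, v) x).length := by linarith
    exact (Nat.cast_lt.1 h3).le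
  refine (measure_mono_ae hsub).trans ?_
  rw [Monotone.measure_iUnion]
  · refine iSup_le fun N => (measure_mono ?_).trans (hT N)
    exact biInter_subset_of_mem self_mem_Ici
  · intro N N' h
    exact biInter_subset_biInter_left (Ici_subset_Ici.2 h)

/-- John–Nirenberg -/
theorem JN : ∃ c C : ℝ, 0 < c ∧ 0 < C ∧ ∀ b : ℝ → ℝ, Measurable b → LocallyIntegrable b → 
    (∀ u v, u < v → ∫ y in Ioc u v, |b y - av b u v| ≤ v - u) → ∀ u v, u < v → 
    ∫⁻ y in Ioc u v, ENNReal.ofReal (Real.exp (c * |b y - av b u v|)) ≤ ENNReal.ofReal (C * (v - u)) := by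
  obtain ⟨c, hc, hce⟩ : ∃ c : ℝ, 0 < c ∧ Real.exp (c * 40) = 4 / 3 := by
    refine ⟨Real.log (4/3) / 40, div_pos (Real.log_pos (by norm_num)) (by norm_num), ?_⟩
    rw [div_mul_cancel₀ _ (by norm_num), Real.exp_log (by norm_num)]
  refine ⟨c, Real.exp (c * 41) + Real.exp (c * 81) * 3, hc, by positivity, fun b hbm hb hosc u v huv => ?_⟩
  set S : ℕ → Set ℝ := fun k => {x | x ∈ Ioc u v ∧ 1 + 40 * (1 + (k:ℝ)) < |b x - av b u v|} with hS
  have hSm : ∀ k, MeasurableSet (S k) := fun k => measurableSet_Ioc.inter (measurableSet_lt (f := fun _ => 1 + 40 * (1 + (k:ℝ))) (g := fun x => |b x - av b u v|) measurable_const (by fun_prop))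
  have hpt : ∀ x ∈ Ioc u v, ENNReal.ofReal (Real.exp (c * |b x - av b u v|)) ≤ ENNReal.ofReal (Real.exp (c * 41)) + 
      ∑' k : ℕ, (S k).indicator (fun _ => ENNReal.ofReal (Real.exp (c * 81) * (4 / 3) ^ k)) x := by
    intro x hx
    by_cases h1 : |b x - av b u v| ≤ 41
    · refine le_add_right (ENNReal.ofReal_le_ofReal (Real.exp_le_exp.2 (by gcongr)))
    · push Not at h1
      set k := ⌈(|b x - av b u v| - 41) / 40⌉₊ - 1
      have hp : 0 < ⌈(|b x - av b u v| - 41) / 40⌉₊ := Nat.ceil_pos.2 (by linarith)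
      have hk1 : ((k:ℕ):ℝ) + 1 = (⌈(|b x - av b u v| - 41) / 40⌉₊ : ℝ) := by
        exact_mod_cast Nat.succ_pred_eq_of_pos hp
      have hk2 : (k:ℝ) < (|b x - av b u v| - 41) / 40 := Nat.lt_ceil.1 (by omega)
      have hk3 : (|b x - av b u v| - 41) / 40 ≤ (k:ℝ) + 1 := by rw [hk1]; exact Nat.le_ceil _
      refine le_add_left ((le_trans ?_ (ENNReal.le_tsum k)))
      rw [indicator_of_mem (show x ∈ S k from ⟨hx, by linarith⟩)]
      refine ENNReal.ofReal_le_ofReal ?_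
      rw [← hce, ← Real.exp_nat_mul, ← Real.exp_add]
      refine Real.exp_le_exp.2 ?_
      have : |b x - av b u v| ≤ 81 + k * 40 := by linarith
      nlinarith
  refine (setLIntegral_mono' measurableSet_Ioc hpt).trans ?_
  rw [lintegral_add_left measurable_const, lintegral_tsum (fun k => (measurable_const.indicator (hSm k)).aemeasurable)]
  have h0 : 0 < v - u := by linarith
  have hk : ∀ k, ∫⁻ x in Ioc u v, (S k).indicator (fun _ => ENNReal.ofReal (Real.exp (c * 81) * (4 / 3) ^ k)) x ≤ 
      ENNReal.ofReal (Real.exp (c * 81) * (v - u) * (2 / 3) ^ k) := by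
    intro k
    refine (setLIntegral_le_lintegral _ _).trans ?_
    rw [lintegral_indicator (hSm k), setLIntegral_const]
    refine (mul_le_mul_right (JN_level hb hosc huv k) _).trans ?_
    rw [← ENNReal.ofReal_mul (by positivity)]
    refine ENNReal.ofReal_le_ofReal (le_of_eq ?_)
    rw [show (2/3:ℝ) = 4/3 * (1/2) by norm_num, mul_pow]; ring
  refine (add_le_add le_rfl (ENNReal.tsum_le_tsum hk)).trans ?_
  have hsm : Summable fun k : ℕ => (2/3:ℝ) ^ k := summable_geometric_of_lt_one (by norm_num) (by norm_num)
  rw [← ENNReal.ofReal_tsum_of_nonneg (fun k => by positivity) (hsm.mul_left _), tsum_mul_left, tsum_geometric_of_lt_one (by norm_num) (by norm_num),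
    setLIntegral_const, Real.volume_Ioc, ← ENNReal.ofReal_mul (by positivity), ← ENNReal.ofReal_add (by positivity) (by positivity)]
  refine ENNReal.ofReal_le_ofReal (le_of_eq ?_)
  ring

lemma Bad_vol {g : ℝ → ℝ} (hg : Integrable g) {α ℓ c0 : ℝ} (hα : 0 ≤ α) (hℓ : 0 < ℓ) (hc : 0 < c0) (h : ∫ y, |g y| ≤ α * ℓ) :
    volume (Bad (fun y => |g y|) (c0 * α)) ≤ ENNReal.ofReal (5 * ℓ / c0) := by
  rcases hα.eq_or_lt with h0 | h0
  · have hz := ae_zero_of_int hg (by rw [← h0, zero_mul] at h; exact h)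
    have : Bad (fun y => |g y|) (c0 * α) = ∅ := by
      rw [eq_empty_iff_forall_notMem]
      rintro x ⟨u, v, _, _, huv, hl⟩
      rw [← h0, mul_zero, zero_mul, intervalIntegral.integral_congr_ae (g := fun _ => 0)] at hl
      · simp at hl
      · filter_upwards [hz] with y hy _
        simp [hy]
    rw [this]; simp
  · refine (volume_Bad_le hg.abs (fun x => abs_nonneg _) (by positivity)).trans (ENNReal.ofReal_le_ofReal ?_)
    rw [div_le_div_iff₀ (by positivity) hc]
    nlinarith [mul_le_mul_of_nonneg_left h (by positivity : 0 ≤ 5 * c0)]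

theorem loc_incr (m : ℕ) {η : ℝ} (hη : 0 < η) : ∃ Λ : ℝ, 0 < Λ ∧ ∀ (a : Fin m → ℝ → ℝ) (f : ℝ → ℝ) (p q : ℝ)
    (α : Fin m → ℝ) (φ : ℝ), (∀ j, 0 ≤ α j) → 0 ≤ φ →
    (∀ j, Integrable (a j)) → Integrable f → (∀ y ∉ Ioc p q, f y = 0) → p < q →
    (∀ j, ∫ y, |a j y| ≤ α j * (q - p)) → ∫ y, |f y| ≤ φ * (q - p) →
    ∃ EE : Set ℝ, volume EE ≤ ENNReal.ofReal (η * (q - p)) ∧ ∀ u v x x' e : ℝ, u < v → x ∈ Icc u v → x' ∈ Icc u v → 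
      x' ∈ Icc p q → x' ∉ EE → 0 < e → 
      |∫ y in {y | e < |x - y|} \ Icc (u - (v - u)) (v + (v - u)), Kq m a x y * f y| ≤ Λ * ((∏ j, α j) * φ) := by
  obtain ⟨Λ, hΛ, H⟩ := core m (half_pos hη)
  have hC1 := C1_pos m
  set c0 : ℝ := 10 * (m + 1) / η with hc0
  have hc0p : 0 < c0 := by positivity
  refine ⟨Λ + (2 * C1 m + 8) * c0 ^ m * (8 * c0), by positivity, ?_⟩
  intro a f p q α φ hα hφ ha hf hs hpq ha1 hf1
  have hℓ : 0 < q - p := by linarith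
  set S0 : Set ℝ := {x | x ∈ Icc p q ∧ ∃ e, 0 < e ∧ Λ * ((∏ j, α j) * φ) < |Tr m a f e x|} with hS0
  refine ⟨((⋃ j, Bad (fun y => |a j y|) (c0 * α j)) ∪ Bad (fun y => |f y|) (c0 * φ)) ∪ S0, ?_, ?_⟩
  · refine (measure_union_le _ _).trans ((add_le_add ((measure_union_le _ _).trans (add_le_add ((measure_iUnion_fintype_le _ _).trans 
      (Finset.sum_le_sum fun j _ => Bad_vol (ha j) (hα j) hℓ hc0p (ha1 j))) (Bad_vol hf hφ hℓ hc0p hf1))) (H a f p q α φ hα hφ ha hf hs hpq ha1 hf1)).trans ?_)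
    rw [Finset.sum_const, Finset.card_univ, Fintype.card_fin, nsmul_eq_mul, ← ENNReal.ofReal_natCast, ← ENNReal.ofReal_mul (by positivity),
      ← ENNReal.ofReal_add (by positivity) (by positivity), ← ENNReal.ofReal_add (by positivity) (by positivity)]
    refine ENNReal.ofReal_le_ofReal (le_of_eq ?_)
    rw [hc0]; field_simp; ring
  · intro u v x x' e huv hx hx' hx'p hE he
    simp only [mem_union, mem_iUnion, not_or, not_exists] at hE
    obtain ⟨⟨h1, h2⟩, h3⟩ := hE
    have := one_step ha (α := fun j => c0 * α j) (fun j => mul_nonneg hc0p.le (hα j)) hf (φ := 8 * (c0 * φ)) (τ := Λ * ((∏ j, α j) * φ)) huv hx hx'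
      (fun j z => Bad_abs_le (h1 j) z) (fun r hr => Tl_Bad hf h2 hr) (fun r hr => by
        by_contra hc
        exact h3 ⟨hx'p, r, hr, not_le.1 hc⟩) he
    refine this.trans (le_of_eq ?_)
    rw [Finset.prod_mul_distrib, Finset.prod_const, Finset.card_univ, Fintype.card_fin]
    ring

/-- left/right end of the tripled interval -/
def lo (I : ℝ × ℝ) : ℝ := I.1 - (I.2 - I.1)
def hi (I : ℝ × ℝ) : ℝ := I.2 + (I.2 - I.1)

/-- kernel of the commutator -/
noncomputable def kA (m : ℕ) (A A' : ℝ → ℝ) (a : Fin m → ℝ → ℝ) (x y : ℝ) : ℝ :=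
  (P2 A A' x y * ∏ j, Adiff (a j) x y) / (x - y) ^ (m + 2)

noncomputable def muA (m : ℕ) (b : ℝ → ℝ) (a : Fin m → ℝ → ℝ) (f : ℝ → ℝ) (I : ℝ × ℝ) : ℝ :=
  (∏ j, av (fun y => |a j y|) (lo I) (hi I)) *
    (av (fun y => |f y|) (lo I) (hi I) + av (fun y => |b y - av b (lo I) (hi I)| * |f y|) (lo I) (hi I))

noncomputable def PsiA (m : ℕ) (A b : ℝ → ℝ) (a : Fin m → ℝ → ℝ) (f : ℝ → ℝ) (e : ℝ) (I : ℝ × ℝ) (x : ℝ) : ℝ :=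
  |∫ y in {y | e < |x - y|} ∩ Ioc (lo I) (hi I), kA m A b a x y * f y|

lemma Adiff_indicator {g : ℝ → ℝ} {p q x y : ℝ} (hx : x ∈ Ioc p q) (hy : y ∈ Ioc p q) :
    Adiff ((Ioc p q).indicator g) x y = Adiff g x y := by
  unfold Adiff
  refine intervalIntegral.integral_congr_ae (Eventually.of_forall fun z hz => indicator_of_mem ?_ _)
  rw [mem_uIoc] at hz
  rcases hz with hz | hz
  · exact ⟨hy.1.trans hz.1, hz.2.trans hx.2⟩
  · exact ⟨hx.1.trans hz.1, hz.2.trans hy.2⟩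

lemma kA_eq {m : ℕ} {A b : ℝ → ℝ} (hAb : ∀ x y, A x - A y = Adiff b x y) (hb : LocallyIntegrable b) (a : Fin m → ℝ → ℝ) (f : ℝ → ℝ) (c : ℝ) {p q x y : ℝ}
    (hx : x ∈ Ioc p q) (hy : y ∈ Ioc p q) :
    kA m A b a x y * f y = Kq (m + 1) (Fin.cons ((Ioc p q).indicator fun y => b y - c) fun j => (Ioc p q).indicator (a j)) x y * (Ioc p q).indicator f y - 
      Kq m (fun j => (Ioc p q).indicator (a j)) x y * (Ioc p q).indicator (fun y => (b y - c) * f y) y := by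
  unfold kA P2 Kq
  rw [Fin.prod_univ_succ]
  simp only [Fin.cons_zero, Fin.cons_succ, Adiff_indicator hx hy, indicator_of_mem hy, hAb x y]
  have h1 : Adiff (fun y => b y - c) x y = Adiff b x y - c * (x - y) := by
    unfold Adiff
    rw [intervalIntegral.integral_sub (hb.integrableOn_isCompact isCompact_uIcc).intervalIntegrable (by simp)]
    simp; ring
  rw [h1, Finset.prod_div_distrib, Finset.prod_const, Finset.card_univ, Fintype.card_fin]
  rcases eq_or_ne x y with rfl | hxy
  · simp
  · have : x - y ≠ 0 := sub_ne_zero.2 hxy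
    field_simp
    ring

lemma av_nonneg {g : ℝ → ℝ} (h : ∀ y, 0 ≤ g y) {u v : ℝ} (huv : u ≤ v) : 0 ≤ av g u v :=
  mul_nonneg (inv_nonneg.2 (by linarith)) (integral_nonneg h)

lemma int_ind_abs {g : ℝ → ℝ} {u v : ℝ} (huv : u < v) : ∫ y, |(Ioc u v).indicator g y| = av (fun y => |g y|) u v * (v - u) := by
  have h0 : v - u ≠ 0 := by linarith
  have : (fun y => |(Ioc u v).indicator g y|) = (Ioc u v).indicator fun y => |g y| := by
    ext y; by_cases h : y ∈ Ioc u v <;> simp [h]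
  rw [this, integral_indicator measurableSet_Ioc, av]
  field_simp

theorem step_A (m : ℕ) : ∃ Λ : ℝ, 0 < Λ ∧ ∀ (A b : ℝ → ℝ) (_ : ∀ x y, A x - A y = Adiff b x y) (_ : LocallyIntegrable b)
    (_ : ∀ u v, u < v → ∫ y in Ioc u v, |b y - av b u v| ≤ v - u) (a : Fin m → ℝ → ℝ) (f : ℝ → ℝ)
    (_ : ∀ j, LocallyIntegrable (a j)) (_ : LocallyIntegrable f) (_ : LocallyIntegrable fun y => b y * f y) (e : ℝ) (_ : 0 < e), ∃ E : ℝ × ℝ → Set ℝ,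
    (∀ I : ℝ × ℝ, I.1 < I.2 → volume (ivl I ∩ E I) ≤ ENNReal.ofReal ((I.2 - I.1) / 8)) ∧
    (∀ x, ∀ I J : ℝ × ℝ, I.1 < I.2 → J.1 < J.2 → ivl J ⊆ ivl I → x ∈ ivl J → (∃ x' ∈ ivl J, x' ∉ E I) →
      PsiA m A b a f e I x ≤ PsiA m A b a f e J x + Λ * muA m b a f I) := by
  obtain ⟨Λ1, hΛ1, H1⟩ := loc_incr (m + 1) (η := 1 / 48) (by norm_num)
  obtain ⟨Λ2, hΛ2, H2⟩ := loc_incr m (η := 1 / 48) (by norm_num)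
  refine ⟨Λ1 + Λ2, by positivity, ?_⟩
  intro A b hAb hb hosc a f ha hf hbf e he
  have key : ∀ I : ℝ × ℝ, ∃ EI : Set ℝ, I.1 < I.2 → volume EI ≤ ENNReal.ofReal ((I.2 - I.1) / 8) ∧ 
      ∀ x, ∀ J : ℝ × ℝ, J.1 < J.2 → ivl J ⊆ ivl I → x ∈ ivl J → (∃ x' ∈ ivl J, x' ∉ EI) →
      PsiA m A b a f e I x ≤ PsiA m A b a f e J x + (Λ1 + Λ2) * muA m b a f I := by
    intro I
    by_cases hI : I.1 < I.2
    swap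
    · exact ⟨∅, fun h => absurd h hI⟩
    set p := lo I with hp
    set q := hi I with hq
    have hpq : p < q := by simp only [hp, hq, lo, hi]; linarith
    have hlen : q - p = 3 * (I.2 - I.1) := by simp only [hp, hq, lo, hi]; ring
    set c := av b p q with hc
    set β : ℝ → ℝ := fun y => b y - c with hβ
    have i1 : IntegrableOn (fun _ => c) (Ioc p q) volume := integrableOn_const (by simp)
    have hβi : Integrable ((Ioc p q).indicator β) := IntegrableOn.integrable_indicator ((locInt_Ioc hb p q).sub i1) measurableSet_Ioc
    have hai : ∀ j, Integrable ((Ioc p q).indicator (a j)) := fun j => (locInt_Ioc (ha j) p q).integrable_indicator measurableSet_Ioc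
    have hfi : Integrable ((Ioc p q).indicator f) := (locInt_Ioc hf p q).integrable_indicator measurableSet_Ioc
    have hβfi : Integrable ((Ioc p q).indicator fun y => β y * f y) := by
      refine IntegrableOn.integrable_indicator ?_ measurableSet_Ioc
      have := (locInt_Ioc hbf p q).sub ((locInt_Ioc hf p q).const_mul c)
      refine this.congr (Eventually.of_forall fun y => ?_)
      simp [hβ]; ring
    have hci : ∀ j, Integrable ((Fin.cons ((Ioc p q).indicator β) fun j => (Ioc p q).indicator (a j) : Fin (m + 1) → ℝ → ℝ) j) := by
      intro j
      refine Fin.cases ?_ (fun j => ?_) j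
      · simpa using hβi
      · simpa using hai j
    set α : Fin m → ℝ := fun j => av (fun y => |a j y|) p q with hα
    set φ1 := av (fun y => |f y|) p q with hφ1
    set φ2 := av (fun y => |β y| * |f y|) p q with hφ2
    have hα0 : ∀ j, 0 ≤ α j := fun j => av_nonneg (fun _ => abs_nonneg _) hpq.le
    have hφ10 : 0 ≤ φ1 := av_nonneg (fun _ => abs_nonneg _) hpq.le
    have hφ20 : 0 ≤ φ2 := av_nonneg (fun _ => by positivity) hpq.le
    have hs : ∀ g : ℝ → ℝ, ∀ y ∉ Ioc p q, (Ioc p q).indicator g y = 0 := fun g y hy => indicator_of_notMem hy _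
    obtain ⟨E1, hE1, P1⟩ := H1 (Fin.cons ((Ioc p q).indicator β) fun j => (Ioc p q).indicator (a j)) ((Ioc p q).indicator f) p q (Fin.cons 1 α) φ1
      (fun j => by refine Fin.cases ?_ (fun j => ?_) j <;> simp [hα0]) hφ10 hci hfi (hs _) hpq 
      (fun j => by
        refine Fin.cases ?_ (fun j => ?_) j
        · simp only [Fin.cons_zero]
          have := hosc p q hpq
          rw [int_ind_abs hpq, av]
          have h0 : q - p ≠ 0 := by linarith
          rw [inv_mul_eq_div, div_mul_cancel₀ _ h0, one_mul]
          exact this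
        · simp only [Fin.cons_succ]
          exact (int_ind_abs hpq).le) (int_ind_abs hpq).le
    obtain ⟨E2, hE2, P2⟩ := H2 (fun j => (Ioc p q).indicator (a j)) ((Ioc p q).indicator fun y => β y * f y) p q α φ2 hα0 hφ20 hai hβfi (hs _) hpq 
      (fun j => (int_ind_abs hpq).le) (by
        refine (int_ind_abs hpq).le.trans (le_of_eq ?_)
        simp only [abs_mul, hφ2])
    refine ⟨E1 ∪ E2, fun _ => ⟨?_, ?_⟩⟩
    · refine (measure_union_le _ _).trans ((add_le_add hE1 hE2).trans ?_)
      rw [← ENNReal.ofReal_add (by linarith) (by linarith)]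
      refine ENNReal.ofReal_le_ofReal ?_
      rw [hlen]; linarith
    · rintro x J hJ hJI hx ⟨x', hx', hxE⟩
      simp only [mem_union, not_or] at hxE
      have hIX : ivl I ⊆ Ioc p q := fun y hy => ⟨by simp only [hp, lo]; linarith [hy.1], by simp only [hq, hi]; linarith [hy.2]⟩
      have hxX : x ∈ Ioc p q := hIX (hJI hx)
      have hJI' : I.1 ≤ J.1 ∧ J.2 ≤ I.2 := by
        rw [ivl, ivl, Ioc_subset_Ioc_iff hJ] at hJI
        exact ⟨hJI.2, hJI.1⟩
      have B1 := P1 J.1 J.2 x x' e hJ ⟨hx.1.le, hx.2⟩ ⟨hx'.1.le, hx'.2⟩ (Ioc_subset_Icc_self (hIX (hJI hx'))) hxE.1 he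
      have B2 := P2 J.1 J.2 x x' e hJ ⟨hx.1.le, hx.2⟩ ⟨hx'.1.le, hx'.2⟩ (Ioc_subset_Icc_self (hIX (hJI hx'))) hxE.2 he
      rw [Fin.prod_univ_succ] at B1
      simp only [Fin.cons_zero, Fin.cons_succ, one_mul] at B1
      set D : Set ℝ := {y | e < |x - y|} with hD
      have hDm : MeasurableSet D := measurableSet_trunc e x
      set G1 : ℝ → ℝ := fun y => Kq (m + 1) (Fin.cons ((Ioc p q).indicator β) fun j => (Ioc p q).indicator (a j)) x y * (Ioc p q).indicator f y with hG1
      set G2 : ℝ → ℝ := fun y => Kq m (fun j => (Ioc p q).indicator (a j)) x y * (Ioc p q).indicator (fun y => β y * f y) y with hG2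
      have hI1 : IntegrableOn G1 D := Tr_integrable hci hfi he x
      have hI2 : IntegrableOn G2 D := Tr_integrable hai hβfi he x
      have heq : ∀ y ∈ Ioc p q, kA m A b a x y * f y = G1 y - G2 y := fun y hy => kA_eq hAb hb a f c hxX hy
      have hoff : ∀ y ∉ Ioc p q, G1 y - G2 y = 0 := fun y hy => by simp [hG1, hG2, hs _ y hy]
      have hsub3 : Ioc (lo J) (hi J) ⊆ Ioc p q := Ioc_subset_Ioc (by simp only [hp, lo]; linarith) (by simp only [hq, hi]; linarith)
      have e1 : ∫ y in D ∩ Ioc p q, kA m A b a x y * f y = ∫ y in D, (G1 y - G2 y) := by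
        rw [setIntegral_congr_fun (hDm.inter measurableSet_Ioc) (fun y hy => heq y hy.2)]
        exact (setIntegral_eq_of_subset_of_forall_sdiff_eq_zero hDm inter_subset_left (fun y hy => hoff y fun h => hy.2 ⟨hy.1, h⟩)).symm
      have e2 : ∫ y in D ∩ Ioc (lo J) (hi J), kA m A b a x y * f y = ∫ y in D ∩ Icc (lo J) (hi J), (G1 y - G2 y) := by
        rw [setIntegral_congr_fun (hDm.inter measurableSet_Ioc) (fun y hy => heq y (hsub3 hy.2))]
        refine setIntegral_congr_set ?_
        exact (ae_eq_refl _).inter Ioc_ae_eq_Icc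
      have e3 := integral_inter_add_sdiff (μ := volume) (s := D) (t := Icc (lo J) (hi J)) (f := fun y => G1 y - G2 y) measurableSet_Icc (hI1.sub hI2)
      have e4 : ∫ y in D \ Icc (lo J) (hi J), (G1 y - G2 y) = (∫ y in D \ Icc (lo J) (hi J), G1 y) - ∫ y in D \ Icc (lo J) (hi J), G2 y :=
        integral_sub (hI1.mono_set sdiff_subset) (hI2.mono_set sdiff_subset)
      have hμ : muA m b a f I = (∏ j, α j) * (φ1 + φ2) := rfl
      unfold PsiA
      rw [← hp, ← hq, e1, e2, ← e3, e4, hμ]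
      have B1' : |∫ y in D \ Icc (lo J) (hi J), G1 y| ≤ Λ1 * ((∏ j, α j) * φ1) := B1
      have B2' : |∫ y in D \ Icc (lo J) (hi J), G2 y| ≤ Λ2 * ((∏ j, α j) * φ2) := B2
      have hPα : 0 ≤ ∏ j, α j := Finset.prod_nonneg fun j _ => hα0 j
      have t1 := abs_add_le (∫ y in D ∩ Icc (lo J) (hi J), (G1 y - G2 y)) ((∫ y in D \ Icc (lo J) (hi J), G1 y) - ∫ y in D \ Icc (lo J) (hi J), G2 y)
      have t2 := abs_sub (∫ y in D \ Icc (lo J) (hi J), G1 y) (∫ y in D \ Icc (lo J) (hi J), G2 y)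
      have n1 : 0 ≤ Λ1 * ((∏ j, α j) * φ2) := by positivity
      have n2 : 0 ≤ Λ2 * ((∏ j, α j) * φ1) := by positivity
      nlinarith
  choose E hE using key
  refine ⟨E, fun I hI => (measure_mono inter_subset_right).trans (hE I hI).1, fun x I J hI => (hE I hI).2 x J⟩

/-- the Young function `t log (e + t)` -/
noncomputable def Ph (t : ℝ) : ℝ := t * Real.log (Real.exp 1 + t)

lemma log_e_ge {t : ℝ} (ht : 0 ≤ t) : 1 ≤ Real.log (Real.exp 1 + t) := by
  rw [Real.le_log_iff_exp_le (by positivity)]; linarith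

lemma Ph_nonneg {t : ℝ} (ht : 0 ≤ t) : 0 ≤ Ph t := mul_nonneg ht (zero_le_one.trans (log_e_ge ht))

lemma Ph_ge {t : ℝ} (ht : 0 ≤ t) : t ≤ Ph t := le_mul_of_one_le_right ht (log_e_ge ht)

lemma Ph_mul {x y : ℝ} (hx : 0 ≤ x) (hy : 0 ≤ y) : Ph (x * y) ≤ 2 * Ph x * Ph y := by
  have h1 := log_e_ge hx
  have h2 := log_e_ge hy
  have he : 1 ≤ Real.exp 1 := Real.one_le_exp (by norm_num)
  have h3 : Real.log (Real.exp 1 + x * y) ≤ Real.log (Real.exp 1 + x) + Real.log (Real.exp 1 + y) := by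
    rw [← Real.log_mul (by positivity) (by positivity)]
    refine Real.log_le_log (by positivity) ?_
    nlinarith [mul_nonneg hx (by linarith : 0 ≤ Real.exp 1), mul_nonneg hy (by linarith : 0 ≤ Real.exp 1), mul_self_nonneg (Real.exp 1 - 1)]
  have h4 : Real.log (Real.exp 1 + x * y) ≤ 2 * (Real.log (Real.exp 1 + x) * Real.log (Real.exp 1 + y)) := by nlinarith
  unfold Ph
  calc x * y * Real.log (Real.exp 1 + x * y) ≤ x * y * (2 * (Real.log (Real.exp 1 + x) * Real.log (Real.exp 1 + y))) := by gcongr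
    _ = _ := by ring

lemma Ph_inv {τ : ℝ} (h0 : 0 < τ) (h1 : τ ≤ 1) : Ph τ⁻¹ ≤ 2 * (τ ^ 2)⁻¹ := by
  have hs : 1 ≤ τ⁻¹ := (one_le_inv₀ h0).2 h1
  have he : (2:ℝ) ≤ Real.exp 1 := by linarith [Real.add_one_le_exp (1:ℝ)]
  have h2 : Real.log (Real.exp 1 + τ⁻¹) ≤ 2 * τ⁻¹ := by
    have e1 : Real.exp 1 + τ⁻¹ = Real.exp 1 * (1 + τ⁻¹ / Real.exp 1) := by field_simp
    rw [e1, Real.log_mul (by positivity) (by positivity), Real.log_exp]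
    have := Real.log_le_sub_one_of_pos (show 0 < 1 + τ⁻¹ / Real.exp 1 by positivity)
    have h3 : τ⁻¹ / Real.exp 1 ≤ τ⁻¹ := div_le_self (by positivity) (by linarith)
    linarith
  unfold Ph
  calc τ⁻¹ * Real.log (Real.exp 1 + τ⁻¹) ≤ τ⁻¹ * (2 * τ⁻¹) := by gcongr
    _ = _ := by rw [← inv_pow]; ring

lemma Ph_prod {m : ℕ} (s : Finset (Fin m)) {α : Fin m → ℝ} (hα : ∀ j, 0 ≤ α j) : Ph (∏ j ∈ s, α j) ≤ Ph 1 * ∏ j ∈ s, (2 * Ph (α j)) := by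
  classical
  induction s using Finset.induction_on with
  | empty => simp
  | insert j s hj ih =>
    rw [Finset.prod_insert hj, Finset.prod_insert hj]
    have := Ph_nonneg (hα j)
    calc _ ≤ 2 * Ph (α j) * Ph (∏ j ∈ s, α j) := Ph_mul (hα j) (Finset.prod_nonneg fun j _ => hα j)
      _ ≤ 2 * Ph (α j) * (Ph 1 * ∏ j ∈ s, (2 * Ph (α j))) := by gcongr
      _ = _ := by ring

lemma young {x y : ℝ} (hy : 0 ≤ y) : x * y ≤ Ph y + Real.exp x := by
  rcases hy.eq_or_lt with rfl | hy
  · simp [Ph]; positivity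
  · have h1 := Real.add_one_le_exp (x - Real.log y)
    rw [Real.exp_sub, Real.exp_log hy, le_div_iff₀ hy] at h1
    have h2 : Real.log y ≤ Real.log (Real.exp 1 + y) := Real.log_le_log hy (by linarith [Real.exp_pos 1])
    have h3 : y * Real.log y ≤ Ph y := mul_le_mul_of_nonneg_left h2 hy.le
    nlinarith

lemma ofReal_int_le {g : ℝ → ℝ} {μ : Measure ℝ} (hg : ∀ y, 0 ≤ g y) : ENNReal.ofReal (∫ y, g y ∂μ) ≤ ∫⁻ y, ENNReal.ofReal (g y) ∂μ := by
  by_cases h : Integrable g μ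
  · rw [ofReal_integral_eq_lintegral_ofReal h (Eventually.of_forall hg)]
  · rw [integral_undef h]; simp

lemma Ph_jensen {g : ℝ → ℝ} {u v : ℝ} (huv : u < v) :
    ENNReal.ofReal (Ph (av (fun y => |g y|) u v) * (v - u)) ≤ 4 * ∫⁻ y in Ioc u v, ENNReal.ofReal (Ph |g y|) := by
  set α := av (fun y => |g y|) u v with hα
  have h0 : 0 < v - u := by linarith
  have hα0 : 0 ≤ α := av_nonneg (fun _ => abs_nonneg _) huv.le
  set l := Real.log (Real.exp 1 + α) with hl
  have hl1 : 1 ≤ l := log_e_ge hα0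
  have he : 1 ≤ Real.exp 1 := Real.one_le_exp (by norm_num)
  have hpt : ∀ s : ℝ, 0 ≤ s → s * (l / 2) ≤ Ph s + α / 4 * l := by
    intro s hs
    have hp := Ph_nonneg hs
    rcases le_total s (α / 2) with h | h
    · nlinarith
    · have : l ≤ 2 * Real.log (Real.exp 1 + s) := by
        rw [hl, ← Real.log_rpow (by positivity)]
        refine Real.log_le_log (by positivity) ?_
        rw [Real.rpow_two]; nlinarith
      have h2 : s * (l / 2) ≤ s * Real.log (Real.exp 1 + s) := by gcongr; linarith
      have h3 : 0 ≤ α / 4 * l := by positivity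
      unfold Ph; linarith
  have h1 : ENNReal.ofReal (α * (v - u)) ≤ ∫⁻ y in Ioc u v, ENNReal.ofReal |g y| := by
    have : α * (v - u) = ∫ y in Ioc u v, |g y| := by rw [hα, av]; field_simp
    rw [this]; exact ofReal_int_le fun _ => abs_nonneg _
  have h2 : ENNReal.ofReal (l / 2) * ∫⁻ y in Ioc u v, ENNReal.ofReal |g y| ≤ (∫⁻ y in Ioc u v, ENNReal.ofReal (Ph |g y|)) + ENNReal.ofReal (α / 4 * l * (v - u)) := by
    rw [← lintegral_const_mul' _ _ ENNReal.ofReal_ne_top]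
    calc _ ≤ ∫⁻ y in Ioc u v, (ENNReal.ofReal (Ph |g y|) + ENNReal.ofReal (α / 4 * l)) := by
          refine lintegral_mono fun y => ?_
          rw [← ENNReal.ofReal_mul (by positivity), ← ENNReal.ofReal_add (Ph_nonneg (abs_nonneg _)) (by positivity)]
          refine ENNReal.ofReal_le_ofReal ?_
          have := hpt |g y| (abs_nonneg _)
          linarith
      _ = _ := by
          rw [lintegral_add_right _ measurable_const, setLIntegral_const, Real.volume_Ioc, ← ENNReal.ofReal_mul (by positivity)]
  have h3 : ENNReal.ofReal (α / 4 * l * (v - u)) + ENNReal.ofReal (α / 4 * l * (v - u)) ≤ (∫⁻ y in Ioc u v, ENNReal.ofReal (Ph |g y|)) + ENNReal.ofReal (α / 4 * l * (v - u)) := by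
    refine le_trans ?_ ((mul_le_mul_right h1 _).trans h2)
    rw [← ENNReal.ofReal_mul (by positivity), ← ENNReal.ofReal_add (by positivity) (by positivity)]
    exact ENNReal.ofReal_le_ofReal (by linarith)
  have h4 := ENNReal.le_of_add_le_add_right ENNReal.ofReal_ne_top h3
  calc ENNReal.ofReal (Ph α * (v - u)) = 4 * ENNReal.ofReal (α / 4 * l * (v - u)) := by
        rw [show (4:ℝ≥0∞) = ENNReal.ofReal 4 by simp, ← ENNReal.ofReal_mul (by norm_num)]
        congr 1; rw [Ph]; ring
    _ ≤ _ := by gcongr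

theorem level_claim (m : ℕ) : ∃ C : ℝ, 1 ≤ C ∧ ∀ (b : ℝ → ℝ) (_ : Measurable b) (_ : LocallyIntegrable b)
    (_ : ∀ u v, u < v → ∫ y in Ioc u v, |b y - av b u v| ≤ v - u) (a : Fin m → ℝ → ℝ) (f : ℝ → ℝ) (τ : ℝ), 0 < τ → τ ≤ 1 → 
    ∀ K : ℝ × ℝ, K.1 < K.2 → τ < muA m b a f K → 
    ENNReal.ofReal (hi K - lo K) ^ (m + 1) ≤ ENNReal.ofReal (C * (τ ^ 2)⁻¹) * 
      ((∏ j, ∫⁻ y in Ioc (lo K) (hi K), ENNReal.ofReal (Ph |a j y|)) * ∫⁻ y in Ioc (lo K) (hi K), ENNReal.ofReal (Ph |f y|)) := by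
  obtain ⟨c, CJ, hc, hCJ, HJ⟩ := JN
  set C' : ℝ := 1 + (1 + CJ) / c with hC'
  have hC'0 : 1 ≤ C' := by rw [hC']; have : 0 < (1 + CJ) / c := by positivity
                           linarith
  have hP1 : 1 ≤ Ph 1 := Ph_ge zero_le_one
  have hPC : 1 ≤ Ph C' := hC'0.trans (Ph_ge (by linarith))
  refine ⟨16 * Ph C' * Ph 1 * 8 ^ m, ?_, ?_⟩
  · have h8 : (1:ℝ) ≤ 8 ^ m := one_le_pow₀ (by norm_num)
    have := one_le_mul_of_one_le_of_one_le (one_le_mul_of_one_le_of_one_le (one_le_mul_of_one_le_of_one_le (by norm_num : (1:ℝ) ≤ 16) hPC) hP1) h8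
    exact this
  intro b hbm hb hosc a f τ hτ hτ1 K hK hlt
  set p := lo K with hp
  set q := hi K with hq
  have hpq : p < q := by simp only [hp, hq, lo, hi]; linarith
  have h0 : 0 < q - p := by linarith
  have hJ := HJ b hbm hb hosc p q hpq
  set u : ℝ → ℝ := fun y => |b y - av b p q| with hu
  have hum : Measurable u := by fun_prop
  set α : Fin m → ℝ := fun j => av (fun y => |a j y|) p q with hα
  have hα0 : ∀ j, 0 ≤ α j := fun j => av_nonneg (fun _ => abs_nonneg _) hpq.le
  set P := ∏ j, α j with hP
  have hP0 : 0 ≤ P := Finset.prod_nonneg fun j _ => hα0 j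
  have hlt' : τ < P * (av (fun y => |f y|) p q + av (fun y => u y * |f y|) p q) := hlt
  have hPp : 0 < P := by
    refine lt_of_le_of_ne hP0 fun h => ?_
    rw [← h, zero_mul] at hlt'; linarith
  set t := τ / (C' * P) with ht
  have ht0 : 0 < t := by positivity
  have hstep : ENNReal.ofReal (q - p) ≤ ∫⁻ y in Ioc p q, ENNReal.ofReal (Ph (|f y| / t)) := by
    by_contra hcon
    push Not at hcon
    have b1 : ∫ y in Ioc p q, |f y| ≤ t * (q - p) := by
      rw [← ENNReal.ofReal_le_ofReal_iff (by positivity)]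
      refine (ofReal_int_le fun _ => abs_nonneg _).trans ?_
      rw [ENNReal.ofReal_mul ht0.le]
      refine le_trans ?_ (mul_le_mul_right hcon.le _)
      rw [← lintegral_const_mul' _ _ ENNReal.ofReal_ne_top]
      refine lintegral_mono fun y => ?_
      rw [← ENNReal.ofReal_mul ht0.le]
      refine ENNReal.ofReal_le_ofReal ?_
      have := Ph_ge (show 0 ≤ |f y| / t by positivity)
      calc |f y| = t * (|f y| / t) := by field_simp
        _ ≤ _ := by gcongr
    have b2 : ∫ y in Ioc p q, u y * |f y| ≤ t / c * (1 + CJ) * (q - p) := by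
      rw [← ENNReal.ofReal_le_ofReal_iff (by positivity)]
      refine (ofReal_int_le fun _ => by positivity).trans ?_
      calc ∫⁻ y in Ioc p q, ENNReal.ofReal (u y * |f y|) ≤ ∫⁻ y in Ioc p q, ENNReal.ofReal (t / c) * (ENNReal.ofReal (Ph (|f y| / t)) + ENNReal.ofReal (Real.exp (c * u y))) := by
            refine lintegral_mono fun y => ?_
            rw [← ENNReal.ofReal_add (Ph_nonneg (by positivity)) (by positivity), ← ENNReal.ofReal_mul (by positivity)]
            refine ENNReal.ofReal_le_ofReal ?_
            have := young (x := c * u y) (y := |f y| / t) (by positivity)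
            calc u y * |f y| = t / c * (c * u y * (|f y| / t)) := by field_simp
              _ ≤ _ := by gcongr
        _ ≤ ENNReal.ofReal (t / c) * (ENNReal.ofReal (q - p) + ENNReal.ofReal (CJ * (q - p))) := by
            rw [lintegral_const_mul' _ _ ENNReal.ofReal_ne_top, lintegral_add_right _ (by fun_prop)]
            gcongr
        _ = _ := by
            rw [← ENNReal.ofReal_add (by positivity) (by positivity), ← ENNReal.ofReal_mul (by positivity)]
            congr 1; ring
    have b3 : av (fun y => |f y|) p q ≤ t := by
      rw [av, inv_mul_le_iff₀ h0]; linarith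
    have b4 : av (fun y => u y * |f y|) p q ≤ t / c * (1 + CJ) := by
      rw [av, inv_mul_le_iff₀ h0]; linarith
    have b5 : P * (av (fun y => |f y|) p q + av (fun y => u y * |f y|) p q) ≤ P * (t * C') := by
      gcongr
      rw [hC']
      calc _ ≤ t + t / c * (1 + CJ) := add_le_add b3 b4
        _ = _ := by field_simp
    have b6 : P * (t * C') = τ := by rw [ht]; field_simp
    linarith
  -- combine
  have hpt : ∀ y, Ph (|f y| / t) ≤ 2 * (2 * (2 * Ph C' * Ph P) * (2 * (τ ^ 2)⁻¹)) * Ph |f y| := by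
    intro y
    have e1 : |f y| / t = (C' * P * τ⁻¹) * |f y| := by rw [ht]; field_simp
    have n1 := Ph_nonneg (abs_nonneg (f y))
    have n2 := Ph_nonneg hP0
    have n3 := Ph_nonneg (show 0 ≤ C' by linarith)
    have n4 := Ph_nonneg (show 0 ≤ C' * P by positivity)
    rw [e1]
    refine (Ph_mul (by positivity) (abs_nonneg _)).trans ?_
    gcongr
    refine (Ph_mul (by positivity) (by positivity)).trans ?_
    gcongr
    · exact Ph_nonneg (by positivity)
    · exact Ph_mul (by linarith) hP0
    · exact Ph_inv hτ hτ1
  have hPP := Ph_prod Finset.univ hα0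
  rw [Finset.prod_mul_distrib, Finset.prod_const, Finset.card_univ, Fintype.card_fin] at hPP
  have nP : 0 ≤ ∏ j, Ph (α j) := Finset.prod_nonneg fun j _ => Ph_nonneg (hα0 j)
  have hfin : ENNReal.ofReal (q - p) ≤ ENNReal.ofReal (16 * Ph C' * Ph 1 * 2 ^ m * (τ ^ 2)⁻¹) * (∏ j, ENNReal.ofReal (Ph (α j))) * ∫⁻ y in Ioc p q, ENNReal.ofReal (Ph |f y|) := by
    refine hstep.trans ?_
    rw [← ENNReal.ofReal_prod_of_nonneg (fun j _ => Ph_nonneg (hα0 j)), ← ENNReal.ofReal_mul (by positivity), ← lintegral_const_mul' _ _ ENNReal.ofReal_ne_top]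
    refine lintegral_mono fun y => ?_
    rw [← ENNReal.ofReal_mul (by positivity)]
    refine ENNReal.ofReal_le_ofReal ((hpt y).trans ?_)
    have n1 := Ph_nonneg (abs_nonneg (f y))
    refine mul_le_mul_of_nonneg_right ?_ n1
    calc 2 * (2 * (2 * Ph C' * Ph P) * (2 * (τ ^ 2)⁻¹)) = 16 * Ph C' * (τ ^ 2)⁻¹ * Ph P := by ring
      _ ≤ 16 * Ph C' * (τ ^ 2)⁻¹ * (Ph 1 * (2 ^ m * ∏ j, Ph (α j))) := by gcongr
      _ = _ := by ring
  have hVm : (∏ j, ENNReal.ofReal (Ph (α j))) * ENNReal.ofReal (q - p) ^ m ≤ ENNReal.ofReal (4 ^ m) * ∏ j, ∫⁻ y in Ioc p q, ENNReal.ofReal (Ph |a j y|) := by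
    have e1 : ENNReal.ofReal (q - p) ^ m = ∏ _j : Fin m, ENNReal.ofReal (q - p) := by simp
    have e2 : ENNReal.ofReal (4 ^ m) = ∏ _j : Fin m, (4:ℝ≥0∞) := by
      rw [ENNReal.ofReal_pow (by norm_num)]; simp
    rw [e1, e2, ← Finset.prod_mul_distrib, ← Finset.prod_mul_distrib]
    refine Finset.prod_le_prod' fun j _ => ?_
    rw [← ENNReal.ofReal_mul (Ph_nonneg (hα0 j))]
    exact Ph_jensen hpq
  calc ENNReal.ofReal (q - p) ^ (m + 1) = ENNReal.ofReal (q - p) * ENNReal.ofReal (q - p) ^ m := by rw [pow_succ]; ring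
    _ ≤ (ENNReal.ofReal (16 * Ph C' * Ph 1 * 2 ^ m * (τ ^ 2)⁻¹) * (∏ j, ENNReal.ofReal (Ph (α j))) * ∫⁻ y in Ioc p q, ENNReal.ofReal (Ph |f y|)) * ENNReal.ofReal (q - p) ^ m := by gcongr
    _ = ENNReal.ofReal (16 * Ph C' * Ph 1 * 2 ^ m * (τ ^ 2)⁻¹) * (((∏ j, ENNReal.ofReal (Ph (α j))) * ENNReal.ofReal (q - p) ^ m) * ∫⁻ y in Ioc p q, ENNReal.ofReal (Ph |f y|)) := by ring
    _ ≤ ENNReal.ofReal (16 * Ph C' * Ph 1 * 2 ^ m * (τ ^ 2)⁻¹) * ((ENNReal.ofReal (4 ^ m) * ∏ j, ∫⁻ y in Ioc p q, ENNReal.ofReal (Ph |a j y|)) * ∫⁻ y in Ioc p q, ENNReal.ofReal (Ph |f y|)) := by gcongr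
    _ = _ := by
        rw [← mul_assoc, ← mul_assoc, ← mul_assoc, ← ENNReal.ofReal_mul (by positivity)]
        congr 3
        rw [show (8:ℝ) = 2 * 4 by norm_num, mul_pow]; ring

noncomputable def eI {k : ℕ} (w : Fin k → ℝ → ℝ) (i : Fin k) (I : ℝ × ℝ) : ℝ≥0∞ :=
  ENNReal.ofReal (essInf (w i) (volume.restrict (ivl I)))

noncomputable def PI {m : ℕ} (w : Fin (m + 1) → ℝ → ℝ) (I : ℝ × ℝ) : ℝ≥0∞ :=
  ∏ i, eI w i I ^ ((1:ℝ) / (m + 1))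

lemma eI_ae {k : ℕ} {w : Fin k → ℝ → ℝ} (hw : ∀ i x, 0 ≤ w i x) (i : Fin k) (I : ℝ × ℝ) :
    ∀ᵐ x ∂(volume.restrict (ivl I)), eI w i I ≤ ENNReal.ofReal (w i x) := by
  have h : ∀ᵐ x ∂(volume.restrict (ivl I)), essInf (w i) (volume.restrict (ivl I)) ≤ w i x :=
    ae_essInf_le ⟨0, by simp only [eventually_map]; exact Eventually.of_forall (fun x => hw i x)⟩
  filter_upwards [h] with x hx
  exact ENNReal.ofReal_le_ofReal hx

lemma PI_ne_top {m : ℕ} (w : Fin (m + 1) → ℝ → ℝ) (I : ℝ × ℝ) : PI w I ≠ ⊤ := by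
  unfold PI
  refine ENNReal.prod_ne_top (fun i _ => ENNReal.rpow_ne_top_of_nonneg (by positivity) ?_)
  exact ENNReal.ofReal_ne_top

lemma W_exists {m : ℕ} {w : Fin (m + 1) → ℝ → ℝ} (hw : ∀ i x, 0 ≤ w i x) (hAP : A11const (m + 1) w ≠ ⊤) :
    ∃ (ν : Measure ℝ) (Q : ℝ), 1 ≤ Q ∧
      (∀ s, ν s = ∫⁻ x in s, ENNReal.ofReal (∏ i, w i x ^ ((1 : ℝ) / (m + 1)))) ∧
      (∀ I : ℝ × ℝ, I.1 < I.2 → ν (ivl I) ≤ ENNReal.ofReal Q * ENNReal.ofReal (I.2 - I.1) * PI w I) ∧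
      (∀ (I : ℝ × ℝ) (s : Set ℝ), s ⊆ ivl I → PI w I * volume s ≤ ν s) := by
  obtain ⟨g, hg, hgF, hgs⟩ := exists_measurable_le_forall_setLIntegral_eq volume
    (fun x => ENNReal.ofReal (∏ i, w i x ^ ((1 : ℝ) / (m + 1))))
  have hν : ∀ s, volume.withDensity g s = ∫⁻ x in s, ENNReal.ofReal (∏ i, w i x ^ ((1 : ℝ) / (m + 1))) := by
    intro s; rw [withDensity_apply' g s, hgs s]
  refine ⟨volume.withDensity g, max (A11const (m+1) w).toReal 1, le_max_right _ _, hν, ?_, ?_⟩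
  · intro I hI
    have hQ : A11const (m+1) w ≤ ENNReal.ofReal (max (A11const (m+1) w).toReal 1) := by
      rw [← ENNReal.ofReal_toReal hAP]
      apply ENNReal.ofReal_le_ofReal
      rw [ENNReal.ofReal_toReal hAP]; exact le_max_left _ _
    set Q := ENNReal.ofReal (max (A11const (m+1) w).toReal 1) with hQd
    have h1 : avgE (fun x => ∏ i, w i x ^ ((1 : ℝ) / (m+1))) I.1 I.2 * (PI w I)⁻¹ ≤ Q := by
      refine le_trans ?_ hQ
      unfold A11const
      refine le_trans (le_of_eq ?_) (le_iSup₂_of_le I.1 I.2 (le_iSup_of_le hI le_rfl))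
      push_cast
      congr 1
      unfold PI
      rw [ENNReal.prod_inv_distrib]
      · refine Finset.prod_congr rfl (fun i _ => ?_)
        rw [ENNReal.inv_rpow]; rfl
      · intro i _ j _ _
        right
        exact ENNReal.rpow_ne_top_of_nonneg (by positivity) ENNReal.ofReal_ne_top
    rw [hν]
    have h2 : ∫⁻ x in ivl I, ENNReal.ofReal (∏ i, w i x ^ ((1 : ℝ) / (m + 1))) = ENNReal.ofReal (I.2 - I.1) * avgE (fun x => ∏ i, w i x ^ ((1 : ℝ) / (m+1))) I.1 I.2 := by
      unfold avgE ivl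
      rw [← mul_assoc, ENNReal.mul_inv_cancel (by simpa using hI) ENNReal.ofReal_ne_top, one_mul]
    rw [h2]
    rw [← div_eq_mul_inv] at h1
    have h3 : avgE (fun x => ∏ i, w i x ^ ((1 : ℝ) / (m+1))) I.1 I.2 ≤ Q * PI w I := by
      by_cases hP : PI w I = 0
      · rw [hP] at h1 ⊢
        by_contra hc
        push Not at hc
        rw [ENNReal.div_zero (by rintro h; rw [h] at hc; simp at hc)] at h1
        exact absurd h1 (by simp [hQd])
      · exact (ENNReal.div_le_iff_le_mul (Or.inl hP) (Or.inl (PI_ne_top w I))).1 h1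
    calc _ ≤ ENNReal.ofReal (I.2 - I.1) * (Q * PI w I) := mul_le_mul_right h3 _
      _ = _ := by ring
  · intro I s hs
    rw [hν, ← setLIntegral_const]
    refine lintegral_mono_ae ?_
    have h : ∀ i, ∀ᵐ x ∂(volume.restrict s), eI w i I ≤ ENNReal.ofReal (w i x) := fun i =>
      ae_restrict_of_ae_restrict_of_subset hs (eI_ae hw i I)
    filter_upwards [ae_all_iff.2 h] with x hx
    unfold PI
    rw [ENNReal.ofReal_prod_of_nonneg (fun i _ => Real.rpow_nonneg (hw i x) _)]
    refine Finset.prod_le_prod' (fun i _ => ?_)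
    rw [← ENNReal.ofReal_rpow_of_nonneg (hw i x) (by positivity)]
    exact ENNReal.rpow_le_rpow (hx i) (by positivity)

lemma W3 {m : ℕ} {w : Fin (m + 1) → ℝ → ℝ} {ν : Measure ℝ} {Q : ℝ} (hQ : 1 ≤ Q)
    (h1 : ∀ I : ℝ × ℝ, I.1 < I.2 → ν (ivl I) ≤ ENNReal.ofReal Q * ENNReal.ofReal (I.2 - I.1) * PI w I)
    (h2 : ∀ (I : ℝ × ℝ) (s : Set ℝ), s ⊆ ivl I → PI w I * volume s ≤ ν s) 
    (I : ℝ × ℝ) (S : Set ℝ) (hI : I.1 < I.2) (hS : S ⊆ ivl I) (hv : volume S ≤ ENNReal.ofReal ((I.2 - I.1) / 2)) :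
    ν S ≤ ENNReal.ofReal (1 - 1 / (2 * Q)) * ν (ivl I) := by
  have hfin : ν (ivl I) ≠ ⊤ := ne_top_of_le_ne_top (ENNReal.mul_ne_top (ENNReal.mul_ne_top ENNReal.ofReal_ne_top ENNReal.ofReal_ne_top) (PI_ne_top w I)) (h1 I hI)
  set S' := toMeasurable volume S ∩ ivl I with hS'
  have hS'm : MeasurableSet S' := (measurableSet_toMeasurable _ _).inter (measurableSet_ivl I)
  have hSS' : S ⊆ S' := subset_inter (subset_toMeasurable _ _) hS
  have hv' : volume S' ≤ ENNReal.ofReal ((I.2 - I.1) / 2) := (measure_mono inter_subset_left).trans (by rwa [measure_toMeasurable])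
  have hd : ν S' + ν (ivl I \ S') = ν (ivl I) := by
    have := measure_inter_add_sdiff (μ := ν) (ivl I) hS'm
    rwa [inter_eq_self_of_subset_right (inter_subset_right : S' ⊆ ivl I)] at this
  have hdv : ENNReal.ofReal ((I.2 - I.1) / 2) ≤ volume (ivl I \ S') := by
    have := measure_inter_add_sdiff (μ := volume) (ivl I) hS'm
    rw [inter_eq_self_of_subset_right (inter_subset_right : S' ⊆ ivl I), volume_ivl] at this
    have h3 : ENNReal.ofReal (I.2 - I.1) = ENNReal.ofReal ((I.2 - I.1) / 2) + ENNReal.ofReal ((I.2 - I.1) / 2) := by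
      rw [← ENNReal.ofReal_add (by linarith) (by linarith)]; congr 1; ring
    rw [h3] at this
    have h4 : ENNReal.ofReal ((I.2 - I.1) / 2) + ENNReal.ofReal ((I.2 - I.1) / 2) ≤ ENNReal.ofReal ((I.2 - I.1) / 2) + volume (ivl I \ S') := by
      rw [← this]; gcongr
    exact (ENNReal.add_le_add_iff_left ENNReal.ofReal_ne_top).1 h4
  have hlow : ν (ivl I) ≤ ENNReal.ofReal (2 * Q) * ν (ivl I \ S') := by
    calc ν (ivl I) ≤ ENNReal.ofReal Q * ENNReal.ofReal (I.2 - I.1) * PI w I := h1 I hI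
      _ = ENNReal.ofReal (2 * Q) * (PI w I * ENNReal.ofReal ((I.2 - I.1) / 2)) := by
        rw [mul_comm (PI w I), ← mul_assoc, ← ENNReal.ofReal_mul (by linarith), ← ENNReal.ofReal_mul (by linarith)]
        congr 2; ring
      _ ≤ ENNReal.ofReal (2 * Q) * (PI w I * volume (ivl I \ S')) := by gcongr
      _ ≤ _ := mul_le_mul_right (h2 I _ sdiff_subset) _
  have f1 : ν S' ≠ ⊤ := ne_top_of_le_ne_top hfin (hd ▸ le_self_add)
  have f2 : ν (ivl I \ S') ≠ ⊤ := ne_top_of_le_ne_top hfin (hd ▸ le_add_self)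
  refine (measure_mono hSS').trans ?_
  have hq : 1 / (2 * Q) ≤ 1 := by rw [div_le_one (by linarith)]; linarith
  rw [← ENNReal.ofReal_toReal f1, ← ENNReal.ofReal_toReal hfin, ← ENNReal.ofReal_mul (by linarith)]
  apply ENNReal.ofReal_le_ofReal
  have hlow' : (ν (ivl I)).toReal ≤ 2 * Q * (ν (ivl I \ S')).toReal := by
    have := ENNReal.toReal_mono (ENNReal.mul_ne_top ENNReal.ofReal_ne_top f2) hlow
    rwa [ENNReal.toReal_mul, ENNReal.toReal_ofReal (by linarith)] at this
  have hd' : (ν S').toReal + (ν (ivl I \ S')).toReal = (ν (ivl I)).toReal := by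
    rw [← ENNReal.toReal_add f1 f2, hd]
  have : 1 / (2 * Q) * (ν (ivl I)).toReal ≤ (ν (ivl I \ S')).toReal := by
    rw [div_mul_eq_mul_div, one_mul, div_le_iff₀ (by linarith)]; linarith
  linarith

lemma exists_M {Q : ℝ} (hQ : 1 ≤ Q) : ∃ M : ℕ, ENNReal.ofReal (1 - 1 / (2 * Q)) ^ M ≤ 8⁻¹ := by
  have h1 : (0:ℝ) < 1 / (2 * Q) := by positivity
  have h2 : 1 / (2 * Q) ≤ 1 := by rw [div_le_one (by linarith)]; linarith
  obtain ⟨M, hM⟩ := exists_pow_lt_of_lt_one (show (0:ℝ) < 8⁻¹ by norm_num) (show 1 - 1 / (2 * Q) < 1 by linarith)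
  refine ⟨M, ?_⟩
  rw [← ENNReal.ofReal_pow (by linarith)]
  refine (ENNReal.ofReal_le_ofReal hM.le).trans ?_
  rw [ENNReal.ofReal_inv_of_pos (by norm_num)]; simp

lemma W4 {k : ℕ} {w : Fin k → ℝ → ℝ} (hw : ∀ i x, 0 ≤ w i x) (i : Fin k) (I : ℝ × ℝ) {X : Set ℝ} (hX : X ⊆ ivl I) (g : ℝ → ℝ) :
    eI w i I * ∫⁻ y in X, ENNReal.ofReal (Ph |g y|) ≤ ∫⁻ y in X, ENNReal.ofReal (Ph |g y| * w i y) := by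
  rw [← lintegral_const_mul' (eI w i I) _ (show eI w i I ≠ ⊤ from ENNReal.ofReal_ne_top)]
  refine lintegral_mono_ae ?_
  filter_upwards [ae_restrict_of_ae_restrict_of_subset hX (eI_ae hw i I)] with x hx
  rw [ENNReal.ofReal_mul (Ph_nonneg (abs_nonneg _)), mul_comm]
  exact mul_le_mul_right hx _

lemma holder_sum {ι : Type} {m : ℕ} (G : Fin (m + 1) → ι → ℝ≥0∞) :
    ∑' s, ∏ i, G i s ^ ((1:ℝ) / (m + 1)) ≤ ∏ i, (∑' s, G i s) ^ ((1:ℝ) / (m + 1)) := by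
  letI : MeasurableSpace ι := ⊤
  have h := ENNReal.lintegral_prod_norm_pow_le (μ := (Measure.count : Measure ι)) (Finset.univ : Finset (Fin (m+1))) (f := G)
    (fun i _ => measurable_from_top.aemeasurable) (p := fun _ => (1:ℝ) / (m + 1)) (by
      simp only [Finset.sum_const, Finset.card_univ, Fintype.card_fin, nsmul_eq_mul]
      push_cast; field_simp) (fun i _ => by positivity)
  simpa only [lintegral_count] using h

lemma level_nu {m : ℕ} {w : Fin (m + 1) → ℝ → ℝ} (hw : ∀ i x, 0 ≤ w i x) {ν : Measure ℝ} {Q : ℝ} (hQ : 1 ≤ Q)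
    (h1 : ∀ I : ℝ × ℝ, I.1 < I.2 → ν (ivl I) ≤ ENNReal.ofReal Q * ENNReal.ofReal (I.2 - I.1) * PI w I)
    (g : Fin (m + 1) → ℝ → ℝ) {c : ℝ} (hc : 1 ≤ c) (p : ℝ × ℝ) (hp : p.1 < p.2)
    (hl : ENNReal.ofReal (p.2 - p.1) ^ (m + 1) ≤ ENNReal.ofReal c * ∏ i, ∫⁻ y in ivl p, ENNReal.ofReal (Ph |g i y|)) :
    ν (ivl (p.1 - 3 * (p.2 - p.1), p.2 + 3 * (p.2 - p.1))) ≤ ENNReal.ofReal (7 * Q * c) *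
      ∏ i, (∫⁻ y in ivl p, ENNReal.ofReal (Ph |g i y| * w i y)) ^ ((1:ℝ) / (m + 1)) := by
  set Y : ℝ × ℝ := (p.1 - 3 * (p.2 - p.1), p.2 + 3 * (p.2 - p.1)) with hY
  have hY1 : Y.1 < Y.2 := by simp only [hY]; linarith
  have hk : (0:ℝ) ≤ 1 / (m + 1) := by positivity
  have hXY : ivl p ⊆ ivl Y := by
    intro x hx; simp only [ivl, mem_Ioc, hY] at hx ⊢; constructor <;> linarith [hx.1, hx.2]
  have hl' : ENNReal.ofReal (p.2 - p.1) ≤ ENNReal.ofReal c * ∏ i, (∫⁻ y in ivl p, ENNReal.ofReal (Ph |g i y|)) ^ ((1:ℝ) / (m + 1)) := by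
    have h := ENNReal.rpow_le_rpow hl hk
    rw [← ENNReal.rpow_natCast, ← ENNReal.rpow_mul] at h
    have e1 : ((m + 1 : ℕ) : ℝ) * (1 / (m + 1)) = 1 := by push_cast; field_simp
    rw [e1, ENNReal.rpow_one, ENNReal.mul_rpow_of_nonneg _ _ hk, ← ENNReal.prod_rpow_of_nonneg hk] at h
    refine h.trans (mul_le_mul_left ?_ _)
    have hc1 : (1:ℝ≥0∞) ≤ ENNReal.ofReal c := by simpa using ENNReal.ofReal_le_ofReal hc
    calc _ ≤ ENNReal.ofReal c ^ (1:ℝ) := ENNReal.rpow_le_rpow_of_exponent_le hc1 (by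
          rw [div_le_one (by positivity)]; have : (0:ℝ) ≤ m := Nat.cast_nonneg _
          linarith)
      _ = _ := by simp
  calc ν (ivl Y) ≤ ENNReal.ofReal Q * ENNReal.ofReal (Y.2 - Y.1) * PI w Y := h1 Y hY1
    _ = ENNReal.ofReal (7 * Q) * ENNReal.ofReal (p.2 - p.1) * PI w Y := by
      rw [← ENNReal.ofReal_mul (by linarith), ← ENNReal.ofReal_mul (by linarith)]
      congr 2; simp only [hY]; ring
    _ ≤ ENNReal.ofReal (7 * Q) * (ENNReal.ofReal c * ∏ i, (∫⁻ y in ivl p, ENNReal.ofReal (Ph |g i y|)) ^ ((1:ℝ) / (m + 1))) * PI w Y := by gcongr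
    _ = ENNReal.ofReal (7 * Q * c) * ∏ i, (eI w i Y * ∫⁻ y in ivl p, ENNReal.ofReal (Ph |g i y|)) ^ ((1:ℝ) / (m + 1)) := by
      rw [ENNReal.ofReal_mul (by linarith : 0 ≤ 7 * Q)]
      simp only [ENNReal.mul_rpow_of_nonneg _ _ hk, Finset.prod_mul_distrib, PI]
      ring
    _ ≤ _ := by
      refine mul_le_mul_right (Finset.prod_le_prod' (fun i _ => ENNReal.rpow_le_rpow ?_ hk)) _
      exact W4 hw i Y hXY (g i)

lemma omega_nu {m : ℕ} {w : Fin (m + 1) → ℝ → ℝ} (hw : ∀ i x, 0 ≤ w i x) {ν : Measure ℝ} {Q : ℝ} (hQ : 1 ≤ Q)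
    (h1 : ∀ I : ℝ × ℝ, I.1 < I.2 → ν (ivl I) ≤ ENNReal.ofReal Q * ENNReal.ofReal (I.2 - I.1) * PI w I)
    (g : Fin (m + 1) → ℝ → ℝ) {c : ℝ} (hc : 1 ≤ c) (T : Set (ℝ × ℝ)) (I0 : ℝ × ℝ) 
    (hT : ∀ K ∈ T, K.1 < K.2 ∧ ivl K ⊆ ivl I0)
    (hl : ∀ K ∈ T, ENNReal.ofReal (hi K - lo K) ^ (m + 1) ≤ ENNReal.ofReal c * ∏ i, ∫⁻ y in Ioc (lo K) (hi K), ENNReal.ofReal (Ph |g i y|)) :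
    ν (⋃ K ∈ T, ivl K) ≤ ENNReal.ofReal (7 * Q * c) *
      ∏ i, (∫⁻ y, ENNReal.ofReal (Ph |g i y| * w i y)) ^ ((1:ℝ) / (m + 1)) := by
  have hlen : ∀ K ∈ T, K.2 - K.1 ≤ I0.2 - I0.1 := by
    intro K hK
    obtain ⟨h2, h3⟩ := hT K hK
    have := (Ioc_subset_Ioc_iff h2).1 h3
    linarith [this.1, this.2]
  obtain ⟨u, hut, huc, hud, hcov⟩ := vitali_intervals ((fun K => (lo K, hi K)) '' T) (3 * (I0.2 - I0.1)) (by
      rintro p ⟨K, hK, rfl⟩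
      have := (hT K hK).1
      simp only [lo, hi]; linarith) (by
      rintro p ⟨K, hK, rfl⟩
      have := hlen K hK
      simp only [lo, hi]; linarith)
  have hsub : (⋃ K ∈ T, ivl K) ⊆ ⋃ b ∈ u, ivl (b.1 - 3 * (b.2 - b.1), b.2 + 3 * (b.2 - b.1)) := by
    refine iUnion₂_subset (fun K hK x hx => ?_)
    obtain ⟨b, hb, hsb⟩ := hcov _ (mem_image_of_mem _ hK)
    have hK1 := (hT K hK).1
    have hb1 : b.1 < b.2 := by
      obtain ⟨K', hK', rfl⟩ := hut hb
      have := (hT K' hK').1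
      simp only [lo, hi]; linarith
    have hx' := hsb (show x ∈ Icc (lo K) (hi K) by
      simp only [ivl, mem_Ioc] at hx; simp only [lo, hi, mem_Icc]; constructor <;> linarith [hx.1, hx.2])
    refine mem_iUnion₂.2 ⟨b, hb, ?_⟩
    simp only [ivl, mem_Ioc]; constructor <;> linarith [hx'.1, hx'.2]
  have hk : (0:ℝ) ≤ 1 / (m + 1) := by positivity
  calc ν (⋃ K ∈ T, ivl K) ≤ ν (⋃ b ∈ u, ivl (b.1 - 3 * (b.2 - b.1), b.2 + 3 * (b.2 - b.1))) := measure_mono hsub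
    _ ≤ ∑' b : u, ν (ivl (b.1.1 - 3 * (b.1.2 - b.1.1), b.1.2 + 3 * (b.1.2 - b.1.1))) := measure_biUnion_le _ huc _
    _ ≤ ∑' b : u, ENNReal.ofReal (7 * Q * c) * ∏ i, (∫⁻ y in ivl b.1, ENNReal.ofReal (Ph |g i y| * w i y)) ^ ((1:ℝ) / (m + 1)) := by
      refine ENNReal.tsum_le_tsum (fun b => ?_)
      obtain ⟨K, hK, hKb⟩ := hut b.2
      have hK1 := (hT K hK).1
      refine level_nu hw hQ h1 g hc b.1 ?_ ?_
      · rw [← hKb]; simp only [lo, hi]; linarith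
      · rw [← hKb]; exact hl K hK
    _ = ENNReal.ofReal (7 * Q * c) * ∑' b : u, ∏ i, (∫⁻ y in ivl b.1, ENNReal.ofReal (Ph |g i y| * w i y)) ^ ((1:ℝ) / (m + 1)) := ENNReal.tsum_mul_left
    _ ≤ ENNReal.ofReal (7 * Q * c) * ∏ i, (∑' b : u, ∫⁻ y in ivl b.1, ENNReal.ofReal (Ph |g i y| * w i y)) ^ ((1:ℝ) / (m + 1)) :=
      mul_le_mul_right (holder_sum (fun i (b : u) => ∫⁻ y in ivl b.1, ENNReal.ofReal (Ph |g i y| * w i y))) _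
    _ ≤ _ := by
      refine mul_le_mul_right (Finset.prod_le_prod' (fun i _ => ENNReal.rpow_le_rpow ?_ hk)) _
      rw [← lintegral_biUnion huc (fun b _ => measurableSet_ivl b) (hud.mono (fun b => Ioc_subset_Icc_self))]
      exact setLIntegral_le_lintegral _ _

theorem weak_A {m : ℕ} {w : Fin (m + 1) → ℝ → ℝ} (hw : ∀ i x, 0 ≤ w i x) (hAP : A11const (m + 1) w ≠ ⊤) :
    ∃ (ν : Measure ℝ) (C : ℝ), 0 < C ∧ 
      (∃ Q : ℝ, ∀ I : ℝ × ℝ, I.1 < I.2 → ν (ivl I) ≤ ENNReal.ofReal Q * ENNReal.ofReal (I.2 - I.1) * PI w I) ∧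
      (∀ s, ν s = ∫⁻ x in s, ENNReal.ofReal (∏ i, w i x ^ ((1 : ℝ) / (m + 1)))) ∧
      ∀ A b : ℝ → ℝ, (∀ x y, A x - A y = Adiff b x y) → Measurable b → LocallyIntegrable b → 
      (∀ u v, u < v → ∫ y in Ioc u v, |b y - av b u v| ≤ v - u) → 
      ∀ (a : Fin m → ℝ → ℝ) (f : ℝ → ℝ), (∀ j, LocallyIntegrable (a j)) → LocallyIntegrable f → LocallyIntegrable (fun y => b y * f y) →
      ∀ (I0 : ℝ × ℝ), I0.1 < I0.2 → (∀ y, y ∉ ivl I0 → f y = 0) → ∀ e : ℝ, 0 < e → 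
      ν (ivl I0 ∩ {x | 1 < |∫ y in {y | e < |x - y|}, kA m A b a x y * f y|}) ≤ ENNReal.ofReal C * 
        ((∏ j : Fin m, (∫⁻ y, ENNReal.ofReal (Ph |a j y| * w j.castSucc y)) ^ ((1:ℝ) / (m + 1))) * 
          (∫⁻ y, ENNReal.ofReal (Ph |f y| * w (Fin.last m) y)) ^ ((1:ℝ) / (m + 1))) := by
  obtain ⟨ν, Q, hQ, hν, h1, h2⟩ := W_exists hw hAP
  obtain ⟨Cl, hCl, HL⟩ := level_claim m
  obtain ⟨Λ, hΛ, HS⟩ := step_A m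
  obtain ⟨M, hM⟩ := exists_M hQ
  set κ : ℝ := min 1 (1 / (Λ * (1 + 4 * M))) with hκ
  have hM0 : (0:ℝ) ≤ M := Nat.cast_nonneg _
  have hκ0 : 0 < κ := by
    have : 0 < Λ * (1 + 4 * M) := by positivity
    exact lt_min one_pos (by positivity)
  have hκ2 : Λ * (κ + 4 * M * κ) ≤ 1 := by
    have : 0 < Λ * (1 + 4 * M) := by positivity
    have h3 := min_le_right 1 (1 / (Λ * (1 + 4 * M)))
    rw [← hκ, le_div_iff₀ this] at h3
    linarith
  refine ⟨ν, 2 * (κ ^ 2)⁻¹ * (7 * Q * Cl), by positivity, ⟨Q, h1⟩, hν, ?_⟩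
  intro A b hAb hbm hb hosc a f ha hf hbf I0 hI0 hsupp e he
  obtain ⟨E, hE, hP⟩ := HS A b hAb hb hosc a f ha hf hbf e he
  set g : Fin (m + 1) → ℝ → ℝ := Fin.snoc (α := fun _ => ℝ → ℝ) a f with hg
  set Z := ∏ i, (∫⁻ y, ENNReal.ofReal (Ph |g i y| * w i y)) ^ ((1:ℝ) / (m + 1)) with hZ
  have hZe : Z = ((∏ j : Fin m, (∫⁻ y, ENNReal.ofReal (Ph |a j y| * w j.castSucc y)) ^ ((1:ℝ) / (m + 1))) * 
          (∫⁻ y, ENNReal.ofReal (Ph |f y| * w (Fin.last m) y)) ^ ((1:ℝ) / (m + 1))) := by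
    rw [hZ, Fin.prod_univ_castSucc]
    simp only [hg, Fin.snoc_castSucc, Fin.snoc_last]
  have hmu : ∀ K, 0 ≤ muA m b a f K := by
    intro K
    unfold muA
    have hav : ∀ g : ℝ → ℝ, (∀ y, 0 ≤ g y) → 0 ≤ av g (lo K) (hi K) := by
      intro g hg0
      by_cases hK : lo K ≤ hi K
      · exact av_nonneg hg0 hK
      · unfold av; rw [Ioc_eq_empty (fun h => hK h.le)]; simp
    exact mul_nonneg (Finset.prod_nonneg (fun j _ => hav _ (fun y => abs_nonneg _))) 
      (add_nonneg (hav _ (fun y => abs_nonneg _)) (hav _ (fun y => mul_nonneg (abs_nonneg _) (abs_nonneg _))))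
  have hmain := sparse_main (ν := ν) hE (W3 hQ h1 h2) hP hΛ (half_pos he) (by
      intro x J hJ hx hd
      have : {y | e < |x - y|} ∩ Ioc (lo J) (hi J) = ∅ := by
        ext y
        simp only [ivl, mem_Ioc, mem_inter_iff, mem_ofPred_eq, lo, hi, mem_empty_iff_false, iff_false, not_and] at hx ⊢
        intro h3 h4 h6
        rcases abs_cases (x - y) with h5 | h5 <;> linarith [hx.1, hx.2]
      unfold PsiA
      rw [this]; simp) hmu hM hI0 (R := ENNReal.ofReal (7 * Q * Cl) * Z) (by
      intro τ hτ hτ1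
      have hc : 1 ≤ Cl * (τ ^ 2)⁻¹ := one_le_mul_of_one_le_of_one_le hCl ((one_le_inv₀ (by positivity)).2 (pow_le_one₀ hτ.le hτ1))
      refine (omega_nu hw hQ h1 g hc _ I0 (fun K hK => ⟨hK.1, hK.2.1⟩) ?_).trans (le_of_eq ?_)
      · intro K hK
        refine (HL b hbm hb hosc a f τ hτ hτ1 K hK.1 hK.2.2).trans (le_of_eq ?_)
        rw [Fin.prod_univ_castSucc]
        simp only [hg, Fin.snoc_castSucc, Fin.snoc_last]
      · rw [← hZ, ← mul_assoc (ENNReal.ofReal _) (ENNReal.ofReal _) Z, ← ENNReal.ofReal_mul (by positivity)]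
        congr 2; ring) hκ0 (min_le_left _ _) hκ2
  have hset : ∀ x ∈ ivl I0, (∫ y in {y | e < |x - y|}, kA m A b a x y * f y) = ∫ y in {y | e < |x - y|} ∩ Ioc (lo I0) (hi I0), kA m A b a x y * f y := by
    intro x _
    rw [← setIntegral_eq_of_subset_of_forall_sdiff_eq_zero (measurableSet_trunc e x) inter_subset_left]
    intro y hy
    have : y ∉ ivl I0 := by
      intro h3
      refine hy.2 ⟨hy.1, ?_⟩
      simp only [ivl, mem_Ioc] at h3; simp only [lo, hi, mem_Ioc]; constructor <;> linarith [h3.1, h3.2]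
    rw [hsupp y this, mul_zero]
  have hseq : ivl I0 ∩ {x | 1 < |∫ y in {y | e < |x - y|}, kA m A b a x y * f y|} = ivl I0 ∩ {x | 1 < PsiA m A b a f e I0 x} := by
    ext x
    simp only [mem_inter_iff, mem_ofPred_eq, PsiA]
    constructor
    · rintro ⟨h3, h4⟩; exact ⟨h3, by rwa [← hset x h3]⟩
    · rintro ⟨h3, h4⟩; exact ⟨h3, by rwa [hset x h3]⟩
  rw [hseq, ← hZe]
  refine hmain.trans (le_of_eq ?_)
  rw [← mul_assoc, ENNReal.ofReal_mul (by positivity : 0 ≤ 2 * (κ ^ 2)⁻¹), ENNReal.ofReal_mul (by norm_num : (0:ℝ) ≤ 2)]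
  simp

lemma kA_split {m : ℕ} {A b : ℝ → ℝ} (hAb : ∀ x y, A x - A y = Adiff b x y) (hb : LocallyIntegrable b) {a : Fin m → ℝ → ℝ} {f : ℝ → ℝ} 
    {p q : ℝ} (hs : ∀ y, y ∉ Ioc p q → f y = 0) {x : ℝ} (hx : x ∈ Ioc p q) (y : ℝ) :
    kA m A b a x y * f y = Kq (m + 1) (Fin.cons ((Ioc p q).indicator b) fun j => (Ioc p q).indicator (a j)) x y * (Ioc p q).indicator f y - 
      Kq m (fun j => (Ioc p q).indicator (a j)) x y * (Ioc p q).indicator (fun y => b y * f y) y := by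
  by_cases hy : y ∈ Ioc p q
  · have := kA_eq hAb hb a f 0 hx hy
    simpa only [sub_zero] using this
  · rw [indicator_of_notMem hy, indicator_of_notMem hy, hs y hy]; ring

lemma lim_exists {m : ℕ} {A b : ℝ → ℝ} (hAb : ∀ x y, A x - A y = Adiff b x y) (hb : LocallyIntegrable b) {a : Fin m → ℝ → ℝ} {f : ℝ → ℝ} 
    (ha : ∀ j, LocallyIntegrable (a j)) (hf : LocallyIntegrable f) (hbf : LocallyIntegrable fun y => b y * f y) 
    {p q : ℝ} (hpq : p < q) (hs : ∀ y, y ∉ Ioc p q → f y = 0) :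
    ∀ᵐ x, x ∈ Ioc p q → ∃ l, Tendsto (fun e => ∫ y in {y | e < |x - y|}, kA m A b a x y * f y) (nhdsWithin 0 (Ioi 0)) (nhds l) := by
  have hI : ∀ {g : ℝ → ℝ}, LocallyIntegrable g → Integrable ((Ioc p q).indicator g) := fun hg =>
    (integrable_indicator_iff measurableSet_Ioc).2 (locInt_Ioc hg p q)
  have ha1 : ∀ j : Fin (m + 1), Integrable ((Fin.cons ((Ioc p q).indicator b) fun j => (Ioc p q).indicator (a j) : Fin (m+1) → ℝ → ℝ) j) := by
    intro j
    refine Fin.cases ?_ (fun j => ?_) j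
    · simpa using hI hb
    · simpa using hI (ha j)
  have ha2 : ∀ j, Integrable ((fun j => (Ioc p q).indicator (a j)) j) := fun j => hI (ha j)
  filter_upwards [conv_ae ha1 (hI hf) hpq (fun y hy => indicator_of_notMem hy _), conv_ae ha2 (hI hbf) hpq (fun y hy => indicator_of_notMem hy _)] with x h1 h2 hx
  obtain ⟨l1, h1⟩ := h1 (Ioc_subset_Icc_self hx)
  obtain ⟨l2, h2⟩ := h2 (Ioc_subset_Icc_self hx)
  refine ⟨l1 - l2, (h1.sub h2).congr' ?_⟩
  filter_upwards [self_mem_nhdsWithin] with e he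
  rw [funext (kA_split hAb hb hs hx)]
  exact (integral_sub (Tr_integrable ha1 (hI hf) he x) (Tr_integrable ha2 (hI hbf) he x)).symm

def GG (m : ℕ) (A b : ℝ → ℝ) (a : Fin m → ℝ → ℝ) (f : ℝ → ℝ) : Set ℝ :=
  {x | (∀ e : ℝ, 0 < e → IntegrableOn (fun y => kA m A b a x y * f y) {y | e < |x - y|}) ∧
    ∀ l, Tendsto (fun e : ℝ => ∫ y in {y | e < |x - y|}, kA m A b a x y * f y) (nhdsWithin 0 (Ioi 0)) (nhds l) → 1 < |l|}

lemma set_fatou {ν : Measure ℝ} {S : ℕ → Set ℝ} {B : ℝ≥0∞} (hS : ∀ n, ν (S n) ≤ B) {T : Set ℝ} (hT : ∀ x ∈ T, ∃ N, ∀ n ≥ N, x ∈ S n) : ν T ≤ B := by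
  have hmono : Monotone (fun N => ⋂ n ≥ N, S n) := by
    intro i j hij x hx
    simp only [mem_iInter] at hx ⊢
    exact fun n hn => hx n (hij.trans hn)
  have hsub : T ⊆ ⋃ N, ⋂ n ≥ N, S n := by
    intro x hx
    obtain ⟨N, hN⟩ := hT x hx
    simp only [mem_iUnion, mem_iInter]
    exact ⟨N, hN⟩
  refine (measure_mono hsub).trans ?_
  rw [hmono.measure_iUnion]
  exact iSup_le (fun N => (measure_mono (iInter₂_subset N le_rfl)).trans (hS N))

noncomputable def RR {m : ℕ} (w : Fin (m + 1) → ℝ → ℝ) (a : Fin m → ℝ → ℝ) (f : ℝ → ℝ) : ℝ≥0∞ :=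
  (∏ j : Fin m, (∫⁻ y, ENNReal.ofReal (Ph |a j y| * w j.castSucc y)) ^ ((1:ℝ) / (m + 1))) * 
          (∫⁻ y, ENNReal.ofReal (Ph |f y| * w (Fin.last m) y)) ^ ((1:ℝ) / (m + 1))

lemma Ph_mono {s t : ℝ} (hs : 0 ≤ s) (h : s ≤ t) : Ph s ≤ Ph t := by
  unfold Ph
  have := Real.exp_pos 1
  exact mul_le_mul h (Real.log_le_log (by linarith) (by linarith)) (zero_le_one.trans (log_e_ge hs)) (hs.trans h)

lemma Ph_ind_le (s : Set ℝ) (f : ℝ → ℝ) (y : ℝ) : Ph |s.indicator f y| ≤ Ph |f y| := by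
  refine Ph_mono (abs_nonneg _) ?_
  by_cases hy : y ∈ s
  · rw [indicator_of_mem hy]
  · rw [indicator_of_notMem hy]; simp

lemma RR_ind {m : ℕ} {w : Fin (m + 1) → ℝ → ℝ} (hw : ∀ i x, 0 ≤ w i x) (a : Fin m → ℝ → ℝ) (f : ℝ → ℝ) (s : Set ℝ) : RR w a (s.indicator f) ≤ RR w a f := by
  unfold RR
  refine mul_le_mul_right (ENNReal.rpow_le_rpow (lintegral_mono (fun y => ?_)) (by positivity)) _
  exact ENNReal.ofReal_le_ofReal (mul_le_mul_of_nonneg_right (Ph_ind_le s f y) (hw _ _))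

/-- The properties of the measure used later on. -/
def WeakProp {m : ℕ} (w : Fin (m + 1) → ℝ → ℝ) (ν : Measure ℝ) (C : ℝ) (A b : ℝ → ℝ) : Prop :=
  (∀ (a : Fin m → ℝ → ℝ) (f : ℝ → ℝ), (∀ j, LocallyIntegrable (a j)) → LocallyIntegrable f → LocallyIntegrable (fun y => b y * f y) →
      ∀ (I0 : ℝ × ℝ), I0.1 < I0.2 → (∀ y, y ∉ ivl I0 → f y = 0) → ∀ e : ℝ, 0 < e → 
      ν (ivl I0 ∩ {x | 1 < |∫ y in {y | e < |x - y|}, kA m A b a x y * f y|}) ≤ ENNReal.ofReal C * RR w a f)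

lemma GG_loc {m : ℕ} {w : Fin (m + 1) → ℝ → ℝ} (hw : ∀ i x, 0 ≤ w i x) {ν : Measure ℝ} (hν : ν ≪ volume) {C : ℝ} {A b : ℝ → ℝ} (hW : WeakProp w ν C A b)
    (hAb : ∀ x y, A x - A y = Adiff b x y) (hb : LocallyIntegrable b) {a : Fin m → ℝ → ℝ} {f : ℝ → ℝ} 
    (ha : ∀ j, LocallyIntegrable (a j)) (hf : LocallyIntegrable f) (hbf : LocallyIntegrable fun y => b y * f y) :
    ν (GG m A b a f) ≤ ENNReal.ofReal C * RR w a f := by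
  set IN : ℕ → Set ℝ := fun N => Ioc (-((N:ℝ) + 1)) ((N:ℝ) + 1) with hIN
  set F : ℕ → ℝ → ℝ := fun N => (IN N).indicator f with hF
  set T : ℕ → ℝ → ℝ → ℝ := fun N x e => ∫ y in {y | e < |x - y|}, kA m A b a x y * F N y with hT
  have hI : ∀ N, MeasurableSet (IN N) := fun N => measurableSet_Ioc
  have hN0 : ∀ N : ℕ, -((N:ℝ) + 1) < (N:ℝ) + 1 := fun N => by have : (0:ℝ) ≤ N := Nat.cast_nonneg _
                                                              linarith
  have hFl : ∀ N, LocallyIntegrable (F N) := fun N => hf.indicator (hI N)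
  have hbFl : ∀ N, LocallyIntegrable fun y => b y * F N y := by
    intro N
    have : (fun y => b y * F N y) = (IN N).indicator fun y => b y * f y := by
      funext y
      by_cases hy : y ∈ IN N
      · simp only [hF, indicator_of_mem hy]
      · simp only [hF, indicator_of_notMem hy, mul_zero]
    rw [this]
    exact hbf.indicator (hI N)
  have hFs : ∀ N, ∀ y, y ∉ IN N → F N y = 0 := fun N y hy => indicator_of_notMem hy _
  have hnull : ∀ᵐ x, ∀ N, x ∈ IN N → ∃ l, Tendsto (T N x) (nhdsWithin 0 (Ioi 0)) (nhds l) :=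
    ae_all_iff.2 (fun N => lim_exists hAb hb ha (hFl N) (hbFl N) (hN0 N) (hFs N))
  have hnull' : ν {x | ¬ ∀ N, x ∈ IN N → ∃ l, Tendsto (T N x) (nhdsWithin 0 (Ioi 0)) (nhds l)} = 0 := hν hnull
  set S : ℕ → Set ℝ := fun N => {x | x ∈ IN N ∧ ∃ l, Tendsto (T N x) (nhdsWithin 0 (Ioi 0)) (nhds l) ∧ 1 < |l|} with hS
  have hSN : ∀ N, ν (S N) ≤ ENNReal.ofReal C * RR w a f := by
    intro N
    refine set_fatou (S := fun n : ℕ => IN N ∩ {x | 1 < |T N x (1 / ((n:ℝ) + 1))|}) (fun n => ?_) ?_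
    · refine (hW a (F N) ha (hFl N) (hbFl N) (-((N:ℝ) + 1), (N:ℝ) + 1) (hN0 N) (hFs N) (1 / ((n:ℝ) + 1)) (by positivity)).trans ?_
      exact mul_le_mul_right (RR_ind hw a f _) _
    · rintro x ⟨hx, l, hl, hl1⟩
      have ht : Tendsto (fun n : ℕ => 1 / ((n:ℝ) + 1)) atTop (nhdsWithin 0 (Ioi 0)) := by
        refine tendsto_nhdsWithin_iff.2 ⟨tendsto_one_div_add_atTop_nhds_zero_nat, Eventually.of_forall (fun n => ?_)⟩
        simp only [mem_Ioi]; positivity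
      have h1 := ((hl.comp ht).abs).eventually (lt_mem_nhds hl1)
      obtain ⟨M, hM⟩ := eventually_atTop.1 h1
      exact ⟨M, fun n hn => ⟨hx, hM n hn⟩⟩
  rw [← measure_sdiff_null (s := GG m A b a f) hnull']
  refine set_fatou hSN ?_
  rintro x ⟨⟨hx1, hx2⟩, hx3⟩
  simp only [mem_ofPred_eq, not_not] at hx3
  -- splitting
  have hsplit : ∀ N : ℕ, |x| < N → ∀ e : ℝ, 0 < e → e < 1 → ∫ y in {y | e < |x - y|}, kA m A b a x y * f y = T N x e + ∫ y in {y | 1 < |x - y|} \ IN N, kA m A b a x y * f y := by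
    intro N hN e he he1
    rw [← integral_inter_add_sdiff (hI N) (hx1 e he)]
    congr 1
    · simp only [hT, hF]
      rw [← setIntegral_indicator (hI N)]
      refine setIntegral_congr_fun (measurableSet_trunc e x) (fun y _ => ?_)
      by_cases hy : y ∈ IN N
      · simp only [indicator_of_mem hy]
      · simp only [indicator_of_notMem hy, mul_zero]
    · congr 2
      ext y
      simp only [Set.mem_sdiff, mem_ofPred_eq, hIN, mem_Ioc]
      constructor
      · rintro ⟨h1, h2⟩
        refine ⟨?_, h2⟩
        by_contra h3
        push Not at h3
        have h4 := abs_lt.1 hN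
        have h5 := abs_le.1 h3
        exact h2 ⟨by linarith, by linarith⟩
      · rintro ⟨h1, h2⟩; exact ⟨by linarith, h2⟩
  have hxm : ∀ N : ℕ, |x| < N → x ∈ IN N := by
    intro N hN
    have h4 := abs_lt.1 hN
    simp only [hIN, mem_Ioc]; constructor <;> linarith
  have hev : ∀ᶠ e : ℝ in nhdsWithin 0 (Ioi 0), 0 < e ∧ e < 1 := by
    filter_upwards [self_mem_nhdsWithin, mem_nhdsWithin_of_mem_nhds (Iio_mem_nhds one_pos)] with e h1 h2
    exact ⟨h1, h2⟩
  obtain ⟨N0, hN0'⟩ := exists_nat_gt |x|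
  have hlimN : ∀ N : ℕ, N0 ≤ N → ∀ l', Tendsto (T N x) (nhdsWithin 0 (Ioi 0)) (nhds l') → 
      Tendsto (fun e : ℝ => ∫ y in {y | e < |x - y|}, kA m A b a x y * f y) (nhdsWithin 0 (Ioi 0)) (nhds (l' + ∫ y in {y | 1 < |x - y|} \ IN N, kA m A b a x y * f y)) := by
    intro N hN l' hl'
    have hN1 : |x| < N := hN0'.trans_le (by exact_mod_cast hN)
    refine (hl'.add_const _).congr' ?_
    filter_upwards [hev] with e he
    exact (hsplit N hN1 e he.1 he.2).symm
  obtain ⟨l0, hl0⟩ := hx3 N0 (hxm N0 hN0')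
  set l := l0 + ∫ y in {y | 1 < |x - y|} \ IN N0, kA m A b a x y * f y with hl
  have hlt := hlimN N0 le_rfl l0 hl0
  rw [← hl] at hlt
  have hl1 := hx2 l hlt
  have htail : Tendsto (fun N : ℕ => ∫ y in {y | 1 < |x - y|} \ IN N, kA m A b a x y * f y) atTop (nhds 0) := by
    have hanti : Antitone (fun N => {y | 1 < |x - y|} \ IN N) := by
      intro i j hij
      refine sdiff_subset_sdiff_right (Ioc_subset_Ioc ?_ ?_) <;> have : (i:ℝ) ≤ j := by exact_mod_cast hij
      · linarith
      · linarith
    have := tendsto_setIntegral_of_antitone (f := fun y => kA m A b a x y * f y) (μ := volume) (s := fun N => {y | 1 < |x - y|} \ IN N) (fun N => (measurableSet_trunc 1 x).diff (hI N)) hanti ⟨0, (hx1 1 one_pos).mono_set sdiff_subset⟩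
    have he : (⋂ N, {y | 1 < |x - y|} \ IN N) = ∅ := by
      rw [eq_empty_iff_forall_notMem]
      intro y hy
      obtain ⟨M, hM⟩ := exists_nat_gt |y|
      have h4 := abs_lt.1 hM
      refine (mem_iInter.1 hy M).2 ?_
      simp only [hIN, mem_Ioc]; constructor <;> linarith
    rw [he] at this
    simpa using this
  have h5 : Tendsto (fun N : ℕ => |l - ∫ y in {y | 1 < |x - y|} \ IN N, kA m A b a x y * f y|) atTop (nhds |l|) := by
    simpa using (tendsto_const_nhds.sub htail).abs
  obtain ⟨N1, hN1⟩ := eventually_atTop.1 (h5.eventually (lt_mem_nhds hl1))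
  refine ⟨max N0 N1, fun N hN => ?_⟩
  have hNx : |x| < N := hN0'.trans_le (by exact_mod_cast (le_max_left _ _).trans hN)
  refine ⟨hxm N hNx, ?_⟩
  obtain ⟨l', hl'⟩ := hx3 N (hxm N hNx)
  refine ⟨l', hl', ?_⟩
  have h6 := tendsto_nhds_unique (hlimN N ((le_max_left _ _).trans hN) l' hl') hlt
  have h7 := hN1 N ((le_max_right _ _).trans hN)
  rwa [← h6, add_sub_cancel_right] at h7

lemma max_meas (f : ℝ → ℝ) : ∃ E : Set ℝ, MeasurableSet E ∧ AEMeasurable f (volume.restrict E) ∧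
    ∀ D, MeasurableSet D → AEMeasurable f (volume.restrict D) → volume (D \ E) = 0 := by
  set μ : Measure ℝ := (volume : Measure ℝ).toFinite with hμ
  set F : Set ℝ≥0∞ := μ '' {D | MeasurableSet D ∧ AEMeasurable f (volume.restrict D)} with hF
  have hne : F.Nonempty := ⟨_, mem_image_of_mem _ (show (∅ : Set ℝ) ∈ {D | MeasurableSet D ∧ AEMeasurable f (volume.restrict D)} from ⟨MeasurableSet.empty, by simp⟩)⟩
  obtain ⟨u, _, hut, huF⟩ := exists_seq_tendsto_sSup hne (OrderTop.bddAbove F)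
  choose D hD hDu using huF
  have hEm : MeasurableSet (⋃ n, D n) := MeasurableSet.iUnion (fun n => (hD n).1)
  have hEa : AEMeasurable f (volume.restrict (⋃ n, D n)) := aemeasurable_iUnion_iff.2 (fun n => (hD n).2)
  refine ⟨⋃ n, D n, hEm, hEa, ?_⟩
  intro D' hD' hD'a
  have h1 : sSup F ≤ μ (⋃ n, D n) := by
    refine le_of_tendsto' hut (fun n => ?_)
    rw [← hDu n]
    exact measure_mono (subset_iUnion D n)
  have h2 : μ ((⋃ n, D n) ∪ D') ≤ sSup F := by
    refine le_sSup (mem_image_of_mem _ ⟨hEm.union hD', ?_⟩)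
    exact aemeasurable_union_iff.2 ⟨hEa, hD'a⟩
  have h3 : μ (D' \ ⋃ n, D n) = 0 := by
    have h4 : μ (⋃ n, D n) + μ (D' \ ⋃ n, D n) = μ ((⋃ n, D n) ∪ D') := by
      rw [← measure_union disjoint_sdiff_right (hD'.diff hEm), union_sdiff_self]
    have h5 : μ (⋃ n, D n) + μ (D' \ ⋃ n, D n) ≤ μ (⋃ n, D n) + 0 := by
      rw [h4, add_zero]; exact h2.trans h1
    exact le_antisymm ((ENNReal.add_le_add_iff_left (measure_ne_top μ _)).1 h5) zero_le
  exact absolutelyContinuous_toFinite volume h3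

lemma loc_of_Ioc {g : ℝ → ℝ} (h : ∀ u v, u < v → IntegrableOn g (Ioc u v)) : LocallyIntegrable g := by
  intro x
  refine ⟨Ioc (x - 1) (x + 1), ?_, h _ _ (by linarith)⟩
  exact mem_of_superset (Ioo_mem_nhds (by linarith : x - 1 < x) (by linarith : x < x + 1)) Ioo_subset_Ioc_self

lemma loc_of_Ph {f : ℝ → ℝ} (hf : AEMeasurable f) (hP : ∀ u v, u < v → ∫⁻ y in Ioc u v, ENNReal.ofReal (Ph |f y|) ≠ ⊤) : LocallyIntegrable f := by
  refine loc_of_Ioc (fun u v huv => ⟨hf.aestronglyMeasurable.restrict, ?_⟩)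
  refine lt_of_le_of_lt (lintegral_mono (fun y => ?_)) (lt_top_iff_ne_top.2 (hP u v huv))
  rw [Real.enorm_eq_ofReal_abs]
  exact ENNReal.ofReal_le_ofReal (Ph_ge (abs_nonneg _))

lemma loc_bf {b f : ℝ → ℝ} (hbm : Measurable b) (hb : LocallyIntegrable b) (hosc : ∀ u v, u < v → ∫ y in Ioc u v, |b y - av b u v| ≤ v - u)
    (hf : AEMeasurable f) (hP : ∀ u v, u < v → ∫⁻ y in Ioc u v, ENNReal.ofReal (Ph |f y|) ≠ ⊤) : LocallyIntegrable (fun y => b y * f y) := by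
  obtain ⟨c, C, hc, hC, HJ⟩ := JN
  refine loc_of_Ioc (fun u v huv => ⟨(hbm.aemeasurable.mul hf).aestronglyMeasurable.restrict, ?_⟩)
  have hJ := HJ b hbm hb hosc u v huv
  set β := av b u v with hβ
  have hpt : ∀ y, ‖b y * f y‖ₑ ≤ ENNReal.ofReal (c⁻¹ + |β|) * ENNReal.ofReal (Ph |f y|) + ENNReal.ofReal c⁻¹ * ENNReal.ofReal (Real.exp (c * |b y - β|)) := by
    intro y
    rw [Real.enorm_eq_ofReal_abs, ← ENNReal.ofReal_mul (by positivity), ← ENNReal.ofReal_mul (by positivity), 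
      ← ENNReal.ofReal_add (mul_nonneg (by positivity) (Ph_nonneg (abs_nonneg _))) (by positivity)]
    apply ENNReal.ofReal_le_ofReal
    rw [abs_mul]
    have h1 : |b y| ≤ |b y - β| + |β| := by
      calc |b y| = |(b y - β) + β| := by ring_nf
        _ ≤ _ := abs_add_le _ _
    have h2 := young (x := c * |b y - β|) (abs_nonneg (f y))
    have h3 : |b y - β| * |f y| ≤ c⁻¹ * (Ph |f y| + Real.exp (c * |b y - β|)) := by
      rw [inv_mul_eq_div, le_div_iff₀ hc]; linarith
    have h4 := Ph_ge (abs_nonneg (f y))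
    have h5 := mul_le_mul_of_nonneg_left h4 (abs_nonneg β)
    have h6 := mul_le_mul_of_nonneg_right h1 (abs_nonneg (f y))
    linarith
  have hm : Measurable fun y => ENNReal.ofReal c⁻¹ * ENNReal.ofReal (Real.exp (c * |b y - β|)) := by fun_prop
  refine lt_of_le_of_lt (lintegral_mono hpt) ?_
  rw [lintegral_add_right _ hm, lintegral_const_mul' _ _ ENNReal.ofReal_ne_top, lintegral_const_mul' _ _ ENNReal.ofReal_ne_top]
  refine ENNReal.add_lt_top.2 ⟨ENNReal.mul_lt_top ENNReal.ofReal_lt_top (lt_top_iff_ne_top.2 (hP u v huv)), ENNReal.mul_lt_top ENNReal.ofReal_lt_top (lt_of_le_of_lt hJ ENNReal.ofReal_lt_top)⟩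

lemma Adiff_cont_loc {g : ℝ → ℝ} (hg : LocallyIntegrable g) (x : ℝ) : Continuous (fun y => Adiff g x y) := by
  have hii : ∀ u v, IntervalIntegrable g volume u v := fun u v => (hg.integrableOn_isCompact isCompact_uIcc).intervalIntegrable
  have h : (fun y => Adiff g x y) = fun y => (∫ t in (0:ℝ)..x, g t) - ∫ t in (0:ℝ)..y, g t := by
    funext y
    unfold Adiff
    rw [intervalIntegral.integral_interval_sub_left (hii _ _) (hii _ _)]
  rw [h]
  exact continuous_const.sub (intervalIntegral.continuous_primitive hii 0)

lemma kA_meas {m : ℕ} {A b : ℝ → ℝ} (hAb : ∀ x y, A x - A y = Adiff b x y) (hbm : Measurable b) (hb : LocallyIntegrable b) {a : Fin m → ℝ → ℝ}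
    (ha : ∀ j, LocallyIntegrable (a j)) (x : ℝ) : Measurable (fun y => kA m A b a x y) := by
  have h : (fun y => kA m A b a x y) = fun y => ((Adiff b x y - b y * (x - y)) * ∏ j, Adiff (a j) x y) / (x - y) ^ (m + 2) := by
    funext y
    unfold kA P2
    rw [hAb x y]
  rw [h]
  have h1 := (Adiff_cont_loc hb x).measurable
  have h2 := fun j => (Adiff_cont_loc (ha j) x).measurable
  have h3 : Measurable fun y => ∏ j, Adiff (a j) x y := Finset.measurable_prod _ (fun j _ => h2 j)
  fun_prop

lemma trunc_union (x : ℝ) : (⋃ n : ℕ, {y | 1 / ((n:ℝ) + 1) < |x - y|}) = {x}ᶜ := by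
  ext y
  simp only [mem_iUnion, mem_ofPred_eq, mem_compl_iff, mem_singleton_iff]
  constructor
  · rintro ⟨n, hn⟩ rfl
    simp at hn
    have : (0:ℝ) ≤ n := Nat.cast_nonneg _
    have : 0 < ((n:ℝ) + 1)⁻¹ := by positivity
    linarith
  · intro h
    exact exists_nat_one_div_lt (abs_pos.2 (sub_ne_zero.2 (Ne.symm h)))

lemma kf_aem {x : ℝ} {k : ℝ → ℝ} (h : ∀ e : ℝ, 0 < e → IntegrableOn k {y | e < |x - y|}) : AEMeasurable k := by
  have h1 : AEMeasurable k (volume.restrict {x}ᶜ) := by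
    rw [← trunc_union x]
    exact aemeasurable_iUnion_iff.2 (fun n => (h _ (by positivity)).aestronglyMeasurable.aemeasurable)
  have : (volume : Measure ℝ).restrict {x}ᶜ = volume := Measure.restrict_eq_self_of_ae_mem (compl_mem_ae_iff.2 (measure_singleton x))
  rwa [this] at h1

lemma GG_congr {m : ℕ} {A b : ℝ → ℝ} {a a' : Fin m → ℝ → ℝ} {f f' : ℝ → ℝ} {x : ℝ} (hx : x ∈ GG m A b a f)
    (h : ∀ᵐ y, kA m A b a x y * f y = kA m A b a' x y * f' y) : x ∈ GG m A b a' f' := by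
  have h1 : ∀ e : ℝ, ∫ y in {y | e < |x - y|}, kA m A b a x y * f y = ∫ y in {y | e < |x - y|}, kA m A b a' x y * f' y :=
    fun e => integral_congr_ae (ae_restrict_of_ae h)
  refine ⟨fun e he => (hx.1 e he).congr (ae_restrict_of_ae h), fun l hl => hx.2 l ?_⟩
  simpa only [h1] using hl

lemma GG_nonmeas {m : ℕ} {w : Fin (m + 1) → ℝ → ℝ} (hw : ∀ i x, 0 ≤ w i x) {ν : Measure ℝ} (hν : ν ≪ volume) {C : ℝ} {A b : ℝ → ℝ} (hW : WeakProp w ν C A b)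
    (hAb : ∀ x y, A x - A y = Adiff b x y) (hbm : Measurable b) (hb : LocallyIntegrable b) (hosc : ∀ u v, u < v → ∫ y in Ioc u v, |b y - av b u v| ≤ v - u)
    {a : Fin m → ℝ → ℝ} {f : ℝ → ℝ} 
    (ha : ∀ j, LocallyIntegrable (a j)) (hP : ∀ u v, u < v → ∫⁻ y in Ioc u v, ENNReal.ofReal (Ph |f y|) ≠ ⊤) :
    ν (GG m A b a f) ≤ ENNReal.ofReal C * RR w a f := by
  obtain ⟨E, hEm, hEa, hE⟩ := max_meas f
  have hfa : AEMeasurable (E.indicator f) := (aemeasurable_indicator_iff hEm).2 hEa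
  have hP' : ∀ u v, u < v → ∫⁻ y in Ioc u v, ENNReal.ofReal (Ph |E.indicator f y|) ≠ ⊤ := fun u v huv =>
    ne_top_of_le_ne_top (hP u v huv) (lintegral_mono (fun y => ENNReal.ofReal_le_ofReal (Ph_ind_le E f y)))
  have hsub : GG m A b a f ⊆ GG m A b a (E.indicator f) := by
    intro x hx
    refine GG_congr hx ?_
    have hk := kA_meas hAb hbm hb ha x
    have hkf := kf_aem hx.1
    set D := {y | kA m A b a x y ≠ 0} with hD
    have hDm : MeasurableSet D := hk (measurableSet_singleton 0).compl
    have hDa : AEMeasurable f (volume.restrict D) := by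
      have h1 : AEMeasurable (fun y => (kA m A b a x y * f y) / kA m A b a x y) (volume.restrict D) := (hkf.div hk.aemeasurable).restrict
      refine h1.congr ?_
      filter_upwards [ae_restrict_mem hDm] with y hy
      exact mul_div_cancel_left₀ _ hy
    have h2 : ∀ᵐ y, y ∉ D \ E := measure_eq_zero_iff_ae_notMem.1 (hE D hDm hDa)
    filter_upwards [h2] with y hy
    by_cases hyE : y ∈ E
    · rw [indicator_of_mem hyE]
    · have : kA m A b a x y = 0 := by
        by_contra h3
        exact hy ⟨h3, hyE⟩
      rw [this]; simp
  refine (measure_mono hsub).trans ((GG_loc hw hν hW hAb hb ha (loc_of_Ph hfa hP') (loc_bf hbm hb hosc hfa hP')).trans ?_)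
  exact mul_le_mul_right (RR_ind hw a f _) _

def cls {m : ℕ} (a : Fin m → ℝ → ℝ) (x : ℝ) : Set ℝ := {y | ∀ j, IntervalIntegrable (a j) volume x y}

lemma cls_refl {m : ℕ} (a : Fin m → ℝ → ℝ) (x : ℝ) : x ∈ cls a x := fun _ => IntervalIntegrable.refl

lemma cls_eq {m : ℕ} {a : Fin m → ℝ → ℝ} {x y : ℝ} (h : y ∈ cls a x) : cls a y = cls a x := by
  ext z
  exact ⟨fun hz j => (h j).trans (hz j), fun hz j => (h j).symm.trans (hz j)⟩

lemma cls_conn {m : ℕ} (a : Fin m → ℝ → ℝ) (x : ℝ) : (cls a x).OrdConnected := by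
  refine ⟨fun y hy z hz t ht j => ?_⟩
  have h1 : IntervalIntegrable (a j) volume y z := (hy j).symm.trans (hz j)
  refine (hy j).trans (h1.mono_set ?_)
  rw [uIcc_of_le ht.1, uIcc_of_le (ht.1.trans ht.2)]
  exact Icc_subset_Icc_right ht.2

lemma cls_aem {m : ℕ} (a : Fin m → ℝ → ℝ) (x : ℝ) (j : Fin m) : AEMeasurable (a j) (volume.restrict (cls a x)) := by
  have h : LocallyIntegrableOn (a j) (cls a x) := by
    intro t ht
    have hl : ∃ y ∈ cls a x, Ici y ∈ nhdsWithin t (cls a x) := by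
      by_cases h : ∃ y ∈ cls a x, y < t
      · obtain ⟨y, hy, hyt⟩ := h
        exact ⟨y, hy, mem_nhdsWithin_of_mem_nhds (Ici_mem_nhds hyt)⟩
      · push Not at h
        exact ⟨t, ht, mem_of_superset self_mem_nhdsWithin h⟩
    have hr : ∃ y ∈ cls a x, Iic y ∈ nhdsWithin t (cls a x) := by
      by_cases h : ∃ y ∈ cls a x, t < y
      · obtain ⟨y, hy, hyt⟩ := h
        exact ⟨y, hy, mem_nhdsWithin_of_mem_nhds (Iic_mem_nhds hyt)⟩
      · push Not at h
        exact ⟨t, ht, mem_of_superset self_mem_nhdsWithin h⟩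
    obtain ⟨y, hy, hy'⟩ := hl
    obtain ⟨z, hz, hz'⟩ := hr
    refine ⟨Ici y ∩ Iic z, inter_mem hy' hz', ?_⟩
    rw [Ici_inter_Iic]
    by_cases hyz : y ≤ z
    · rw [← uIcc_of_le hyz, ← intervalIntegrable_iff']
      exact (hy j).symm.trans (hz j)
    · rw [Icc_eq_empty hyz]; exact integrableOn_empty
  exact h.aestronglyMeasurable.aemeasurable

lemma Adiff_ind_cls {m : ℕ} (a : Fin m → ℝ → ℝ) {x y : ℝ} (hy : y ∈ cls a x) (j : Fin m) :
    Adiff ((cls a x).indicator (a j)) x y = Adiff (a j) x y := by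
  unfold Adiff
  refine intervalIntegral.integral_congr_ae (Eventually.of_forall fun z hz => indicator_of_mem ?_ _)
  exact (cls_conn a x).uIcc_subset hy (cls_refl a x) (uIoc_subset_uIcc hz)

lemma kA_cls {m : ℕ} (A b : ℝ → ℝ) (a : Fin m → ℝ → ℝ) (f : ℝ → ℝ) (x y : ℝ) :
    kA m A b a x y * f y = kA m A b (fun j => (cls a x).indicator (a j)) x y * (cls a x).indicator f y := by
  by_cases hy : y ∈ cls a x
  · simp only [kA, Adiff_ind_cls a hy, indicator_of_mem hy]
  · rw [indicator_of_notMem hy, mul_zero]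
    have : ∃ j, ¬ IntervalIntegrable (a j) volume x y := by
      by_contra h; push Not at h; exact hy h
    obtain ⟨j, hj⟩ := this
    have h0 : Adiff (a j) x y = 0 := intervalIntegral.integral_undef (fun h => hj h.symm)
    unfold kA
    rw [Finset.prod_eq_zero (Finset.mem_univ j) h0]; simp

lemma ind_lint {w : ℝ → ℝ} {g : ℝ → ℝ} {U : Set ℝ} (hU : MeasurableSet U) :
    ∫⁻ y, ENNReal.ofReal (Ph |U.indicator g y| * w y) = ∫⁻ y in U, ENNReal.ofReal (Ph |g y| * w y) := by
  rw [← lintegral_indicator hU]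
  refine lintegral_congr (fun y => ?_)
  by_cases hy : y ∈ U
  · simp only [indicator_of_mem hy]
  · simp only [indicator_of_notMem hy]; simp [Ph]

lemma GG_cls {m : ℕ} {w : Fin (m + 1) → ℝ → ℝ} (hw : ∀ i x, 0 ≤ w i x) {ν : Measure ℝ} (hν : ν ≪ volume) {C : ℝ} {A b : ℝ → ℝ} (hW : WeakProp w ν C A b)
    (hAb : ∀ x y, A x - A y = Adiff b x y) (hbm : Measurable b) (hb : LocallyIntegrable b) (hosc : ∀ u v, u < v → ∫ y in Ioc u v, |b y - av b u v| ≤ v - u)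
    {a : Fin m → ℝ → ℝ} {f : ℝ → ℝ} 
    (hPa : ∀ j, ∀ u v, u < v → ∫⁻ y in Ioc u v, ENNReal.ofReal (Ph |a j y|) ≠ ⊤) (hP : ∀ u v, u < v → ∫⁻ y in Ioc u v, ENNReal.ofReal (Ph |f y|) ≠ ⊤) :
    ν (GG m A b a f) ≤ ENNReal.ofReal C * RR w a f := by
  set u : Set (Set ℝ) := range (fun r : ℚ => cls a r) with hu
  have huc : u.Countable := countable_range _
  have hum : ∀ U ∈ u, MeasurableSet U := by
    rintro U ⟨r, rfl⟩; exact (cls_conn a r).measurableSet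
  have hud : u.PairwiseDisjoint id := by
    rintro U ⟨r, rfl⟩ V ⟨s, rfl⟩ hne
    refine disjoint_left.2 (fun z hz1 hz2 => hne ?_)
    exact (cls_eq hz1).symm.trans (cls_eq hz2)
  have hcover : GG m A b a f ⊆ ⋃ U ∈ u, GG m A b (fun j => U.indicator (a j)) (U.indicator f) := by
    intro x hx
    have hU : cls a x ∈ u := by
      by_contra hc
      have hsing : ∀ y, y ∈ cls a x → y = x := by
        intro y hy
        by_contra hne
        have : ∃ r : ℚ, (r:ℝ) ∈ cls a x := by
          rcases lt_or_gt_of_ne hne with h | h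
          · obtain ⟨r, h1, h2⟩ := exists_rat_btwn h
            exact ⟨r, (cls_conn a x).out hy (cls_refl a x) ⟨h1.le, h2.le⟩⟩
          · obtain ⟨r, h1, h2⟩ := exists_rat_btwn h
            exact ⟨r, (cls_conn a x).out (cls_refl a x) hy ⟨h1.le, h2.le⟩⟩
        obtain ⟨r, hr⟩ := this
        exact hc ⟨r, cls_eq hr⟩
      have hz : ∀ y, kA m A b a x y * f y = 0 := by
        intro y
        by_cases hy : y ∈ cls a x
        · rw [hsing y hy]; simp [kA]
        · rw [kA_cls, indicator_of_notMem hy, mul_zero]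
      have := hx.2 0 (by simp only [hz]; simp)
      simp at this
      linarith
    refine mem_iUnion₂.2 ⟨_, hU, GG_congr hx (Eventually.of_forall (fun y => kA_cls A b a f x y))⟩
  have hone : ∀ U : u, ν (GG m A b (fun j => U.1.indicator (a j)) (U.1.indicator f)) ≤ ENNReal.ofReal C * RR w (fun j => U.1.indicator (a j)) (U.1.indicator f) := by
    rintro ⟨U, hU⟩
    refine GG_nonmeas hw hν hW hAb hbm hb hosc (fun j => ?_) ?_
    · refine loc_of_Ph ((aemeasurable_indicator_iff (hum U hU)).2 ?_) ?_
      · obtain ⟨r, rfl⟩ := hU; exact cls_aem a r j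
      · exact fun u v huv => ne_top_of_le_ne_top (hPa j u v huv) (lintegral_mono (fun y => ENNReal.ofReal_le_ofReal (Ph_ind_le _ _ y)))
    · exact fun u v huv => ne_top_of_le_ne_top (hP u v huv) (lintegral_mono (fun y => ENNReal.ofReal_le_ofReal (Ph_ind_le _ _ y)))
  set g : Fin (m + 1) → ℝ → ℝ := Fin.snoc (α := fun _ => ℝ → ℝ) a f with hg
  have hk : (0:ℝ) ≤ 1 / (m + 1) := by positivity
  calc ν (GG m A b a f) ≤ ν (⋃ U ∈ u, GG m A b (fun j => U.indicator (a j)) (U.indicator f)) := measure_mono hcover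
    _ ≤ ∑' U : u, ν (GG m A b (fun j => U.1.indicator (a j)) (U.1.indicator f)) := measure_biUnion_le _ huc _
    _ ≤ ∑' U : u, ENNReal.ofReal C * RR w (fun j => U.1.indicator (a j)) (U.1.indicator f) := ENNReal.tsum_le_tsum hone
    _ = ENNReal.ofReal C * ∑' U : u, RR w (fun j => U.1.indicator (a j)) (U.1.indicator f) := ENNReal.tsum_mul_left
    _ = ENNReal.ofReal C * ∑' U : u, ∏ i, (∫⁻ y in U.1, ENNReal.ofReal (Ph |g i y| * w i y)) ^ ((1:ℝ) / (m + 1)) := by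
      congr 2
      funext U
      rw [Fin.prod_univ_castSucc]
      simp only [hg, Fin.snoc_castSucc, Fin.snoc_last, RR, ind_lint (hum U.1 U.2)]
    _ ≤ ENNReal.ofReal C * ∏ i, (∑' U : u, ∫⁻ y in U.1, ENNReal.ofReal (Ph |g i y| * w i y)) ^ ((1:ℝ) / (m + 1)) :=
      mul_le_mul_right (holder_sum (fun i (U : u) => ∫⁻ y in U.1, ENNReal.ofReal (Ph |g i y| * w i y))) _
    _ ≤ ENNReal.ofReal C * ∏ i, (∫⁻ y, ENNReal.ofReal (Ph |g i y| * w i y)) ^ ((1:ℝ) / (m + 1)) := by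
      refine mul_le_mul_right (Finset.prod_le_prod' (fun i _ => ENNReal.rpow_le_rpow ?_ hk)) _
      have := lintegral_biUnion (μ := volume) huc (s := id) hum hud (fun y => ENNReal.ofReal (Ph |g i y| * w i y))
      simp only [id] at this
      rw [← this]
      exact setLIntegral_le_lintegral _ _
    _ = ENNReal.ofReal C * RR w a f := by
      rw [Fin.prod_univ_castSucc]
      simp only [hg, Fin.snoc_castSucc, Fin.snoc_last, RR]

lemma GG_zero {m : ℕ} {A b : ℝ → ℝ} {a : Fin m → ℝ → ℝ} {f : ℝ → ℝ}
    (h : ∀ x, x ∈ GG m A b a f → ∀ᵐ y, kA m A b a x y * f y = 0) : GG m A b a f = ∅ := by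
  rw [eq_empty_iff_forall_notMem]
  intro x hx
  have hz : ∀ e : ℝ, ∫ y in {y | e < |x - y|}, kA m A b a x y * f y = 0 := fun e =>
    integral_eq_zero_of_ae (ae_restrict_of_ae (h x hx))
  have := hx.2 0 (by simp only [hz]; exact tendsto_const_nhds)
  simp at this
  linarith

lemma GG_zero_a {m : ℕ} {A b : ℝ → ℝ} {a : Fin m → ℝ → ℝ} {f : ℝ → ℝ} (j : Fin m)
    (h : ∀ u v, u < v → ∫⁻ y in Ioc u v, ENNReal.ofReal (Ph |a j y|) = 0) : GG m A b a f = ∅ := by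
  refine GG_zero (fun x _ => Eventually.of_forall (fun y => ?_))
  have h0 : Adiff (a j) x y = 0 := by
    rcases eq_or_ne x y with rfl | hxy
    · simp [Adiff]
    · have h1 : ENNReal.ofReal (∫ t in Ioc (min y x) (max y x), |a j t|) ≤ 0 := by
        refine (ofReal_int_le (fun t => abs_nonneg _)).trans ?_
        rw [← h (min y x) (max y x) (min_lt_max.2 hxy.symm)]
        exact lintegral_mono (fun t => ENNReal.ofReal_le_ofReal (Ph_ge (abs_nonneg _)))
      have h2 := ENNReal.ofReal_eq_zero.1 (le_antisymm h1 zero_le)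
      have h3 : ‖Adiff (a j) x y‖ ≤ ∫ t in Ioc (min y x) (max y x), |a j t| := intervalIntegral.norm_integral_le_integral_norm_uIoc
      exact norm_le_zero_iff.1 (h3.trans h2)
  unfold kA
  rw [Finset.prod_eq_zero (Finset.mem_univ j) h0]; simp

lemma lint_zero {g : ℝ → ℝ≥0∞} (h : ∀ u v : ℝ, u < v → ∫⁻ y in Ioc u v, g y = 0) : ∫⁻ y, g y = 0 := by
  have hU : (⋃ n : ℕ, Ioc (-((n:ℝ) + 1)) ((n:ℝ) + 1)) = univ := by
    refine eq_univ_of_forall (fun y => ?_)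
    obtain ⟨n, hn⟩ := exists_nat_gt |y|
    have := abs_lt.1 hn
    exact mem_iUnion.2 ⟨n, by constructor <;> linarith⟩
  rw [← setLIntegral_univ, ← hU]
  refine le_antisymm ((lintegral_iUnion_le _ _).trans ?_) zero_le
  rw [ENNReal.tsum_eq_zero.2]
  intro n
  exact h _ _ (by have : (0:ℝ) ≤ n := Nat.cast_nonneg _
                  linarith)

/-- If the kernel is measurable, a vanishing lower integral of `f` kills `k * f`. -/
lemma prod_zero {k f : ℝ → ℝ} (hkf : AEMeasurable (fun y => k y * f y)) (hk : Measurable k) (hf : ∫⁻ y, ENNReal.ofReal (Ph |f y|) = 0) :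
    ∀ᵐ y, k y * f y = 0 := by
  have h1 : ∀ n : ℕ, ∀ᵐ y, |k y| ≤ n → k y * f y = 0 := by
    intro n
    have hm : MeasurableSet {y | |k y| ≤ (n:ℝ)} := measurableSet_le (f := fun y => |k y|) (g := fun _ => (n:ℝ)) (by fun_prop) measurable_const
    have h2 : ∫⁻ y in {y | |k y| ≤ (n:ℝ)}, ‖k y * f y‖ₑ = 0 := by
      refine le_antisymm ?_ zero_le
      calc ∫⁻ y in {y | |k y| ≤ (n:ℝ)}, ‖k y * f y‖ₑ ≤ ∫⁻ y in {y | |k y| ≤ (n:ℝ)}, ENNReal.ofReal n * ENNReal.ofReal (Ph |f y|) := by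
            refine setLIntegral_mono' hm (fun y hy => ?_)
            rw [Real.enorm_eq_ofReal_abs, abs_mul, ENNReal.ofReal_mul (abs_nonneg _)]
            exact mul_le_mul' (ENNReal.ofReal_le_ofReal hy) (ENNReal.ofReal_le_ofReal (Ph_ge (abs_nonneg _)))
        _ ≤ ∫⁻ y, ENNReal.ofReal n * ENNReal.ofReal (Ph |f y|) := setLIntegral_le_lintegral _ _
        _ = 0 := by rw [lintegral_const_mul' _ _ ENNReal.ofReal_ne_top, hf, mul_zero]
    have h3 := (lintegral_eq_zero_iff' hkf.restrict.enorm).1 h2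
    rw [EventuallyEq, ae_restrict_iff' hm] at h3
    filter_upwards [h3] with y hy hyn
    simpa using hy hyn
  filter_upwards [ae_all_iff.2 h1] with y hy
  obtain ⟨n, hn⟩ := exists_nat_gt |k y|
  exact hy n hn.le

lemma Adiff_meas (g : ℝ → ℝ) (x : ℝ) : Measurable (fun y => Adiff g x y) := by
  classical
  set a : Fin 1 → ℝ → ℝ := fun _ => g with ha
  set V := cls a x with hV
  have hxV : x ∈ V := cls_refl a x
  have hc : ContinuousOn (fun y => Adiff g x y) V := by
    intro t ht
    have hl : ∃ y ∈ V, y ≤ t ∧ Ici y ∈ nhdsWithin t V := by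
      by_cases h : ∃ y ∈ V, y < t
      · obtain ⟨y, hy, hyt⟩ := h
        exact ⟨y, hy, hyt.le, mem_nhdsWithin_of_mem_nhds (Ici_mem_nhds hyt)⟩
      · push Not at h
        exact ⟨t, ht, le_rfl, mem_of_superset self_mem_nhdsWithin h⟩
    have hr : ∃ y ∈ V, t ≤ y ∧ Iic y ∈ nhdsWithin t V := by
      by_cases h : ∃ y ∈ V, t < y
      · obtain ⟨y, hy, hyt⟩ := h
        exact ⟨y, hy, hyt.le, mem_nhdsWithin_of_mem_nhds (Iic_mem_nhds hyt)⟩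
      · push Not at h
        exact ⟨t, ht, le_rfl, mem_of_superset self_mem_nhdsWithin h⟩
    obtain ⟨y, hy, hyt, hy'⟩ := hl
    obtain ⟨z, hz, hzt, hz'⟩ := hr
    have hp : min y x ∈ V := by rcases min_choice y x with h | h <;> rw [h] <;> assumption
    have hq : max z x ∈ V := by rcases max_choice z x with h | h <;> rw [h] <;> assumption
    have hpq : min y x ≤ max z x := (min_le_right _ _).trans (le_max_right _ _)
    have hintg : IntervalIntegrable g volume (min y x) (max z x) := (hp 0).symm.trans (hq 0)
    have h1 := (intervalIntegral.continuousOn_primitive_interval' hintg (by rw [uIcc_of_le hpq]; exact ⟨min_le_right _ _, le_max_right _ _⟩ : x ∈ uIcc (min y x) (max z x))).neg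
    have h2 : (fun y => Adiff g x y) = fun y => -∫ t in x..y, g t := by
      funext y; unfold Adiff; rw [intervalIntegral.integral_symm]
    rw [h2]
    refine (h1 t ?_).mono_of_mem_nhdsWithin ?_
    · rw [uIcc_of_le hpq]; exact ⟨(min_le_left _ _).trans hyt, hzt.trans (le_max_left _ _)⟩
    · rw [uIcc_of_le hpq]
      filter_upwards [hy', hz'] with s hs1 hs2
      exact ⟨(min_le_left _ _).trans hs1, (show s ≤ z from hs2).trans (le_max_left _ _)⟩
  have h3 : (fun y => Adiff g x y) = V.piecewise (fun y => Adiff g x y) (fun _ => 0) := by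
    funext y
    by_cases hy : y ∈ V
    · rw [piecewise_eq_of_mem _ _ _ hy]
    · rw [piecewise_eq_of_notMem _ _ _ hy]
      exact intervalIntegral.integral_undef (fun h => hy (fun j => h.symm))
  rw [h3]
  exact hc.measurable_piecewise continuousOn_const (cls_conn a x).measurableSet

lemma GG_final {m : ℕ} {w : Fin (m + 1) → ℝ → ℝ} (hw : ∀ i x, 0 ≤ w i x) {ν : Measure ℝ} (hν : ν ≪ volume) {C : ℝ} (hC : 0 < C) {A b : ℝ → ℝ} (hW : WeakProp w ν C A b)
    (hAb : ∀ x y, A x - A y = Adiff b x y) (hbm : Measurable b) (hb : LocallyIntegrable b) (hosc : ∀ u v, u < v → ∫ y in Ioc u v, |b y - av b u v| ≤ v - u)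
    {Q : ℝ} (h1 : ∀ I : ℝ × ℝ, I.1 < I.2 → ν (ivl I) ≤ ENNReal.ofReal Q * ENNReal.ofReal (I.2 - I.1) * PI w I)
    (a : Fin m → ℝ → ℝ) (f : ℝ → ℝ)  :
    ν (GG m A b a f) ≤ ENNReal.ofReal C * RR w a f := by
  by_cases hν0 : ν = 0
  · rw [hν0]; simp
  have hN : ∃ n : ℕ, ν (Ioc (-((n:ℝ) + 1)) ((n:ℝ) + 1)) ≠ 0 := by
    by_contra hc
    push Not at hc
    have hU : (⋃ n : ℕ, Ioc (-((n:ℝ) + 1)) ((n:ℝ) + 1)) = univ := by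
      refine eq_univ_of_forall (fun y => ?_)
      obtain ⟨n, hn⟩ := exists_nat_gt |y|
      have := abs_lt.1 hn
      exact mem_iUnion.2 ⟨n, by constructor <;> linarith⟩
    exact hν0 (Measure.measure_univ_eq_zero.1 (by rw [← hU]; exact measure_iUnion_null hc))
  obtain ⟨N, hN⟩ := hN
  have key : ∀ (i : Fin (m + 1)) (u v : ℝ), u < v → ∃ c : ℝ≥0∞, c ≠ 0 ∧ ∀ g : ℝ → ℝ, c * ∫⁻ y in Ioc u v, ENNReal.ofReal (Ph |g y|) ≤ ∫⁻ y, ENNReal.ofReal (Ph |g y| * w i y) := by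
    intro i u v huv
    set I : ℝ × ℝ := (min u (-((N:ℝ) + 1)), max v ((N:ℝ) + 1)) with hI
    have hI1 : I.1 < I.2 := (min_le_left _ _).trans_lt (huv.trans_le (le_max_left _ _))
    refine ⟨eI w i I, ?_, fun g => ?_⟩
    · intro h0
      have h2 := h1 I hI1
      have h3 : PI w I = 0 := by
        unfold PI
        refine Finset.prod_eq_zero (Finset.mem_univ i) ?_
        rw [h0, ENNReal.zero_rpow_of_pos (by positivity)]
      rw [h3, mul_zero] at h2
      refine hN (le_antisymm ((measure_mono ?_).trans h2) zero_le)
      exact Ioc_subset_Ioc (min_le_right _ _) (le_max_right _ _)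
    · refine (W4 hw i I (X := Ioc u v) (Ioc_subset_Ioc (min_le_left _ _) (le_max_left _ _)) g).trans (setLIntegral_le_lintegral _ _)
  have kz : ∀ (i : Fin (m + 1)) (g : ℝ → ℝ), ∫⁻ y, ENNReal.ofReal (Ph |g y| * w i y) = 0 → ∀ u v, u < v → ∫⁻ y in Ioc u v, ENNReal.ofReal (Ph |g y|) = 0 := by
    intro i g hg u v huv
    obtain ⟨c, hc, H⟩ := key i u v huv
    have := H g
    rw [hg] at this
    exact (mul_eq_zero.1 (le_antisymm this zero_le)).resolve_left hc
  have kt : ∀ (i : Fin (m + 1)) (g : ℝ → ℝ), ∫⁻ y, ENNReal.ofReal (Ph |g y| * w i y) ≠ ⊤ → ∀ u v, u < v → ∫⁻ y in Ioc u v, ENNReal.ofReal (Ph |g y|) ≠ ⊤ := by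
    intro i g hg u v huv ht
    obtain ⟨c, hc, H⟩ := key i u v huv
    have := H g
    rw [ht, ENNReal.mul_top hc] at this
    exact hg (top_le_iff.1 this)
  by_cases ha0 : ∃ j, ∫⁻ y, ENNReal.ofReal (Ph |a j y| * w j.castSucc y) = 0
  · obtain ⟨j, hj⟩ := ha0
    rw [GG_zero_a j (kz _ _ hj)]; simp
  push Not at ha0
  have hk : (0:ℝ) < 1 / (m + 1) := by positivity
  have hprod0 : (∏ j : Fin m, (∫⁻ y, ENNReal.ofReal (Ph |a j y| * w j.castSucc y)) ^ ((1:ℝ) / (m + 1))) ≠ 0 := by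
    refine Finset.prod_ne_zero_iff.2 (fun j _ h => ?_)
    rcases ENNReal.rpow_eq_zero_iff.1 h with h2 | h2
    · exact ha0 j h2.1
    · linarith [h2.2]
  by_cases hPa : ∀ j, ∀ u v, u < v → ∫⁻ y in Ioc u v, ENNReal.ofReal (Ph |a j y|) ≠ ⊤
  · by_cases hP : ∀ u v, u < v → ∫⁻ y in Ioc u v, ENNReal.ofReal (Ph |f y|) ≠ ⊤
    · exact GG_cls hw hν hW hAb hbm hb hosc hPa hP
    · have hft : ∫⁻ y, ENNReal.ofReal (Ph |f y| * w (Fin.last m) y) = ⊤ := by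
        by_contra h; exact hP (kt _ _ h)
      unfold RR
      rw [hft, ENNReal.top_rpow_of_pos hk, ENNReal.mul_top hprod0, ENNReal.mul_top (by simpa using hC)]
      exact le_top
  · have hat : ∃ j, ∫⁻ y, ENNReal.ofReal (Ph |a j y| * w j.castSucc y) = ⊤ := by
      by_contra h
      push Not at h
      exact hPa (fun j => kt _ _ (h j))
    obtain ⟨j, hj⟩ := hat
    by_cases hf0 : ∫⁻ y, ENNReal.ofReal (Ph |f y| * w (Fin.last m) y) = 0
    · rw [GG_zero (fun x hx => ?_)]
      · simp
      refine prod_zero (kf_aem hx.1) ?_ (lint_zero (kz _ _ hf0))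
      have h2 : kA m A b a x = fun y => ((Adiff b x y - b y * (x - y)) * ∏ j, Adiff (a j) x y) / (x - y) ^ (m + 2) := by
        funext y
        unfold kA P2
        rw [hAb x y]
      rw [h2]
      have h3 := Adiff_meas b x
      have h4 : Measurable fun y => ∏ j, Adiff (a j) x y := Finset.measurable_prod _ (fun j _ => Adiff_meas (a j) x)
      fun_prop
    · unfold RR
      have h2 : (∏ j : Fin m, (∫⁻ y, ENNReal.ofReal (Ph |a j y| * w j.castSucc y)) ^ ((1:ℝ) / (m + 1))) = ⊤ := by
        rw [← Finset.mul_prod_erase _ _ (Finset.mem_univ j), hj, ENNReal.top_rpow_of_pos hk, ENNReal.top_mul]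
        intro h3
        refine hprod0 ?_
        rw [← Finset.mul_prod_erase _ _ (Finset.mem_univ j), h3, mul_zero]
      rw [h2, ENNReal.top_mul, ENNReal.mul_top (by simpa using hC)]
      · exact le_top
      · intro h3
        rcases ENNReal.rpow_eq_zero_iff.1 h3 with h4 | h4
        · exact hf0 h4.1
        · linarith [h4.2]

lemma kA_scale {m : ℕ} (A b : ℝ → ℝ) (a : Fin m → ℝ → ℝ) (f : ℝ → ℝ) {s lam : ℝ} (hs : s ^ (m + 1) = lam) (x y : ℝ) :
    kA m A b (fun j y => a j y / s) x y * (f y / s) = lam⁻¹ * (kA m A b a x y * f y) := by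
  have h1 : ∀ j, Adiff (fun y => a j y / s) x y = Adiff (a j) x y / s := fun j => by
    unfold Adiff; exact intervalIntegral.integral_div _ _
  unfold kA
  simp only [h1, Finset.prod_div_distrib, Finset.prod_const, Finset.card_univ, Fintype.card_fin]
  rw [← hs]
  rw [pow_succ s m, mul_inv]
  ring

lemma mem_GG {m : ℕ} (A b : ℝ → ℝ) (a : Fin m → ℝ → ℝ) (f : ℝ → ℝ) {s lam : ℝ} (hlam : 0 < lam) (hs : s ^ (m + 1) = lam) {x : ℝ}
    (hx : lam < |CcommA m A b a f x|) : x ∈ GG m A b (fun j y => a j y / s) (fun y => f y / s) := by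
  have hC : ∀ l, Tendsto (fun e : ℝ => ∫ y in {y | e < |x - y|}, kA m A b a x y * f y) (nhdsWithin 0 (Ioi 0)) (nhds l) → CcommA m A b a f x = l :=
    fun l hl => hl.limUnder_eq
  have hintg : ∀ e : ℝ, 0 < e → IntegrableOn (fun y => kA m A b a x y * f y) {y | e < |x - y|} := by
    by_contra hc
    push Not at hc
    obtain ⟨e0, he0, hne⟩ := hc
    have h0 : Tendsto (fun e : ℝ => ∫ y in {y | e < |x - y|}, kA m A b a x y * f y) (nhdsWithin 0 (Ioi 0)) (nhds 0) := by
      refine tendsto_const_nhds.congr' ?_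
      filter_upwards [mem_nhdsWithin_of_mem_nhds (Iio_mem_nhds he0)] with e he
      refine (integral_undef (fun h => hne ?_)).symm
      exact IntegrableOn.mono_set h (fun y hy => lt_trans (mem_Iio.1 he) (show e0 < |x - y| from hy))
    rw [hC 0 h0] at hx
    simp at hx
    linarith
  refine ⟨fun e he => ?_, fun l hl => ?_⟩
  · simp only [kA_scale A b a f hs]
    exact (hintg e he).const_mul _
  · simp only [kA_scale A b a f hs, integral_const_mul] at hl
    have h1 := hl.const_mul lam
    simp only [← mul_assoc, mul_inv_cancel₀ hlam.ne', one_mul] at h1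
    rw [hC _ h1, abs_mul, abs_of_pos hlam] at hx
    exact (lt_mul_iff_one_lt_right hlam).1 hx

/-- Theorem 1.3(ii): weighted weak type endpoint estimate for the
generalized Calderón commutator with an `A_{(1,…,1)}` vector weight. -/
theorem weighted_weak_endpoint_CcommA (m : ℕ) (w : Fin (m + 1) → ℝ → ℝ)
    (hw : ∀ i x, 0 ≤ w i x) (hAP : A11const (m + 1) w ≠ ⊤)
    (A A' : ℝ → ℝ) (hA : ∀ x, HasDerivAt A (A' x) x) (hbmo : bmoNorm A' = 1) :
    ∃ C : ℝ, 0 < C ∧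
      ∀ (a : Fin m → ℝ → ℝ) (f : ℝ → ℝ) (lam : ℝ), 0 < lam →
        (∫⁻ x in {x : ℝ | lam < |CcommA m A A' a f x|},
            ENNReal.ofReal (∏ i, w i x ^ ((1 : ℝ) / (m + 1)))) ≤
          ENNReal.ofReal C *
            ((∏ j : Fin m,
              (∫⁻ y, ENNReal.ofReal (|a j y| / lam ^ ((1 : ℝ) / (m + 1)) *
                Real.log (Real.exp 1 + |a j y| / lam ^ ((1 : ℝ) / (m + 1))) *
                  w j.castSucc y)) ^ ((1 : ℝ) / (m + 1))) *
            (∫⁻ y, ENNReal.ofReal (|f y| / lam ^ ((1 : ℝ) / (m + 1)) *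
              Real.log (Real.exp 1 + |f y| / lam ^ ((1 : ℝ) / (m + 1))) *
                w (Fin.last m) y)) ^ ((1 : ℝ) / (m + 1))) := by
  obtain ⟨ν, C, hC, ⟨Q, h1⟩, hν, H⟩ := weak_A hw hAP
  have hb : LocallyIntegrable A' := locInt hA hbmo
  have hbm : Measurable A' := by
    have : A' = deriv A := funext (fun x => (hA x).deriv.symm)
    rw [this]; exact measurable_deriv A
  have hAb := FTC_A hA hb
  have hosc : ∀ u v, u < v → ∫ y in Ioc u v, |A' y - av A' u v| ≤ v - u := fun u v huv => by
    have h := bmo_le hbmo huv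
    rw [inv_mul_le_iff₀ (by linarith), mul_one] at h
    exact h
  have hac : ν ≪ volume := by
    intro s hs
    rw [hν s]; exact setLIntegral_measure_zero s _ hs
  have hW : WeakProp w ν C A A' := H A A' hAb hbm hb hosc
  refine ⟨C, hC, fun a f lam hlam => ?_⟩
  set s : ℝ := lam ^ ((1 : ℝ) / (m + 1)) with hs
  have hs0 : 0 < s := Real.rpow_pos_of_pos hlam _
  have hsm : s ^ (m + 1) = lam := by
    rw [hs, ← Real.rpow_natCast, ← Real.rpow_mul hlam.le]
    have : (1:ℝ) / (m + 1) * ((m + 1 : ℕ) : ℝ) = 1 := by push_cast; field_simp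
    rw [this, Real.rpow_one]
  rw [← hν]
  refine (measure_mono (fun x hx => mem_GG A A' a f hlam hsm hx)).trans ?_
  refine (GG_final hw hac hC hW hAb hbm hb hosc h1 (fun j y => a j y / s) (fun y => f y / s)).trans (le_of_eq ?_)
  simp only [RR, Ph, abs_div, abs_of_pos hs0]
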